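/- Let ε > 0 be small and fixed, T ≥ N ≥ 2 with T^{9/11−10ε} ≤ N ≤ T^{1−ε/10}, and let N(s) = Σ_{n∼N} a_n n^{−s} with divisor-bounded coefficients a_n (|a_n| ≪ d(n)^B for some fixed B). If 5ε ≤ σ ≤ 49/206 − 5ε, then the measure of {t ∈ [−T,T] : |N(1+it)| > N^{−σ}} is ≪ T^{2σ − ε²/5}. -/

import Mathlib

open Finset MeasureTheory

/-- The divisor function grows more slowly than any positive power. -/
lemma exists_card_divisors_le_rpow {η : ℝ} (hη : 0 < η) :
    ∃ C : ℝ, 1 ≤ C ∧ ∀ n : ℕ, 1 ≤ n → (n.divisors.card : ℝ) ≤ C * (n : ℝ) ^ η := by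
  set K : ℝ := max 1 (1 / (η * Real.log 2)) with hK
  have hlog2 : 0 < Real.log 2 := Real.log_pos (by norm_num)
  have hK1 : 1 ≤ K := le_max_left _ _
  have hK2 : 1 ≤ K * (η * Real.log 2) := by
    have : 1 / (η * Real.log 2) ≤ K := le_max_right _ _
    rwa [div_le_iff₀ (by positivity)] at this
  set P : ℕ := ⌈(2 : ℝ) ^ (1 / η)⌉₊ with hP
  have hbern : ∀ (x : ℝ) (a : ℕ), 0 < x → 1 + a * (η * Real.log x) ≤ (x ^ a) ^ η := by
    intro x a hx
    have h1 := Real.add_one_le_exp (a * (η * Real.log x))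
    have h2 : Real.exp (a * (η * Real.log x)) = (x ^ a) ^ η := by
      rw [Real.rpow_def_of_pos (by positivity), Real.log_pow]; ring_nf
    linarith
  have hsmall : ∀ (p a : ℕ), p.Prime → ((a : ℝ) + 1) ≤ K * ((p : ℝ) ^ a) ^ η := by
    intro p a hp
    have hp2 : (2 : ℝ) ≤ p := by exact_mod_cast hp.two_le
    have h1 := hbern 2 a (by norm_num)
    have h2 : ((2 : ℝ) ^ a) ^ η ≤ ((p : ℝ) ^ a) ^ η := by gcongr
    have ha : (0 : ℝ) ≤ a := by positivity
    nlinarith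
  have hlarge : ∀ (p a : ℕ), P ≤ p → ((a : ℝ) + 1) ≤ ((p : ℝ) ^ a) ^ η := by
    intro p a hp
    have h0 : (2 : ℝ) ^ (1 / η) ≤ p := (Nat.le_ceil _).trans (by exact_mod_cast hp)
    have hp0 : (0 : ℝ) < p := lt_of_lt_of_le (by positivity) h0
    have h1 : (2 : ℝ) ≤ (p : ℝ) ^ η := by
      calc (2 : ℝ) = ((2 : ℝ) ^ (1 / η)) ^ η := by
            rw [← Real.rpow_mul (by norm_num), one_div_mul_cancel hη.ne', Real.rpow_one]
        _ ≤ _ := by gcongr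
    have h2 : ((p : ℝ) ^ a) ^ η = ((p : ℝ) ^ η) ^ a := by
      rw [← Real.rpow_natCast, ← Real.rpow_mul hp0.le, ← Real.rpow_natCast, ← Real.rpow_mul hp0.le,
        mul_comm]
    have h3 : (a : ℝ) + 1 ≤ 2 ^ a := by exact_mod_cast Nat.lt_two_pow_self (n := a)
    rw [h2]
    exact h3.trans (by gcongr)
  refine ⟨K ^ P, one_le_pow₀ hK1, fun n hn => ?_⟩
  have hn0 : n ≠ 0 := by omega
  have hfac : (n : ℝ) ^ η = ∏ p ∈ n.primeFactors, ((p : ℝ) ^ n.factorization p) ^ η := by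
    rw [Real.finsetProd_rpow _ _ (fun i _ => by positivity)]
    congr 1
    conv_lhs => rw [← Nat.prod_factorization_pow_eq_self hn0]
    rw [Finsupp.prod, Nat.support_factorization]
    push_cast; rfl
  rw [Nat.card_divisors hn0, hfac]
  push_cast
  have hstep : ∏ p ∈ n.primeFactors, ((n.factorization p : ℝ) + 1) ≤
      ∏ p ∈ n.primeFactors, ((if p < P then K else 1) *
        ((p : ℝ) ^ n.factorization p) ^ η) := by
    refine Finset.prod_le_prod (fun i _ => by positivity) (fun p hp => ?_)
    split_ifs with h
    · exact hsmall p _ (Nat.prime_of_mem_primeFactors hp)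
    · rw [one_mul]; exact hlarge p _ (by omega)
  refine hstep.trans ?_
  rw [Finset.prod_mul_distrib]
  refine mul_le_mul_of_nonneg_right ?_ (Finset.prod_nonneg fun i _ => by positivity)
  rw [Finset.prod_ite, Finset.prod_const, Finset.prod_const_one, mul_one]
  refine pow_le_pow_right₀ hK1 ?_
  calc _ ≤ (Finset.range P).card := Finset.card_le_card fun p hp => by
        simp only [Finset.mem_filter] at hp; exact Finset.mem_range.2 hp.2
    _ = P := Finset.card_range P

/-- The unimodular oscillation `n ^ (i t)`. -/
noncomputable def osc (n : ℕ) (t : ℝ) : ℂ := Complex.exp ((t * Real.log n : ℝ) * Complex.I)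

/-- The Dirichlet polynomial `∑_{n ≤ M} c n * n ^ (i t)`. -/
noncomputable def dirPoly (c : ℕ → ℂ) (M : ℕ) (t : ℝ) : ℂ := ∑ n ∈ Icc 1 M, c n * osc n t

lemma norm_osc (n : ℕ) (t : ℝ) : ‖osc n t‖ = 1 := Complex.norm_exp_ofReal_mul_I _

lemma osc_add (n : ℕ) (t u : ℝ) : osc n (t + u) = osc n t * osc n u := by
  simp only [osc, ← Complex.exp_add]; push_cast; ring_nf

lemma osc_mul {m n : ℕ} (hm : m ≠ 0) (hn : n ≠ 0) (t : ℝ) :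
    osc (m * n) t = osc m t * osc n t := by
  simp only [osc, ← Complex.exp_add]
  rw [Nat.cast_mul, Real.log_mul (by exact_mod_cast hm) (by exact_mod_cast hn)]
  push_cast; ring_nf

lemma conj_osc (n : ℕ) (t : ℝ) : (starRingEnd ℂ) (osc n t) = osc n (-t) := by
  simp only [osc, ← Complex.exp_conj, map_mul, Complex.conj_ofReal, Complex.conj_I]
  push_cast; ring_nf

lemma osc_sub (n : ℕ) (t s : ℝ) : osc n (t - s) = osc n t * (starRingEnd ℂ) (osc n s) := by
  rw [conj_osc, ← osc_add, sub_eq_add_neg]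

@[fun_prop]
lemma continuous_osc (n : ℕ) : Continuous (osc n) := by unfold osc; fun_prop

@[fun_prop]
lemma continuous_dirPoly (c : ℕ → ℂ) (M : ℕ) : Continuous (dirPoly c M) := by
  unfold dirPoly; fun_prop

lemma norm_dirPoly_le (c : ℕ → ℂ) (M : ℕ) (t : ℝ) :
    ‖dirPoly c M t‖ ≤ ∑ n ∈ Icc 1 M, ‖c n‖ := by
  refine (norm_sum_le _ _).trans (le_of_eq (Finset.sum_congr rfl fun n _ => ?_))
  rw [norm_mul, norm_osc, mul_one]

lemma dirPoly_add (c : ℕ → ℂ) (M : ℕ) (t u : ℝ) :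
    dirPoly c M (t + u) = dirPoly (fun n => c n * osc n u) M t := by
  unfold dirPoly
  refine Finset.sum_congr rfl fun n _ => ?_
  rw [osc_add]; ring

/-- The product of two Dirichlet polynomials is a Dirichlet polynomial whose coefficients are
controlled by the divisor function. -/
lemma dirPoly_mul (a b : ℕ → ℂ) (A B : ℕ) {α β κ : ℝ} (hα : 0 ≤ α)
    (ha : ∀ n, 1 ≤ n → ‖a n‖ ≤ α * (n : ℝ) ^ κ) (hb : ∀ n, 1 ≤ n → ‖b n‖ ≤ β * (n : ℝ) ^ κ) :
    ∃ c : ℕ → ℂ, (∀ n, 1 ≤ n → ‖c n‖ ≤ α * β * n.divisors.card * (n : ℝ) ^ κ) ∧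
      ∀ t, dirPoly a A t * dirPoly b B t = dirPoly c (A * B) t := by
  classical
  refine ⟨fun n => ∑ p ∈ (Icc 1 A ×ˢ Icc 1 B) with p.1 * p.2 = n, a p.1 * b p.2, ?_, ?_⟩
  · intro n hn
    refine (norm_sum_le _ _).trans ?_
    have h1 : ∀ p ∈ (Icc 1 A ×ˢ Icc 1 B).filter (fun p : ℕ × ℕ => p.1 * p.2 = n),
        ‖a p.1 * b p.2‖ ≤ α * β * (n : ℝ) ^ κ := by
      intro p hp
      simp only [Finset.mem_filter, Finset.mem_product, Finset.mem_Icc] at hp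
      obtain ⟨⟨⟨h1, _⟩, h2, _⟩, h3⟩ := hp
      rw [norm_mul, ← h3, Nat.cast_mul, Real.mul_rpow (by positivity) (by positivity)]
      calc _ ≤ (α * (p.1 : ℝ) ^ κ) * (β * (p.2 : ℝ) ^ κ) :=
            mul_le_mul (ha _ h1) (hb _ h2) (norm_nonneg _) (by positivity)
        _ = _ := by ring
    refine (Finset.sum_le_card_nsmul _ _ _ h1).trans ?_
    rw [nsmul_eq_mul]
    have hβ : 0 ≤ β := by
      have := (norm_nonneg _).trans (hb 1 le_rfl)
      simpa using this
    have h2 : ((Icc 1 A ×ˢ Icc 1 B).filter (fun p : ℕ × ℕ => p.1 * p.2 = n)).card ≤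
        n.divisors.card := by
      refine Finset.card_le_card_of_injOn (fun p => p.1) ?_ ?_
      · intro p hp
        simp only [Finset.coe_filter, Finset.mem_product, Finset.mem_Icc, Set.mem_ofPred_eq] at hp
        simp only [Finset.mem_coe, Nat.mem_divisors]
        exact ⟨⟨p.2, hp.2.symm⟩, by omega⟩
      · intro p hp q hq hpq
        simp only [Finset.coe_filter, Finset.mem_product, Finset.mem_Icc, Set.mem_ofPred_eq] at hp hq
        simp only at hpq
        refine Prod.ext hpq ?_
        have h3 : p.1 * p.2 = p.1 * q.2 := by rw [hp.2, hpq, hq.2]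
        exact Nat.eq_of_mul_eq_mul_left (by omega) h3
    have h3 : (((Icc 1 A ×ˢ Icc 1 B).filter (fun p : ℕ × ℕ => p.1 * p.2 = n)).card : ℝ) ≤
        n.divisors.card := by exact_mod_cast h2
    calc _ ≤ (n.divisors.card : ℝ) * (α * β * (n : ℝ) ^ κ) := by gcongr
      _ = _ := by ring
  · intro t
    unfold dirPoly
    rw [Finset.sum_mul_sum, ← Finset.sum_product']
    have hmaps : ∀ p ∈ Icc 1 A ×ˢ Icc 1 B, p.1 * p.2 ∈ Icc 1 (A * B) := by
      intro p hp
      simp only [Finset.mem_product, Finset.mem_Icc] at hp ⊢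
      exact ⟨Nat.mul_pos (by omega) (by omega), Nat.mul_le_mul hp.1.2 hp.2.2⟩
    rw [← Finset.sum_fiberwise_of_maps_to hmaps]
    refine Finset.sum_congr rfl fun n _ => ?_
    rw [Finset.sum_mul]
    refine Finset.sum_congr rfl fun p hp => ?_
    simp only [Finset.mem_filter, Finset.mem_product, Finset.mem_Icc] at hp
    rw [← hp.2, osc_mul (by omega) (by omega)]
    ring

/-- Coefficients of powers of a Dirichlet polynomial. -/
lemma exists_dirPoly_pow (κ : ℝ) {η : ℝ} (hη : 0 < η) (k : ℕ) :
    ∃ C : ℝ, 0 ≤ C ∧ ∀ (L : ℕ) (a : ℕ → ℂ), (∀ n, 1 ≤ n → ‖a n‖ ≤ (n : ℝ) ^ κ) →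
      ∃ c : ℕ → ℂ, (∀ n, 1 ≤ n → ‖c n‖ ≤ C * (n : ℝ) ^ (κ + k * η)) ∧
        ∀ t, dirPoly a L t ^ (k + 1) = dirPoly c (L ^ (k + 1)) t := by
  obtain ⟨Cd, hCd1, hCd⟩ := exists_card_divisors_le_rpow hη
  induction k with
  | zero => exact ⟨1, zero_le_one, fun L a ha => ⟨a, by simpa using ha, by simp⟩⟩
  | succ k ih =>
    obtain ⟨C, hC, h⟩ := ih
    refine ⟨C * Cd, by positivity, fun L a ha => ?_⟩
    obtain ⟨c, hc, hc'⟩ := h L a ha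
    obtain ⟨c2, h1, h2⟩ := dirPoly_mul c a (L ^ (k + 1)) L (β := 1) hC hc (fun n hn => by
      refine (ha n hn).trans ?_
      rw [one_mul]
      have : (1 : ℝ) ≤ n := by exact_mod_cast hn
      exact Real.rpow_le_rpow_of_exponent_le this (by
        have : 0 ≤ k * η := by positivity
        linarith))
    refine ⟨c2, fun n hn => (h1 n hn).trans ?_, fun t => ?_⟩
    · have hn0 : (0 : ℝ) < n := by exact_mod_cast hn
      calc _ ≤ C * 1 * (Cd * (n : ℝ) ^ η) * (n : ℝ) ^ (κ + k * η) := by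
            gcongr; exact hCd n hn
        _ = C * Cd * ((n : ℝ) ^ η * (n : ℝ) ^ (κ + k * η)) := by ring
        _ = _ := by rw [← Real.rpow_add hn0]; push_cast; ring_nf
    · rw [pow_succ, hc', h2, ← pow_succ]

lemma norm_dirPoly_sq_eq (c : ℕ → ℂ) (M : ℕ) (t : ℝ) :
    ((‖dirPoly c M t‖ ^ 2 : ℝ) : ℂ) = ∑ n ∈ Icc 1 M, ∑ m ∈ Icc 1 M,
      c n * (starRingEnd ℂ) (c m) * (osc n t * (starRingEnd ℂ) (osc m t)) := by
  push_cast
  rw [← Complex.mul_conj']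
  unfold dirPoly
  rw [map_sum, Finset.sum_mul_sum]
  refine Finset.sum_congr rfl fun n _ => Finset.sum_congr rfl fun m _ => ?_
  rw [map_mul]; ring

lemma abs_log_sub_log_ge {n m M : ℕ} (hn : n ∈ Icc 1 M) (hm : m ∈ Icc 1 M) :
    |(n : ℝ) - m| / M ≤ |Real.log n - Real.log m| := by
  wlog h : m ≤ n generalizing n m
  · rw [abs_sub_comm, abs_sub_comm (Real.log n)]
    exact this hm hn (by omega)
  simp only [Finset.mem_Icc] at hn hm
  have hn0 : (0 : ℝ) < n := by exact_mod_cast hn.1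
  have hm0 : (0 : ℝ) < m := by exact_mod_cast hm.1
  have hM0 : (0 : ℝ) < M := by exact_mod_cast hn.1.trans hn.2
  have hmn : (m : ℝ) ≤ n := by exact_mod_cast h
  rw [abs_of_nonneg (by linarith), abs_of_nonneg (by
    have := Real.log_le_log hm0 hmn; linarith)]
  have h1 := Real.log_le_sub_one_of_pos (div_pos hm0 hn0)
  rw [Real.log_div hm0.ne' hn0.ne'] at h1
  have h2 : ((n : ℝ) - m) / M ≤ (n - m) / n := by
    have : (n : ℝ) ≤ M := by exact_mod_cast hn.2
    apply div_le_div_of_nonneg_left (by linarith) hn0 this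
  have h3 : ((n : ℝ) - m) / n = 1 - m / n := by field_simp
  linarith

lemma integral_gaussian_mul_osc (T : ℝ) (hT : 0 < T) (n m : ℕ) :
    ‖∫ t : ℝ, (Real.exp (-(1 / T ^ 2) * t ^ 2) : ℂ) * (osc n t * (starRingEnd ℂ) (osc m t))‖ =
      Real.sqrt Real.pi * T * Real.exp (-(T ^ 2 * (Real.log n - Real.log m) ^ 2 / 4)) := by
  have h := fourierIntegral_gaussian (b := ((1 / T ^ 2 : ℝ) : ℂ)) (by
    rw [Complex.ofReal_re]; positivity) ((Real.log n - Real.log m : ℝ) : ℂ)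
  have h2 : (fun t : ℝ => (Real.exp (-(1 / T ^ 2) * t ^ 2) : ℂ) *
      (osc n t * (starRingEnd ℂ) (osc m t))) =
      fun x : ℝ => Complex.exp (Complex.I * ((Real.log n - Real.log m : ℝ) : ℂ) * x) *
        Complex.exp (-((1 / T ^ 2 : ℝ) : ℂ) * (x : ℂ) ^ 2) := by
    funext t
    rw [conj_osc, osc, osc, ← Complex.exp_add, mul_comm, Complex.ofReal_exp]
    congr 2
    · push_cast; ring
    · push_cast; ring
  rw [h2, h, norm_mul, Complex.norm_exp]
  congr 1
  · have : ((Real.pi : ℂ) / ((1 / T ^ 2 : ℝ) : ℂ)) = ((Real.pi * T ^ 2 : ℝ) : ℂ) := by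
      push_cast; field_simp
    rw [this, Complex.norm_cpow_eq_rpow_re_of_pos (by positivity)]
    have h4 : (1 / 2 : ℂ).re = 1 / 2 := by norm_num
    rw [h4, ← Real.sqrt_eq_rpow, Real.sqrt_mul (by positivity), Real.sqrt_sq hT.le]
  · congr 1
    have h5 : (-((Real.log n - Real.log m : ℝ) : ℂ) ^ 2 / (4 * ((1 / T ^ 2 : ℝ) : ℂ))) =
      ((-(T ^ 2 * (Real.log n - Real.log m) ^ 2 / 4) : ℝ) : ℂ) := by
      push_cast; field_simp
    rw [h5, Complex.ofReal_re]

/-- A mean value theorem for Dirichlet polynomials. -/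
lemma exists_meanValue_dirPoly : ∃ C : ℝ, 0 < C ∧ ∀ (T : ℝ) (M : ℕ) (c : ℕ → ℂ), 0 < T →
    ∫ t in (-T)..T, ‖dirPoly c M t‖ ^ 2 ≤
      C * (T + (M : ℝ) ^ 2 / T) * ∑ n ∈ Icc 1 M, ‖c n‖ ^ 2 := by
  have hsummable : Summable fun j : ℤ => 1 / (j : ℝ) ^ 2 :=
    Real.summable_one_div_int_pow.2 one_lt_two
  set S : ℝ := ∑' j : ℤ, 1 / (j : ℝ) ^ 2 with hS
  have hS0 : 0 ≤ S := tsum_nonneg fun j => by positivity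
  have hpi : 0 < Real.sqrt Real.pi := Real.sqrt_pos.2 Real.pi_pos
  refine ⟨Real.exp 1 * (Real.sqrt Real.pi * (1 + 4 * S)), by positivity, fun T M c hT => ?_⟩
  set g : ℝ → ℝ := fun t => Real.exp (-(1 / T ^ 2) * t ^ 2) with hg
  have hgint : Integrable g := integrable_exp_neg_mul_sq (by positivity)
  have hgc : Continuous g := by fun_prop
  have hFint : Integrable (fun t => g t * ‖dirPoly c M t‖ ^ 2) := by
    refine hgint.mul_bdd (c := (∑ n ∈ Icc 1 M, ‖c n‖) ^ 2) (by fun_prop) ?_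
    refine Filter.Eventually.of_forall fun t => ?_
    rw [norm_pow, norm_norm]
    exact pow_le_pow_left₀ (norm_nonneg _) (norm_dirPoly_le c M t) 2
  have h1 : ∫ t in (-T)..T, ‖dirPoly c M t‖ ^ 2 ≤
      Real.exp 1 * ∫ t, g t * ‖dirPoly c M t‖ ^ 2 := by
    rw [← integral_const_mul, intervalIntegral.integral_of_le (by linarith)]
    calc _ ≤ ∫ t in Set.Ioc (-T) T, Real.exp 1 * (g t * ‖dirPoly c M t‖ ^ 2) := by
          refine setIntegral_mono_on ?_ (hFint.const_mul _).integrableOn measurableSet_Ioc ?_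
          · exact (Continuous.integrableOn_Icc (by fun_prop)).mono_set Set.Ioc_subset_Icc_self
          · intro t ht
            rw [← mul_assoc, hg, ← Real.exp_add]
            refine le_mul_of_one_le_left (by positivity) (Real.one_le_exp ?_)
            have : t ^ 2 ≤ T ^ 2 := by nlinarith [ht.1, ht.2]
            have h3 : 1 / T ^ 2 * t ^ 2 ≤ 1 := by
              rw [one_div_mul_eq_div, div_le_one (by positivity)]; exact this
            linarith
      _ ≤ _ := setIntegral_le_integral (hFint.const_mul _)
          (Filter.Eventually.of_forall fun t => by positivity)
  refine h1.trans ?_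
  rw [mul_assoc, mul_assoc]
  refine mul_le_mul_of_nonneg_left ?_ (by positivity)
  set K : ℕ → ℕ → ℝ := fun n m => Real.sqrt Real.pi * T *
    Real.exp (-(T ^ 2 * (Real.log n - Real.log m) ^ 2 / 4)) with hK
  have hKsymm : ∀ n m, K n m = K m n := fun n m => by
    simp only [hK]; congr 3; ring
  have h2 : ∫ t, g t * ‖dirPoly c M t‖ ^ 2 ≤
      ∑ n ∈ Icc 1 M, ∑ m ∈ Icc 1 M, ‖c n‖ * ‖c m‖ * K n m := by
    have h3 : ((∫ t, g t * ‖dirPoly c M t‖ ^ 2 : ℝ) : ℂ) =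
        ∑ n ∈ Icc 1 M, ∑ m ∈ Icc 1 M, c n * (starRingEnd ℂ) (c m) *
          ∫ t : ℝ, (Real.exp (-(1 / T ^ 2) * t ^ 2) : ℂ) *
            (osc n t * (starRingEnd ℂ) (osc m t)) := by
      have hint : ∀ n m : ℕ, Integrable fun t : ℝ => c n * (starRingEnd ℂ) (c m) *
          ((Real.exp (-(1 / T ^ 2) * t ^ 2) : ℂ) * (osc n t * (starRingEnd ℂ) (osc m t))) := by
        intro n m
        refine Integrable.const_mul ?_ _
        refine (hgint.ofReal (𝕜 := ℂ)).mul_bdd (c := 1) ?_ ?_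
        · exact ((continuous_osc n).mul
            (Complex.continuous_conj.comp (continuous_osc m))).aestronglyMeasurable
        · refine Filter.Eventually.of_forall fun t => ?_
          rw [norm_mul, RCLike.norm_conj, norm_osc, norm_osc, one_mul]
      simp_rw [← integral_const_mul]
      rw [← integral_complex_ofReal]
      have : ∀ n ∈ Icc 1 M, ∑ m ∈ Icc 1 M, ∫ t : ℝ, c n * (starRingEnd ℂ) (c m) *
          ((Real.exp (-(1 / T ^ 2) * t ^ 2) : ℂ) * (osc n t * (starRingEnd ℂ) (osc m t))) =
          ∫ t : ℝ, ∑ m ∈ Icc 1 M, c n * (starRingEnd ℂ) (c m) *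
          ((Real.exp (-(1 / T ^ 2) * t ^ 2) : ℂ) * (osc n t * (starRingEnd ℂ) (osc m t))) :=
        fun n _ => (integral_finsetSum _ fun m _ => hint n m).symm
      rw [Finset.sum_congr rfl this,
        ← integral_finsetSum _ fun n _ => integrable_finsetSum _ fun m _ => hint n m]
      congr 1
      funext t
      rw [Complex.ofReal_mul, norm_dirPoly_sq_eq, Finset.mul_sum]
      refine Finset.sum_congr rfl fun n _ => ?_
      rw [Finset.mul_sum]
      refine Finset.sum_congr rfl fun m _ => ?_
      ring
    have h4 : 0 ≤ ∫ t, g t * ‖dirPoly c M t‖ ^ 2 :=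
      integral_nonneg fun t => by positivity
    rw [← Complex.norm_of_nonneg h4, h3]
    refine (norm_sum_le _ _).trans (Finset.sum_le_sum fun n _ => ?_)
    refine (norm_sum_le _ _).trans (Finset.sum_le_sum fun m _ => ?_)
    rw [norm_mul, norm_mul, RCLike.norm_conj, integral_gaussian_mul_osc T hT]
  have hKsum : ∀ n ∈ Icc 1 M, ∑ m ∈ Icc 1 M, K n m ≤
      Real.sqrt Real.pi * (1 + 4 * S) * (T + (M : ℝ) ^ 2 / T) := by
    intro n hn
    have hM0 : (0 : ℝ) < M := by
      simp only [Finset.mem_Icc] at hn; exact_mod_cast hn.1.trans hn.2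
    have h5 : ∀ m ∈ Icc 1 M, K n m ≤ Real.sqrt Real.pi * T *
        ((if m = n then 1 else 0) + 4 * M ^ 2 / T ^ 2 * (1 / (((n : ℤ) - m : ℤ) : ℝ) ^ 2)) := by
      intro m hm
      refine mul_le_mul_of_nonneg_left ?_ (by positivity)
      split_ifs with h
      · subst h; simp
      · rw [zero_add]
        have hnm : ((n : ℝ) - m) ≠ 0 := by
          rw [sub_ne_zero]; exact_mod_cast Ne.symm h
        have h6 := abs_log_sub_log_ge hn hm
        have h7 : ((n : ℝ) - m) ^ 2 / M ^ 2 ≤ (Real.log n - Real.log m) ^ 2 := by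
          rw [← sq_abs ((n : ℝ) - m), ← sq_abs (Real.log n - _), ← div_pow]
          exact pow_le_pow_left₀ (by positivity) h6 2
        set x := T ^ 2 * (Real.log n - Real.log m) ^ 2 / 4 with hx
        have hx1 : T ^ 2 * (((n : ℝ) - m) ^ 2 / M ^ 2) / 4 ≤ x := by rw [hx]; gcongr
        have hx0 : 0 < T ^ 2 * (((n : ℝ) - m) ^ 2 / M ^ 2) / 4 := by positivity
        have h8 : Real.exp (-x) ≤ 1 / x := by
          rw [Real.exp_neg, one_div]
          exact inv_anti₀ (hx0.trans_le hx1) (by linarith [Real.add_one_le_exp x])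
        refine h8.trans ((one_div_le_one_div_of_le hx0 hx1).trans (le_of_eq ?_))
        push_cast
        field_simp
    refine (Finset.sum_le_sum h5).trans ?_
    rw [← Finset.mul_sum, Finset.sum_add_distrib, Finset.sum_ite_eq', if_pos hn, ← Finset.mul_sum]
    have h9 : ∑ m ∈ Icc 1 M, (1 / (((n : ℤ) - m : ℤ) : ℝ) ^ 2) ≤ S := by
      have hinj : Set.InjOn (fun m : ℕ => (n : ℤ) - m) (Icc 1 M : Finset ℕ) := by
        intro a _ b _ hab; simp only at hab; omega
      rw [← Finset.sum_image (f := fun j : ℤ => 1 / (j : ℝ) ^ 2) hinj]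
      exact hsummable.sum_le_tsum _ fun j _ => by positivity
    calc _ ≤ Real.sqrt Real.pi * T * (1 + 4 * M ^ 2 / T ^ 2 * S) := by gcongr
      _ = Real.sqrt Real.pi * (T + 4 * S * (M ^ 2 / T)) := by field_simp
      _ ≤ Real.sqrt Real.pi * (T + 4 * S * (M ^ 2 / T)) +
          Real.sqrt Real.pi * (4 * S * T + M ^ 2 / T) :=
        le_add_of_nonneg_right (by positivity)
      _ = _ := by ring
  refine h2.trans ?_
  have h10 : ∑ n ∈ Icc 1 M, ∑ m ∈ Icc 1 M, ‖c n‖ * ‖c m‖ * K n m ≤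
      ∑ n ∈ Icc 1 M, ∑ m ∈ Icc 1 M, (‖c n‖ ^ 2 / 2 * K n m + ‖c m‖ ^ 2 / 2 * K n m) := by
    refine Finset.sum_le_sum fun n _ => Finset.sum_le_sum fun m _ => ?_
    rw [← add_mul]
    refine mul_le_mul_of_nonneg_right ?_ (by positivity)
    nlinarith [sq_nonneg (‖c n‖ - ‖c m‖)]
  refine h10.trans ?_
  simp_rw [Finset.sum_add_distrib]
  rw [Finset.sum_comm (f := fun n m => ‖c m‖ ^ 2 / 2 * K n m)]
  simp_rw [hKsymm _ _]
  rw [← Finset.sum_add_distrib]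
  rw [← mul_assoc, Finset.mul_sum]
  refine Finset.sum_le_sum fun n hn => ?_
  have h11 : ∑ m ∈ Icc 1 M, ‖c n‖ ^ 2 / 2 * K m n = ‖c n‖ ^ 2 / 2 * ∑ m ∈ Icc 1 M, K n m := by
    rw [Finset.mul_sum]; exact Finset.sum_congr rfl fun m _ => by rw [hKsymm]
  have h12 : ∑ m ∈ Icc 1 M, ‖c n‖ ^ 2 / 2 * K n m = ‖c n‖ ^ 2 / 2 * ∑ m ∈ Icc 1 M, K n m := by
    rw [Finset.mul_sum]
  first | rw [h11, h12] | rw [h11] | rw [h12]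
  have := hKsum n hn
  have h13 : (0 : ℝ) ≤ ‖c n‖ ^ 2 := by positivity
  nlinarith

/-- Jensen's inequality for powers. -/
lemma pow_integral_le {α : Type*} [MeasurableSpace α] (μ : Measure α) [IsFiniteMeasure μ]
    (n : ℕ) {f : α → ℝ} (hf0 : ∀ x, 0 ≤ f x) (hf : Integrable f μ)
    (hfn : Integrable (fun x => f x ^ (n + 1)) μ) :
    (∫ x, f x ∂μ) ^ (n + 1) ≤ μ.real Set.univ ^ n * ∫ x, f x ^ (n + 1) ∂μ := by
  rcases eq_or_ne μ 0 with h | h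
  · subst h; simp
  have : NeZero μ := ⟨h⟩
  have hpos : 0 < μ.real Set.univ := by
    rw [measureReal_def]
    exact ENNReal.toReal_pos (by simpa using h) (measure_ne_top _ _)
  have h1 := ConvexOn.map_average_le (μ := μ) (convexOn_pow (𝕜 := ℝ) (n + 1))
    (by fun_prop) isClosed_Ici (Filter.Eventually.of_forall hf0) hf hfn
  rw [average_eq, average_eq, smul_eq_mul, smul_eq_mul, mul_pow] at h1
  calc (∫ x, f x ∂μ) ^ (n + 1) = μ.real Set.univ ^ (n + 1) *
        ((μ.real Set.univ)⁻¹ ^ (n + 1) * (∫ x, f x ∂μ) ^ (n + 1)) := by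
        rw [← mul_assoc, ← mul_pow, mul_inv_cancel₀ hpos.ne', one_pow, one_mul]
    _ ≤ μ.real Set.univ ^ (n + 1) * ((μ.real Set.univ)⁻¹ * ∫ x, f x ^ (n + 1) ∂μ) := by gcongr
    _ = _ := by rw [pow_succ]; field_simp

/-- A bounded continuous function is integrable for a finite measure. -/
lemma Continuous.integrable_of_norm_le {α : Type*} [TopologicalSpace α] [MeasurableSpace α]
    [OpensMeasurableSpace α] [SecondCountableTopology α] {E : Type*} [NormedAddCommGroup E]
    {μ : Measure α} [IsFiniteMeasure μ] {f : α → E} (hf : Continuous f) {C : ℝ}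
    (hC : ∀ x, ‖f x‖ ≤ C) : Integrable f μ := by
  have : SecondCountableTopologyEither α E := by infer_instance
  exact Integrable.of_bound hf.aestronglyMeasurable C (Filter.Eventually.of_forall hC)

/-- Powers of Dirichlet polynomials along continuous shifts are integrable. -/
lemma integrable_norm_dirPoly_pow {α : Type*} [TopologicalSpace α] [MeasurableSpace α]
    [OpensMeasurableSpace α] [SecondCountableTopology α] (μ : Measure α) [IsFiniteMeasure μ]
    (c : ℕ → ℂ) (M k : ℕ) {φ : α → ℝ} (hφ : Continuous φ) :
    Integrable (fun p => ‖dirPoly c M (φ p)‖ ^ k) μ := by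
  refine Continuous.integrable_of_norm_le (C := (∑ n ∈ Icc 1 M, ‖c n‖) ^ k) (by fun_prop) ?_
  intro x
  rw [norm_pow, norm_norm]
  exact pow_le_pow_left₀ (norm_nonneg _) (norm_dirPoly_le c M _) k

/-- Majorant principle for differences. -/
lemma integral_norm_dirPoly_sub_sq_le (μ : Measure ℝ) [IsFiniteMeasure μ] (M : ℕ)
    (c : ℕ → ℂ) (b : ℕ → ℝ) (hcb : ∀ n ∈ Icc 1 M, ‖c n‖ ≤ b n) :
    ∫ p : ℝ × ℝ, ‖dirPoly c M (p.1 - p.2)‖ ^ 2 ∂(μ.prod μ) ≤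
      ∫ p : ℝ × ℝ, ‖dirPoly (fun n => (b n : ℂ)) M (p.1 - p.2)‖ ^ 2 ∂(μ.prod μ) := by
  have key : ∀ c : ℕ → ℂ,
      ((∫ p : ℝ × ℝ, ‖dirPoly c M (p.1 - p.2)‖ ^ 2 ∂(μ.prod μ) : ℝ) : ℂ) =
      ∑ n ∈ Icc 1 M, ∑ m ∈ Icc 1 M, c n * (starRingEnd ℂ) (c m) *
        ((‖∫ t, osc n t * (starRingEnd ℂ) (osc m t) ∂μ‖ ^ 2 : ℝ) : ℂ) := by
    intro c
    have hcont : ∀ n m : ℕ, Continuous fun p : ℝ × ℝ =>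
        osc n (p.1 - p.2) * (starRingEnd ℂ) (osc m (p.1 - p.2)) := fun n m =>
      ((continuous_osc n).comp (by fun_prop)).mul
        (Complex.continuous_conj.comp ((continuous_osc m).comp (by fun_prop)))
    have hint : ∀ n m : ℕ, Integrable (fun p : ℝ × ℝ => c n * (starRingEnd ℂ) (c m) *
        (osc n (p.1 - p.2) * (starRingEnd ℂ) (osc m (p.1 - p.2)))) (μ.prod μ) := by
      intro n m
      refine Integrable.const_mul ((hcont n m).integrable_of_norm_le (C := 1) fun p => ?_) _
      rw [norm_mul, RCLike.norm_conj, norm_osc, norm_osc, one_mul]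
    rw [← integral_complex_ofReal]
    simp_rw [norm_dirPoly_sq_eq]
    rw [integral_finsetSum _ fun n _ => integrable_finsetSum _ fun m _ => hint n m]
    refine Finset.sum_congr rfl fun n _ => ?_
    rw [integral_finsetSum _ fun m _ => hint n m]
    refine Finset.sum_congr rfl fun m _ => ?_
    rw [integral_const_mul]
    congr 1
    have h1 : (fun p : ℝ × ℝ => osc n (p.1 - p.2) * (starRingEnd ℂ) (osc m (p.1 - p.2))) =
        fun p : ℝ × ℝ => (fun t => osc n t * (starRingEnd ℂ) (osc m t)) p.1 *
          (fun t => (starRingEnd ℂ) (osc n t * (starRingEnd ℂ) (osc m t))) p.2 := by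
      funext p
      simp only [osc_sub, map_mul, Complex.conj_conj]
      ring
    rw [h1, integral_prod_mul (fun t => osc n t * (starRingEnd ℂ) (osc m t))
      (fun t => (starRingEnd ℂ) (osc n t * (starRingEnd ℂ) (osc m t))), integral_conj,
      Complex.mul_conj']
    push_cast; rfl
  have h0 : 0 ≤ ∫ p : ℝ × ℝ, ‖dirPoly c M (p.1 - p.2)‖ ^ 2 ∂(μ.prod μ) :=
    integral_nonneg fun p => by positivity
  have h1 : ∫ p : ℝ × ℝ, ‖dirPoly (fun n => (b n : ℂ)) M (p.1 - p.2)‖ ^ 2 ∂(μ.prod μ) =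
      ∑ n ∈ Icc 1 M, ∑ m ∈ Icc 1 M, b n * b m *
        ‖∫ t, osc n t * (starRingEnd ℂ) (osc m t) ∂μ‖ ^ 2 := by
    have := key fun n => (b n : ℂ)
    simp only [Complex.conj_ofReal] at this
    exact_mod_cast this
  rw [h1, ← Complex.norm_of_nonneg h0, key c]
  refine (norm_sum_le _ _).trans (Finset.sum_le_sum fun n hn => ?_)
  refine (norm_sum_le _ _).trans (Finset.sum_le_sum fun m hm => ?_)
  rw [norm_mul, norm_mul, RCLike.norm_conj, Complex.norm_of_nonneg (by positivity)]
  refine mul_le_mul_of_nonneg_right ?_ (by positivity)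
  exact mul_le_mul (hcb n hn) (hcb m hm) (norm_nonneg _) ((norm_nonneg _).trans (hcb n hn))

/-- Euler's integral with a complex scale parameter in the right half-plane. -/
theorem integral_cpow_mul_exp_neg_mul_of_re_pos {a r : ℂ} (ha : 0 < a.re) (hr : 0 < r.re) :
    ∫ y in Set.Ioi (0 : ℝ), (y : ℂ) ^ (a - 1) * Complex.exp (-(r * y)) =
      r ^ (-a) * Complex.Gamma a := by
  have hcont : ∀ b : ℂ, ContinuousOn (fun y : ℝ => (y : ℂ) ^ b) (Set.Ioi 0) := fun b =>
    Complex.continuous_ofReal.continuousOn.cpow_const fun y hy =>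
      Complex.ofReal_mem_slitPlane.2 hy
  have hmeas : ∀ b r : ℂ, AEStronglyMeasurable
      (fun y : ℝ => (y : ℂ) ^ b * Complex.exp (-(r * y))) (volume.restrict (Set.Ioi 0)) :=
    fun b r => ((hcont b).mul (by fun_prop)).aestronglyMeasurable measurableSet_Ioi
  have hnorm : ∀ (b r : ℂ) (y : ℝ), 0 < y → ‖(y : ℂ) ^ b * Complex.exp (-(r * y))‖ =
      y ^ b.re * Real.exp (-(r.re * y)) := by
    intro b r y hy
    rw [norm_mul, Complex.norm_cpow_eq_rpow_re_of_pos hy, Complex.norm_exp]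
    simp
  have hint : ∀ (s δ : ℝ), -1 < s → 0 < δ →
      IntegrableOn (fun y : ℝ => y ^ s * Real.exp (-(δ * y))) (Set.Ioi 0) := by
    intro s δ hs hδ
    have := integrableOn_rpow_mul_exp_neg_mul_rpow (s := s) (p := 1) (b := δ) hs zero_lt_one hδ
    simpa using this
  have hdiff : DifferentiableOn ℂ
      (fun r : ℂ => ∫ y in Set.Ioi (0 : ℝ), (y : ℂ) ^ (a - 1) * Complex.exp (-(r * y)))
      {r : ℂ | 0 < r.re} := by
    intro r hr
    have hr' : 0 < r.re := hr
    refine DifferentiableAt.differentiableWithinAt ?_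
    refine (hasDerivAt_integral_of_dominated_loc_of_deriv_le
      (μ := volume.restrict (Set.Ioi (0 : ℝ)))
      (F := fun (r : ℂ) (y : ℝ) => (y : ℂ) ^ (a - 1) * Complex.exp (-(r * y)))
      (F' := fun (r : ℂ) (y : ℝ) => (y : ℂ) ^ (a - 1) * (Complex.exp (-(r * y)) * (-(1 * y))))
      (bound := fun y => y ^ a.re * Real.exp (-(r.re / 2 * y)))
      (s := Metric.ball r (r.re / 2)) (Metric.ball_mem_nhds r (by positivity)) ?_ ?_ ?_ ?_ ?_ ?_).2.differentiableAt
    · exact Filter.Eventually.of_forall fun s => hmeas _ _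
    · refine Integrable.mono' (hint (a.re - 1) r.re (by linarith) hr') (hmeas _ _) ?_
      filter_upwards [ae_restrict_mem measurableSet_Ioi] with y hy
      rw [hnorm _ _ _ hy]; simp
    · exact ((hcont _).mul (by fun_prop)).aestronglyMeasurable measurableSet_Ioi
    · filter_upwards [ae_restrict_mem measurableSet_Ioi] with y hy s hs
      have hy : 0 < y := hy
      rw [← mul_assoc, norm_mul, hnorm _ _ _ hy]
      have h1 : ‖(-(1 * (y : ℂ)))‖ = y := by simp [abs_of_pos hy]
      rw [h1]
      have h2 : y ^ a.re = y ^ (a - 1).re * y := by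
        rw [← Real.rpow_add_one hy.ne']; simp
      rw [h2]
      have h3 : r.re / 2 ≤ s.re := by
        have := Complex.abs_re_le_norm (s - r)
        rw [Metric.mem_ball, dist_eq_norm] at hs
        rw [Complex.sub_re] at this
        have := neg_abs_le (s.re - r.re)
        linarith
      have h4 : Real.exp (-(s.re * y)) ≤ Real.exp (-(r.re / 2 * y)) := by
        gcongr
      have := Real.rpow_pos_of_pos hy (a - 1).re
      calc _ = y ^ (a - 1).re * y * Real.exp (-(s.re * y)) := by ring
        _ ≤ _ := by gcongr
    · exact hint a.re (r.re / 2) (by linarith) (by positivity)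
    · refine Filter.Eventually.of_forall fun y s hs => ?_
      exact ((((hasDerivAt_id s).mul_const (y : ℂ)).neg).cexp).const_mul _
  have hopen : IsOpen {r : ℂ | 0 < r.re} := isOpen_lt continuous_const Complex.continuous_re
  have hdiff2 : DifferentiableOn ℂ (fun r : ℂ => r ^ (-a) * Complex.Gamma a)
      {r : ℂ | 0 < r.re} := by
    intro r hr
    exact ((differentiableAt_id.cpow_const (Or.inl hr)).mul_const _).differentiableWithinAt
  have hconv : IsPreconnected {r : ℂ | 0 < r.re} :=
    (convex_halfSpace_re_gt 0).isPreconnected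
  refine AnalyticOnNhd.eqOn_of_preconnected_of_frequently_eq (hdiff.analyticOnNhd hopen)
    (hdiff2.analyticOnNhd hopen) hconv (z₀ := 1) (by simp) ?_ hr
  have htend : Filter.Tendsto (fun n : ℕ => (1 : ℂ) + ((1 / ((n : ℝ) + 1) : ℝ) : ℂ)) Filter.atTop
      (nhdsWithin 1 {1}ᶜ) := by
    rw [tendsto_nhdsWithin_iff]
    constructor
    · have h := (Complex.continuous_ofReal.tendsto 0).comp
        (tendsto_one_div_add_atTop_nhds_zero_nat (𝕜 := ℝ))
      simpa using h.const_add (1 : ℂ)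
    · refine Filter.Eventually.of_forall fun n => ?_
      simp only [Set.mem_compl_iff, Set.mem_singleton_iff, add_eq_left]
      have : (1 / ((n : ℝ) + 1)) ≠ 0 := by positivity
      exact_mod_cast this
  refine htend.frequently (Filter.Frequently.of_forall fun n => ?_)
  have hx : 0 < 1 + 1 / ((n : ℝ) + 1) := by positivity
  have h := Complex.integral_cpow_mul_exp_neg_mul_Ioi ha hx
  have hcast : (1 : ℂ) + ((1 / ((n : ℝ) + 1) : ℝ) : ℂ) = ((1 + 1 / ((n : ℝ) + 1) : ℝ) : ℂ) := by
    push_cast; ring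
  simp only [hcast]
  generalize 1 + 1 / ((n : ℝ) + 1) = x at h hx
  have harg : Complex.arg (x : ℂ) ≠ Real.pi := by
    rw [Complex.arg_ofReal_of_nonneg hx.le]; exact Real.pi_pos.ne
  rw [h, one_div, Complex.inv_cpow _ _ harg, ← Complex.cpow_neg]

theorem norm_Gamma_half_add_mul_I_le (τ : ℝ) :
    ‖Complex.Gamma (1 / 2 + τ * Complex.I)‖ ≤ 3 * Real.exp (-(Real.pi * |τ| / 2)) := by
  have h := Complex.Gamma_mul_Gamma_one_sub (1 / 2 + τ * Complex.I)
  have h1 : (1 : ℂ) - (1 / 2 + τ * Complex.I) = (starRingEnd ℂ) (1 / 2 + τ * Complex.I) := by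
    simp only [map_add, map_mul, Complex.conj_ofReal, Complex.conj_I, map_div₀, map_one, map_ofNat]
    ring
  rw [h1, Complex.Gamma_conj, Complex.mul_conj] at h
  have h2 : Complex.sin (Real.pi * (1 / 2 + τ * Complex.I)) = (Real.cosh (Real.pi * τ) : ℝ) := by
    have : (Real.pi : ℂ) * (1 / 2 + τ * Complex.I) =
        Real.pi / 2 - (-((Real.pi * τ : ℝ) : ℂ)) * Complex.I := by push_cast; ring
    rw [this, Complex.sin_pi_div_two_sub, Complex.cos_mul_I, Complex.cosh_neg]
    simp
  rw [h2] at h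
  have h3 : Complex.normSq (Complex.Gamma (1 / 2 + τ * Complex.I)) =
      Real.pi / Real.cosh (Real.pi * τ) := by exact_mod_cast h
  rw [Complex.normSq_eq_norm_sq] at h3
  have h4 : Real.exp (Real.pi * |τ|) / 2 ≤ Real.cosh (Real.pi * τ) := by
    rw [← Real.cosh_abs, abs_mul, abs_of_pos Real.pi_pos, Real.cosh_eq]
    have := Real.exp_pos (-(Real.pi * |τ|))
    linarith
  refine le_of_sq_le_sq ?_ (by positivity)
  rw [h3, mul_pow, ← Real.exp_nat_mul]
  have h5 : ((2 : ℕ) : ℝ) * -(Real.pi * |τ| / 2) = -(Real.pi * |τ|) := by push_cast; ring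
  rw [h5, Real.exp_neg, div_le_iff₀ (Real.cosh_pos _)]
  have h6 := Real.exp_pos (Real.pi * |τ|)
  calc Real.pi ≤ 3 ^ 2 * (Real.exp (Real.pi * |τ|))⁻¹ * (Real.exp (Real.pi * |τ|) / 2) := by
        field_simp; nlinarith [Real.pi_lt_four]
    _ ≤ _ := by gcongr

theorem norm_Gamma_nat_add_half_le (k : ℕ) (τ : ℝ) :
    ‖Complex.Gamma (k + 1 / 2 + τ * Complex.I)‖ ≤
      3 * k.factorial * (1 + |τ|) ^ k * Real.exp (-(Real.pi * |τ| / 2)) := by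
  induction k with
  | zero => simpa using norm_Gamma_half_add_mul_I_le τ
  | succ k ih =>
    have h1 : ((k + 1 : ℕ) : ℂ) + 1 / 2 + τ * Complex.I = (k + 1 / 2 + τ * Complex.I) + 1 := by
      push_cast; ring
    have h2 : (k : ℂ) + 1 / 2 + τ * Complex.I ≠ 0 := by
      intro h
      have := congrArg Complex.re h
      simp at this
      have hk : (0 : ℝ) ≤ k := by positivity
      linarith
    rw [h1, Complex.Gamma_add_one _ h2, norm_mul]
    have h3 : ‖(k : ℂ) + 1 / 2 + τ * Complex.I‖ ≤ (k + 1) * (1 + |τ|) := by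
      calc _ ≤ ‖(k : ℂ)‖ + ‖(1 / 2 : ℂ)‖ + ‖(τ : ℂ) * Complex.I‖ := norm_add₃_le
        _ = k + 1 / 2 + |τ| := by simp
        _ ≤ _ := by
          have : (0 : ℝ) ≤ k := by positivity
          nlinarith [abs_nonneg τ]
    calc _ ≤ ((k + 1) * (1 + |τ|)) *
          (3 * k.factorial * (1 + |τ|) ^ k * Real.exp (-(Real.pi * |τ| / 2))) := by
            gcongr
      _ = _ := by rw [Nat.factorial_succ]; push_cast; ring

theorem norm_cpow_mul_Gamma_le (k : ℕ) {r : ℂ} (hr : 0 ≤ r.re) (hr0 : r ≠ 0) (τ : ℝ) :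
    ‖r ^ (-(k + 1 / 2 + τ * Complex.I)) * Complex.Gamma (k + 1 / 2 + τ * Complex.I)‖ ≤
      3 * k.factorial * (1 + |τ|) ^ k * ‖r‖ ^ (-((k : ℝ) + 1 / 2)) := by
  rw [norm_mul, Complex.norm_cpow_of_ne_zero hr0]
  have harg : |r.arg| ≤ Real.pi / 2 := Complex.abs_arg_le_pi_div_two_iff.2 hr
  have hre : (-((k : ℂ) + 1 / 2 + τ * Complex.I)).re = -((k : ℝ) + 1 / 2) := by simp
  have him : (-((k : ℂ) + 1 / 2 + τ * Complex.I)).im = -τ := by simp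
  rw [hre, him]
  have h1 : -(Real.pi * |τ| / 2) ≤ r.arg * -τ := by
    have : |r.arg * τ| ≤ Real.pi / 2 * |τ| := by rw [abs_mul]; gcongr
    have := le_abs_self (r.arg * τ)
    linarith
  have h2 := norm_Gamma_nat_add_half_le k τ
  have h3 : (0:ℝ) ≤ ‖r‖ ^ (-((k : ℝ) + 1 / 2)) := by positivity
  rw [div_mul_eq_mul_div, div_le_iff₀ (Real.exp_pos _)]
  calc _ ≤ ‖r‖ ^ (-((k : ℝ) + 1 / 2)) *
        (3 * k.factorial * (1 + |τ|) ^ k * Real.exp (r.arg * -τ)) := by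
          gcongr
          refine h2.trans ?_
          gcongr
    _ = _ := by ring

/-- A smooth bump function on the logarithmic scale. -/
noncomputable def logBump : ContDiffBump (0 : ℝ) where
  rIn := 1
  rOut := 2
  rIn_pos := zero_lt_one
  rIn_lt_rOut := one_lt_two

/-- A smooth weight on the positive reals that is `1` on `[1, 2]` and vanishes off
`[exp (-2), exp 2]`. -/
noncomputable def wgt (y : ℝ) : ℝ := if 0 < y then logBump (Real.log y) else 0

theorem wgt_of_pos {y : ℝ} (hy : 0 < y) : wgt y = logBump (Real.log y) := if_pos hy

theorem wgt_nonneg (y : ℝ) : 0 ≤ wgt y := by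
  unfold wgt; split_ifs
  · exact logBump.nonneg
  · exact le_rfl

theorem wgt_le_one (y : ℝ) : wgt y ≤ 1 := by
  unfold wgt; split_ifs
  · exact logBump.le_one
  · exact zero_le_one

theorem wgt_eq_one {y : ℝ} (h1 : 1 ≤ y) (h2 : y ≤ 2) : wgt y = 1 := by
  rw [wgt_of_pos (by linarith)]
  apply logBump.one_of_mem_closedBall
  rw [Metric.mem_closedBall, Real.dist_eq, sub_zero, abs_of_nonneg (Real.log_nonneg h1)]
  change Real.log y ≤ 1
  rw [Real.log_le_iff_le_exp (by linarith)]
  linarith [Real.add_one_le_exp (1 : ℝ)]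

theorem wgt_eq_zero_of_le {y : ℝ} (h : y ≤ Real.exp (-2)) : wgt y = 0 := by
  unfold wgt; split_ifs with hy
  · apply logBump.zero_of_le_dist
    change 2 ≤ dist (Real.log y) 0
    have : Real.log y ≤ -2 := (Real.log_le_iff_le_exp hy).2 h
    rw [Real.dist_eq, sub_zero, abs_of_nonpos (by linarith)]
    linarith
  · rfl

theorem wgt_eq_zero_of_ge {y : ℝ} (h : Real.exp 2 ≤ y) : wgt y = 0 := by
  have hy : 0 < y := (Real.exp_pos 2).trans_le h
  rw [wgt_of_pos hy]
  apply logBump.zero_of_le_dist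
  change 2 ≤ dist (Real.log y) 0
  have : 2 ≤ Real.log y := (Real.le_log_iff_exp_le hy).2 h
  rw [Real.dist_eq, sub_zero]
  exact this.trans (le_abs_self _)

theorem exp_two_lt_eight : Real.exp 2 < 8 := by
  have h := Real.exp_one_lt_d9
  have h1 : Real.exp 2 = Real.exp 1 * Real.exp 1 := by rw [← Real.exp_add]; norm_num
  have := Real.exp_pos 1
  rw [h1]; nlinarith

theorem continuous_wgt : Continuous wgt := by
  rw [continuous_iff_continuousAt]
  intro y
  rcases lt_or_ge y (Real.exp (-2)) with h | h
  · have : wgt =ᶠ[nhds y] fun _ => 0 := by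
      filter_upwards [Iio_mem_nhds h] with z hz
      exact wgt_eq_zero_of_le (le_of_lt hz)
    exact this.continuousAt
  · have hy : 0 < y := (Real.exp_pos _).trans_le h
    have : wgt =ᶠ[nhds y] fun z => logBump (Real.log z) := by
      filter_upwards [Ioi_mem_nhds hy] with z hz
      exact wgt_of_pos hz
    rw [continuousAt_congr this]
    exact logBump.continuous.continuousAt.comp (Real.continuousAt_log hy.ne')

theorem hasCompactSupport_wgt : HasCompactSupport wgt := by
  refine HasCompactSupport.intro (isCompact_Icc (a := Real.exp (-2)) (b := Real.exp 2)) ?_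
  intro y hy
  rw [Set.mem_Icc, not_and_or, not_le, not_le] at hy
  rcases hy with h | h
  · exact wgt_eq_zero_of_le h.le
  · exact wgt_eq_zero_of_ge h.le

theorem integrable_wgt : Integrable wgt :=
  continuous_wgt.integrable_of_hasCompactSupport hasCompactSupport_wgt

/-- The Schwartz function `v ↦ exp (c v) * logBump v`. -/
noncomputable def expBump (c : ℝ) : SchwartzMap ℝ ℂ :=
  HasCompactSupport.toSchwartzMap
    (f := fun v : ℝ => ((Real.exp (c * v) * logBump v : ℝ) : ℂ))
    (by
      have h : HasCompactSupport fun v : ℝ => Real.exp (c * v) * logBump v :=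
        logBump.hasCompactSupport.mul_left
      exact h.comp_left (g := fun x : ℝ => (x : ℂ)) (by simp))
    (by
      have h1 : ContDiff ℝ ⊤ (fun v : ℝ => Real.exp (c * v)) := by fun_prop
      exact Complex.ofRealCLM.contDiff.comp ((h1.of_le le_top).mul logBump.contDiff))

theorem expBump_apply (c v : ℝ) : expBump c v = ((Real.exp (c * v) * logBump v : ℝ) : ℂ) := rfl

open FourierTransform in
/-- The Fourier transform of `expBump`. -/
noncomputable def expBumpHat (c : ℝ) : SchwartzMap ℝ ℂ := 𝓕 (expBump c)

open FourierTransform in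
theorem integral_expBumpHat_mul (c v : ℝ) :
    ∫ ω : ℝ, expBumpHat c ω * Complex.exp ((2 * Real.pi * ω * v : ℝ) * Complex.I) =
      expBump c v := by
  have h := congrFun (Continuous.fourierInv_fourier_eq (f := (expBump c : ℝ → ℂ))
    (expBump c).continuous (expBump c).integrable
    (by rw [← SchwartzMap.fourier_coe]; exact (expBumpHat c).integrable)) v
  rw [← h, Real.fourierInv_eq']
  refine integral_congr_ae (Filter.Eventually.of_forall fun ω => ?_)
  simp only [smul_eq_mul, ← SchwartzMap.fourier_coe]
  rw [mul_comm]
  congr 2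
  have : inner ℝ ω v = ω * v := by simp [mul_comm]
  rw [this, mul_assoc]

theorem integrable_mul_norm_expBumpHat (c : ℝ) (k : ℕ) :
    Integrable fun ω : ℝ => (1 + 2 * Real.pi * |ω|) ^ k * ‖expBumpHat c ω‖ := by
  have h0 := (expBumpHat c).integrable_pow_mul volume 0
  have h1 := (expBumpHat c).integrable_pow_mul volume k
  refine Integrable.mono' ((h0.add (h1.const_mul ((2 * Real.pi) ^ k))).const_mul (2 ^ (k - 1))) ?_ ?_
  · have : Continuous fun ω : ℝ => (1 + 2 * Real.pi * |ω|) ^ k * ‖expBumpHat c ω‖ := by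
      have := (expBumpHat c).continuous
      fun_prop
    exact this.aestronglyMeasurable
  · refine Filter.Eventually.of_forall fun ω => ?_
    have h2 : (1 + 2 * Real.pi * |ω|) ^ k ≤ 2 ^ (k - 1) * (1 ^ k + (2 * Real.pi * |ω|) ^ k) :=
      add_pow_le (by positivity) (by positivity) k
    rw [Real.norm_of_nonneg (by positivity)]
    calc _ ≤ 2 ^ (k - 1) * (1 ^ k + (2 * Real.pi * |ω|) ^ k) * ‖expBumpHat c ω‖ := by gcongr
      _ = _ := by simp; ring

/-- The Mellin–Laplace transform of the weight. -/
noncomputable def wgtTransform (t : ℝ) (r : ℂ) : ℂ :=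
  ∫ y in Set.Ioi (0 : ℝ),
    (wgt y : ℂ) * Complex.exp ((t * Real.log y : ℝ) * Complex.I) * Complex.exp (-(r * y))

theorem wgt_mul_exp_eq (k : ℕ) (t : ℝ) {y : ℝ} (hy : 0 < y) :
    (wgt y : ℂ) * Complex.exp ((t * Real.log y : ℝ) * Complex.I) =
      ∫ ω : ℝ, expBumpHat (1 / 2 - k) ω *
        (y : ℂ) ^ (k + 1 / 2 + (t + 2 * Real.pi * ω : ℝ) * Complex.I - 1) := by
  have hy' : (y : ℂ) ≠ 0 := by exact_mod_cast hy.ne'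
  have h1 : ∀ ω : ℝ, expBumpHat (1 / 2 - k) ω *
        (y : ℂ) ^ (k + 1 / 2 + (t + 2 * Real.pi * ω : ℝ) * Complex.I - 1) =
      Complex.exp (((k - 1 / 2) * Real.log y : ℝ)) *
        Complex.exp ((t * Real.log y : ℝ) * Complex.I) * (expBumpHat (1 / 2 - k) ω *
        Complex.exp ((2 * Real.pi * ω * Real.log y : ℝ) * Complex.I)) := by
    intro ω
    rw [Complex.cpow_def_of_ne_zero hy', ← Complex.ofReal_log hy.le, mul_left_comm,
      ← Complex.exp_add, ← Complex.exp_add]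
    congr 2
    push_cast; ring
  simp_rw [h1]
  rw [integral_const_mul, integral_expBumpHat_mul, expBump_apply, wgt_of_pos hy]
  push_cast
  have h2 : Complex.exp ((k - 1 / 2 : ℂ) * (Real.log y : ℂ)) *
      Complex.exp ((1 / 2 - k : ℂ) * (Real.log y : ℂ)) = 1 := by
    rw [← Complex.exp_add, ← add_mul]; simp
  linear_combination (-(logBump (Real.log y) : ℂ) *
    Complex.exp (t * (Real.log y : ℂ) * Complex.I)) * h2

theorem wgtTransform_eq_of_re_pos (k : ℕ) (t : ℝ) {r : ℂ} (hr : 0 < r.re) :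
    wgtTransform t r = ∫ ω : ℝ, expBumpHat (1 / 2 - k) ω *
      (r ^ (-(k + 1 / 2 + (t + 2 * Real.pi * ω : ℝ) * Complex.I)) *
        Complex.Gamma (k + 1 / 2 + (t + 2 * Real.pi * ω : ℝ) * Complex.I)) := by
  have hk : (0 : ℝ) ≤ k := by positivity
  have hmeas : AEStronglyMeasurable (fun p : ℝ × ℝ => (p.1 : ℂ) ^
      ((k : ℂ) + 1 / 2 + (t + 2 * Real.pi * p.2 : ℝ) * Complex.I - 1) * Complex.exp (-(r * p.1)))
      ((volume.restrict (Set.Ioi (0 : ℝ))).prod volume) := by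
    have h1 : Measurable fun p : ℝ × ℝ => (p.1 : ℂ) ^
      ((k : ℂ) + 1 / 2 + (t + 2 * Real.pi * p.2 : ℝ) * Complex.I - 1) :=
      Measurable.pow (by fun_prop) (by fun_prop)
    exact (h1.mul (by fun_prop)).aestronglyMeasurable
  have hG : IntegrableOn (fun y : ℝ => y ^ ((k : ℝ) - 1 / 2) * Real.exp (-(r.re * y)))
      (Set.Ioi 0) := by
    have := integrableOn_rpow_mul_exp_neg_mul_rpow (s := (k : ℝ) - 1 / 2) (p := 1) (b := r.re)
      (by linarith) zero_lt_one hr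
    simpa using this
  have hint : Integrable (fun p : ℝ × ℝ => expBumpHat (1 / 2 - k) p.2 * ((p.1 : ℂ) ^
      ((k : ℂ) + 1 / 2 + (t + 2 * Real.pi * p.2 : ℝ) * Complex.I - 1) * Complex.exp (-(r * p.1))))
      ((volume.restrict (Set.Ioi (0 : ℝ))).prod volume) := by
    refine Integrable.mono' (hG.mul_prod (expBumpHat (1 / 2 - k)).integrable.norm) ?_ ?_
    · exact AEStronglyMeasurable.mul
        ((expBumpHat (1 / 2 - k)).continuous.comp continuous_snd).aestronglyMeasurable hmeas
    · have h0 : ∀ᵐ p : ℝ × ℝ ∂((volume.restrict (Set.Ioi (0 : ℝ))).prod volume), 0 < p.1 :=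
        Measure.quasiMeasurePreserving_fst.ae
          (p := fun x : ℝ => 0 < x) (ae_restrict_mem measurableSet_Ioi)
      filter_upwards [h0] with p hp
      rw [norm_mul, norm_mul, Complex.norm_cpow_eq_rpow_re_of_pos hp, Complex.norm_exp]
      have e1 : ((k : ℂ) + 1 / 2 + (t + 2 * Real.pi * p.2 : ℝ) * Complex.I - 1).re =
          (k : ℝ) - 1 / 2 := by
        simp; ring
      rw [e1]
      simp only [Complex.neg_re, Complex.mul_re, Complex.ofReal_re, Complex.ofReal_im, mul_zero,
        sub_zero]
      apply le_of_eq; ring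
  have h_eq : wgtTransform t r = ∫ y in Set.Ioi (0 : ℝ), ∫ ω : ℝ,
      expBumpHat (1 / 2 - k) ω * ((y : ℂ) ^
      ((k : ℂ) + 1 / 2 + (t + 2 * Real.pi * ω : ℝ) * Complex.I - 1) * Complex.exp (-(r * y))) := by
    unfold wgtTransform
    refine setIntegral_congr_fun measurableSet_Ioi fun y hy => ?_
    rw [wgt_mul_exp_eq k t hy, ← integral_mul_const]
    simp only [mul_assoc]
  rw [h_eq, integral_integral_swap hint]
  refine integral_congr_ae (Filter.Eventually.of_forall fun ω => ?_)
  beta_reduce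
  rw [integral_const_mul, integral_cpow_mul_exp_neg_mul_of_re_pos _ hr]
  simp; linarith

theorem norm_expBumpHat_mul_le (k : ℕ) (t : ℝ) {r r₀ : ℂ} (hr : 0 ≤ r.re) (hr0 : r ≠ 0)
    (hr₀ : r₀ ≠ 0) (h : ‖r₀‖ ≤ ‖r‖) (ω : ℝ) :
    ‖expBumpHat (1 / 2 - k) ω *
      (r ^ (-(k + 1 / 2 + (t + 2 * Real.pi * ω : ℝ) * Complex.I)) *
        Complex.Gamma (k + 1 / 2 + (t + 2 * Real.pi * ω : ℝ) * Complex.I))‖ ≤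
    3 * k.factorial * (1 + |t|) ^ k * ‖r₀‖ ^ (-((k : ℝ) + 1 / 2)) *
      ((1 + 2 * Real.pi * |ω|) ^ k * ‖expBumpHat (1 / 2 - k) ω‖) := by
  rw [norm_mul]
  have h1 := norm_cpow_mul_Gamma_le k hr hr0 (t + 2 * Real.pi * ω)
  have h2 : 1 + |t + 2 * Real.pi * ω| ≤ (1 + |t|) * (1 + 2 * Real.pi * |ω|) := by
    have e : |2 * Real.pi * ω| = 2 * Real.pi * |ω| := by
      rw [abs_mul, abs_of_pos (by positivity)]
    have := abs_add_le t (2 * Real.pi * ω)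
    rw [e] at this
    have : 0 ≤ |t| * (2 * Real.pi * |ω|) := by positivity
    linarith
  have hk : (0 : ℝ) ≤ k := by positivity
  have h3 : ‖r‖ ^ (-((k : ℝ) + 1 / 2)) ≤ ‖r₀‖ ^ (-((k : ℝ) + 1 / 2)) :=
    Real.rpow_le_rpow_of_nonpos (norm_pos_iff.2 hr₀) h (by linarith)
  have h4 : (1 + |t + 2 * Real.pi * ω|) ^ k ≤ (1 + |t|) ^ k * (1 + 2 * Real.pi * |ω|) ^ k := by
    rw [← mul_pow]; gcongr
  calc _ ≤ ‖expBumpHat (1 / 2 - k) ω‖ * (3 * k.factorial *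
        ((1 + |t|) ^ k * (1 + 2 * Real.pi * |ω|) ^ k) * ‖r₀‖ ^ (-((k : ℝ) + 1 / 2))) := by
          gcongr
          refine h1.trans ?_
          gcongr
    _ = _ := by ring

theorem measurable_Gamma_line (k : ℕ) (t : ℝ) : Measurable fun ω : ℝ =>
    Complex.Gamma (k + 1 / 2 + (t + 2 * Real.pi * ω : ℝ) * Complex.I) := by
  refine Continuous.measurable ?_
  rw [continuous_iff_continuousAt]
  intro ω
  refine ContinuousAt.comp (f := fun ω : ℝ =>
    ((k : ℂ) + 1 / 2 + (t + 2 * Real.pi * ω : ℝ) * Complex.I)) ?_ (by fun_prop)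
  refine (Complex.differentiableAt_Gamma _ fun m h => ?_).continuousAt
  have := congrArg Complex.re h
  simp at this
  have h1 : (0 : ℝ) ≤ k := by positivity
  have h2 : (0 : ℝ) ≤ m := by positivity
  linarith

theorem integrable_expBumpHat_mul (k : ℕ) (t : ℝ) {r : ℂ} (hr : 0 ≤ r.re) (hr0 : r ≠ 0) :
    Integrable fun ω : ℝ => expBumpHat (1 / 2 - k) ω *
      (r ^ (-(k + 1 / 2 + (t + 2 * Real.pi * ω : ℝ) * Complex.I)) *
        Complex.Gamma (k + 1 / 2 + (t + 2 * Real.pi * ω : ℝ) * Complex.I)) := by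
  refine Integrable.mono' ((integrable_mul_norm_expBumpHat _ k).const_mul _) ?_
    (Filter.Eventually.of_forall fun ω => norm_expBumpHat_mul_le k t hr hr0 hr0 le_rfl ω)
  refine ((expBumpHat (1 / 2 - k)).continuous.measurable.mul
    (Measurable.mul ?_ (measurable_Gamma_line k t))).aestronglyMeasurable
  exact Measurable.const_pow (by fun_prop) _

theorem wgtTransform_eq (k : ℕ) (t : ℝ) {r : ℂ} (hr : 0 ≤ r.re) (hr0 : r ≠ 0) :
    wgtTransform t r = ∫ ω : ℝ, expBumpHat (1 / 2 - k) ω *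
      (r ^ (-(k + 1 / 2 + (t + 2 * Real.pi * ω : ℝ) * Complex.I)) *
        Complex.Gamma (k + 1 / 2 + (t + 2 * Real.pi * ω : ℝ) * Complex.I)) := by
  have hslit : r ∈ Complex.slitPlane := by
    rw [Complex.mem_slitPlane_iff]
    rcases hr.lt_or_eq with h | h
    · exact Or.inl h
    · exact Or.inr fun h' => hr0 (Complex.ext h.symm h')
  have hd : ∀ n : ℕ, 0 < 1 / ((n : ℝ) + 1) := fun n => by positivity
  let u : ℕ → ℂ := fun n => r + ((1 / ((n : ℝ) + 1) : ℝ) : ℂ)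
  have hu : Filter.Tendsto u Filter.atTop (nhds r) := by
    have h := (Complex.continuous_ofReal.tendsto 0).comp
      (tendsto_one_div_add_atTop_nhds_zero_nat (𝕜 := ℝ))
    have h' := h.const_add r
    rw [Complex.ofReal_zero, add_zero] at h'
    exact h'
  have hure : ∀ n, (u n).re = r.re + 1 / ((n : ℝ) + 1) := fun n => by
    simp only [u, Complex.add_re, Complex.ofReal_re]
  have huim : ∀ n, (u n).im = r.im := fun n => by
    simp only [u, Complex.add_im, Complex.ofReal_im, add_zero]
  have hre : ∀ n, 0 < (u n).re := fun n => by rw [hure]; linarith [hd n]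
  have hu0 : ∀ n, u n ≠ 0 := fun n h => by
    have := hre n; rw [h] at this; simp at this
  have hnorm : ∀ n, ‖r‖ ≤ ‖u n‖ := fun n => by
    refine le_of_sq_le_sq ?_ (norm_nonneg _)
    rw [← Complex.normSq_eq_norm_sq, ← Complex.normSq_eq_norm_sq, Complex.normSq_apply,
      Complex.normSq_apply, hure, huim]
    nlinarith [hd n]
  have hL : Filter.Tendsto (fun n => wgtTransform t (u n)) Filter.atTop
      (nhds (wgtTransform t r)) := by
    refine tendsto_integral_of_dominated_convergence wgt ?_ integrable_wgt.integrableOn ?_ ?_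
    · intro n
      have h1 : Measurable fun y : ℝ => (wgt y : ℂ) :=
        (Complex.continuous_ofReal.comp continuous_wgt).measurable
      refine Measurable.aestronglyMeasurable ?_
      exact (h1.mul (by fun_prop)).mul (by fun_prop)
    · intro n
      filter_upwards [ae_restrict_mem measurableSet_Ioi] with y hy
      have hy : 0 < y := hy
      rw [norm_mul, norm_mul, Complex.norm_exp_ofReal_mul_I, Complex.norm_real, mul_one,
        Real.norm_of_nonneg (wgt_nonneg y), Complex.norm_exp]
      refine mul_le_of_le_one_right (wgt_nonneg y) ?_
      rw [Real.exp_le_one_iff]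
      simp only [Complex.neg_re, Complex.mul_re, Complex.ofReal_re, Complex.ofReal_im, mul_zero,
        sub_zero, Left.neg_nonpos_iff]
      have := hre n; positivity
    · refine Filter.Eventually.of_forall fun y => ?_
      have : Continuous fun r : ℂ => (wgt y : ℂ) * Complex.exp ((t * Real.log y : ℝ) * Complex.I) *
          Complex.exp (-(r * y)) := by fun_prop
      exact (this.tendsto r).comp hu
  have hfun : ∀ n, wgtTransform t (u n) = _ := fun n => wgtTransform_eq_of_re_pos k t (hre n)
  simp_rw [hfun] at hL
  refine tendsto_nhds_unique hL ?_
  refine tendsto_integral_of_dominated_convergence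
    (fun ω => 3 * k.factorial * (1 + |t|) ^ k * ‖r‖ ^ (-((k : ℝ) + 1 / 2)) *
      ((1 + 2 * Real.pi * |ω|) ^ k * ‖expBumpHat (1 / 2 - k) ω‖)) ?_ 
      ((integrable_mul_norm_expBumpHat _ k).const_mul _) ?_ ?_
  · intro n
    refine Measurable.aestronglyMeasurable ?_
    refine (expBumpHat (1 / 2 - k)).continuous.measurable.mul (Measurable.mul ?_ (measurable_Gamma_line k t))
    exact Measurable.const_pow (by fun_prop) _
  · intro n
    refine Filter.Eventually.of_forall fun ω => ?_
    exact norm_expBumpHat_mul_le k t (hre n).le (hu0 n) hr0 (hnorm n) ω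
  · refine Filter.Eventually.of_forall fun ω => ?_
    refine Filter.Tendsto.const_mul _ (Filter.Tendsto.mul_const _ ?_)
    exact (continuousAt_cpow_const hslit).tendsto.comp hu

theorem exists_norm_wgtTransform_le (k : ℕ) : ∃ C : ℝ, 0 < C ∧ ∀ (t : ℝ) (r : ℂ), 0 ≤ r.re →
    r ≠ 0 → ‖wgtTransform t r‖ ≤ C * (1 + |t|) ^ k * ‖r‖ ^ (-((k : ℝ) + 1 / 2)) := by
  have h0 : 0 ≤ ∫ ω : ℝ, (1 + 2 * Real.pi * |ω|) ^ k * ‖expBumpHat (1 / 2 - k) ω‖ :=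
    integral_nonneg fun ω => by positivity
  refine ⟨3 * k.factorial *
    (∫ ω : ℝ, (1 + 2 * Real.pi * |ω|) ^ k * ‖expBumpHat (1 / 2 - k) ω‖) + 1, by positivity, ?_⟩
  intro t r hr hr0
  rw [wgtTransform_eq k t hr hr0]
  refine (norm_integral_le_of_norm_le ((integrable_mul_norm_expBumpHat _ k).const_mul _)
    (Filter.Eventually.of_forall fun ω =>
      norm_expBumpHat_mul_le k t hr hr0 hr0 le_rfl ω)).trans ?_
  rw [integral_const_mul]
  have : 0 ≤ (1 + |t|) ^ k * ‖r‖ ^ (-((k : ℝ) + 1 / 2)) := by positivity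
  nlinarith

theorem exists_norm_wgtTransform_zero_le : ∃ C : ℝ, 0 < C ∧ ∀ t : ℝ,
    ‖wgtTransform t 0‖ ≤ C / (1 + t ^ 2) := by
  have h : ∀ t : ℝ, wgtTransform t 0 = expBumpHat (-1) (t / (2 * Real.pi)) := by
    intro t
    have h1 : wgtTransform t 0 = mellin (fun y : ℝ => (wgt y : ℂ)) (1 + t * Complex.I) := by
      unfold wgtTransform mellin
      refine setIntegral_congr_fun measurableSet_Ioi fun y hy => ?_
      have hy : 0 < y := hy
      have hy' : (y : ℂ) ≠ 0 := by exact_mod_cast hy.ne'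
      simp only [zero_mul, neg_zero, Complex.exp_zero, mul_one, smul_eq_mul]
      rw [Complex.cpow_def_of_ne_zero hy', ← Complex.ofReal_log hy.le, mul_comm]
      congr 2
      push_cast; ring
    rw [h1, mellin_eq_fourier]
    unfold expBumpHat
    rw [SchwartzMap.fourier_coe]
    have h2 : (fun u : ℝ => Real.exp (-(1 + t * Complex.I : ℂ).re * u) •
        ((wgt (Real.exp (-u)) : ℝ) : ℂ)) = expBump (-1) := by
      funext u
      rw [expBump_apply, wgt_of_pos (Real.exp_pos _), Real.log_exp, ContDiffBump.neg]
      simp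
    rw [h2]
    simp
  obtain ⟨C0, hC0, h0⟩ := (expBumpHat (-1)).decay 0 0
  obtain ⟨C2, hC2, h2⟩ := (expBumpHat (-1)).decay 2 0
  refine ⟨C0 + (2 * Real.pi) ^ 2 * C2, by positivity, fun t => ?_⟩
  rw [h, le_div_iff₀ (by positivity)]
  have a0 := h0 (t / (2 * Real.pi))
  have a2 := h2 (t / (2 * Real.pi))
  simp only [pow_zero, one_mul, norm_iteratedFDeriv_zero] at a0 a2
  rw [Real.norm_eq_abs, sq_abs, div_pow] at a2
  have hpi : 0 < (2 * Real.pi) ^ 2 := by positivity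
  rw [div_mul_eq_mul_div, div_le_iff₀ hpi] at a2
  linarith

theorem ofReal_mul_cpow {x : ℝ} (hx : 0 < x) {z : ℂ} (hz : z ≠ 0) (s : ℂ) :
    ((x : ℂ) * z) ^ s = (x : ℂ) ^ s * z ^ s := by
  have hx' : (x : ℂ) ≠ 0 := by exact_mod_cast hx.ne'
  rw [Complex.cpow_def_of_ne_zero (mul_ne_zero hx' hz), Complex.cpow_def_of_ne_zero hx',
    Complex.cpow_def_of_ne_zero hz, Complex.log_ofReal_mul hx hz, Complex.ofReal_log hx.le,
    add_mul, Complex.exp_add]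

theorem norm_dirPoly_neg (c : ℕ → ℝ) (M : ℕ) (t : ℝ) :
    ‖dirPoly (fun n => (c n : ℂ)) M (-t)‖ = ‖dirPoly (fun n => (c n : ℂ)) M t‖ := by
  rw [← Complex.norm_conj]
  congr 1
  simp [dirPoly, map_sum, conj_osc]

/-- The coefficients `n ^ (-1/2)`. -/
noncomputable def invSqrt (n : ℕ) : ℝ := (n : ℝ) ^ (-(1 / 2) : ℝ)

theorem sum_cpow_mul_Gamma (L : ℕ) {r : ℂ} (hr0 : r ≠ 0) (τ : ℝ) :
    ∑ m ∈ Icc 1 L, (((m : ℝ) : ℂ) * r) ^ (-(((0 : ℕ) : ℂ) + 1 / 2 + τ * Complex.I)) *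
      Complex.Gamma (((0 : ℕ) : ℂ) + 1 / 2 + τ * Complex.I) =
    r ^ (-(((0 : ℕ) : ℂ) + 1 / 2 + τ * Complex.I)) *
      Complex.Gamma (((0 : ℕ) : ℂ) + 1 / 2 + τ * Complex.I) *
      dirPoly (fun n => (invSqrt n : ℂ)) L (-τ) := by
  unfold dirPoly
  rw [mul_sum]
  refine sum_congr rfl fun m hm => ?_
  have hm : (0 : ℝ) < m := by
    have := (mem_Icc.1 hm).1
    exact_mod_cast this
  rw [ofReal_mul_cpow hm hr0]
  have h1 : ((m : ℝ) : ℂ) ^ (-(((0 : ℕ) : ℂ) + 1 / 2 + τ * Complex.I)) =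
      (invSqrt m : ℂ) * osc m (-τ) := by
    have hm' : ((m : ℝ) : ℂ) ≠ 0 := by exact_mod_cast hm.ne'
    rw [invSqrt, Complex.ofReal_cpow hm.le, osc, Complex.cpow_def_of_ne_zero hm',
      Complex.cpow_def_of_ne_zero hm', ← Complex.exp_add, ← Complex.ofReal_log hm.le]
    congr 1
    push_cast; ring
  rw [h1]; ring

theorem norm_sum_wgtTransform_le (t : ℝ) (L : ℕ) {r : ℂ} (hr : 0 ≤ r.re) (hr0 : r ≠ 0) :
    ‖∑ m ∈ Icc 1 L, wgtTransform t (((m : ℝ) : ℂ) * r)‖ ≤ 3 * ‖r‖ ^ (-(1 / 2) : ℝ) *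
      ∫ ω : ℝ, ‖expBumpHat (1 / 2) ω‖ *
        ‖dirPoly (fun n => (invSqrt n : ℂ)) L (t + 2 * Real.pi * ω)‖ := by
  have hpos : ∀ m ∈ Icc 1 L, (0 : ℝ) < m := fun m hm => by
    have := (mem_Icc.1 hm).1
    exact_mod_cast this
  have h1 : ∀ m ∈ Icc 1 L, wgtTransform t (((m : ℝ) : ℂ) * r) = _ := fun m hm =>
    wgtTransform_eq 0 t (r := ((m : ℝ) : ℂ) * r)
      (by rw [Complex.re_ofReal_mul]; have := hpos m hm; positivity)
      (mul_ne_zero (by exact_mod_cast (hpos m hm).ne') hr0)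
  have hint : ∀ m ∈ Icc 1 L, Integrable fun ω : ℝ => expBumpHat (1 / 2 - (0 : ℕ)) ω *
      ((((m : ℝ) : ℂ) * r) ^ (-(((0 : ℕ) : ℂ) + 1 / 2 + (t + 2 * Real.pi * ω : ℝ) * Complex.I)) *
      Complex.Gamma (((0 : ℕ) : ℂ) + 1 / 2 + (t + 2 * Real.pi * ω : ℝ) * Complex.I)) := by
    intro m hm
    have hm0 : ((m : ℝ) : ℂ) * r ≠ 0 := mul_ne_zero (by exact_mod_cast (hpos m hm).ne') hr0
    have hmre : 0 ≤ (((m : ℝ) : ℂ) * r).re := by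
      rw [Complex.re_ofReal_mul]; have := hpos m hm; positivity
    exact integrable_expBumpHat_mul 0 t hmre hm0
  rw [sum_congr rfl h1, ← integral_finsetSum _ hint, ← integral_const_mul]
  refine norm_integral_le_of_norm_le ?_ (Filter.Eventually.of_forall fun ω => ?_)
  · refine Integrable.const_mul ?_ _
    refine Integrable.mono' ((expBumpHat (1 / 2)).integrable.norm.mul_const
      (∑ n ∈ Icc 1 L, ‖(invSqrt n : ℂ)‖)) ?_ (Filter.Eventually.of_forall fun ω => ?_)
    · have := (expBumpHat (1 / 2)).continuous
      exact Continuous.aestronglyMeasurable (by fun_prop)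
    · rw [Real.norm_of_nonneg (by positivity)]
      gcongr
      exact norm_dirPoly_le _ _ _
  · rw [← mul_sum, sum_cpow_mul_Gamma L hr0, norm_mul, norm_mul, norm_dirPoly_neg]
    have h2 := norm_cpow_mul_Gamma_le 0 hr hr0 (t + 2 * Real.pi * ω)
    simp only [Nat.factorial_zero, Nat.cast_one, mul_one, pow_zero, CharP.cast_eq_zero,
      zero_add, sub_zero] at h2 ⊢
    calc _ ≤ ‖expBumpHat (1 / 2) ω‖ * (3 * ‖r‖ ^ (-(1 / 2) : ℝ) *
          ‖dirPoly (fun n => (invSqrt n : ℂ)) L (t + 2 * Real.pi * ω)‖) := by gcongr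
      _ = _ := by ring

/-- A smooth function on the line interpolating `wgt (n / N) * osc n t`. -/
noncomputable def wgtOsc (N : ℕ) (t x : ℝ) : ℂ :=
  (wgt (x / N) : ℂ) * Complex.exp ((t * Real.log x : ℝ) * Complex.I)

open FourierTransform in
theorem fourier_wgtOsc {N : ℕ} (hN : 0 < N) (t ξ : ℝ) :
    𝓕 (wgtOsc N t) ξ =
      N * osc N t * wgtTransform t (2 * Real.pi * N * ξ * Complex.I) := by
  have hN' : (0 : ℝ) < N := by exact_mod_cast hN
  rw [Real.fourier_eq']
  have h1 := Measure.integral_comp_mul_left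
    (fun v : ℝ => Complex.exp (((-2 * Real.pi * inner ℝ v ξ : ℝ) : ℂ) * Complex.I) •
      wgtOsc N t v) (N : ℝ)
  rw [abs_of_pos (inv_pos.2 hN')] at h1
  have h2 : (∫ v : ℝ, Complex.exp (((-2 * Real.pi * inner ℝ v ξ : ℝ) : ℂ) * Complex.I) •
      wgtOsc N t v) = (N : ℂ) * ∫ x : ℝ,
        Complex.exp (((-2 * Real.pi * inner ℝ (N * x) ξ : ℝ) : ℂ) * Complex.I) •
      wgtOsc N t (N * x) := by
    rw [h1, Complex.real_smul, ← mul_assoc]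
    have : (N : ℂ) ≠ 0 := by exact_mod_cast hN.ne'
    push_cast
    rw [mul_inv_cancel₀ this, one_mul]
  rw [h2, mul_assoc]
  congr 1
  unfold wgtTransform
  rw [← integral_const_mul]
  refine (setIntegral_eq_integral_of_forall_compl_eq_zero (s := Set.Ioi (0 : ℝ))
    fun x hx => ?_).symm.trans ?_
  · have hx : x ≤ 0 := not_lt.1 hx
    have : wgt (N * x / N) = 0 := by
      rw [mul_div_cancel_left₀ _ hN'.ne']
      exact if_neg (not_lt.2 hx)
    simp [wgtOsc, this]
  · refine setIntegral_congr_fun measurableSet_Ioi fun x hx => ?_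
    have hx : 0 < x := hx
    have e1 : inner ℝ ((N : ℝ) * x) ξ = N * x * ξ := by simp [mul_comm]
    simp only [wgtOsc, smul_eq_mul]
    rw [e1, mul_div_cancel_left₀ _ hN'.ne', Real.log_mul hN'.ne' hx.ne', osc]
    have e2 : Complex.exp ((t * Real.log N : ℝ) * Complex.I) *
        Complex.exp ((t * Real.log x : ℝ) * Complex.I) =
        Complex.exp ((t * (Real.log N + Real.log x) : ℝ) * Complex.I) := by
      rw [← Complex.exp_add]; congr 1; push_cast; ring
    have e3 : Complex.exp (-(2 * Real.pi * N * ξ * Complex.I * x)) =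
        Complex.exp ((-2 * Real.pi * (N * x * ξ) : ℝ) * Complex.I) := by
      congr 1; push_cast; ring
    rw [← e2, e3]; ring

theorem continuous_wgtOsc {N : ℕ} (hN : 0 < N) (t : ℝ) : Continuous (wgtOsc N t) := by
  have hN' : (0 : ℝ) < N := by exact_mod_cast hN
  rw [continuous_iff_continuousAt]
  intro x
  rcases lt_or_ge x (N * Real.exp (-2)) with h | h
  · have : wgtOsc N t =ᶠ[nhds x] fun _ => 0 := by
      filter_upwards [Iio_mem_nhds h] with z hz
      have hz' : z / N ≤ Real.exp (-2) := by
        rw [div_le_iff₀' hN']; exact le_of_lt hz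
      simp [wgtOsc, wgt_eq_zero_of_le hz']
    exact this.continuousAt
  · have hx : x ≠ 0 := by
      have := Real.exp_pos (-2)
      nlinarith
    unfold wgtOsc
    have h1 := (continuous_wgt.continuousAt (x := x / N))
    have h2 : ContinuousAt (fun x : ℝ => (wgt (x / N) : ℂ)) x := by
      refine (Complex.continuous_ofReal.comp (continuous_wgt.comp ?_)).continuousAt
      fun_prop
    have h3 := Real.continuousAt_log hx
    fun_prop

theorem hasCompactSupport_wgtOsc {N : ℕ} (hN : 0 < N) (t : ℝ) :
    HasCompactSupport (wgtOsc N t) := by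
  have hN' : (0 : ℝ) < N := by exact_mod_cast hN
  refine HasCompactSupport.intro (isCompact_Icc (a := 0) (b := N * Real.exp 2)) ?_
  intro y hy
  rw [Set.mem_Icc, not_and_or, not_le, not_le] at hy
  rcases hy with h | h
  · have : y / N ≤ Real.exp (-2) :=
      (div_nonpos_of_nonpos_of_nonneg h.le hN'.le).trans (Real.exp_pos _).le
    simp [wgtOsc, wgt_eq_zero_of_le this]
  · have : Real.exp 2 ≤ y / N := by
      rw [le_div_iff₀' hN']; exact h.le
    simp [wgtOsc, wgt_eq_zero_of_ge this]

/-- The smoothed Dirichlet polynomial of length `N`. -/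
noncomputable def smoothPoly (N : ℕ) (t : ℝ) : ℂ :=
  dirPoly (fun n => (wgt ((n : ℝ) / N) : ℂ)) (8 * N) t

theorem tsum_wgtOsc {N : ℕ} (hN : 0 < N) (t : ℝ) :
    ∑' n : ℤ, wgtOsc N t n = smoothPoly N t := by
  have hN' : (0 : ℝ) < N := by exact_mod_cast hN
  rw [tsum_eq_sum (s := (Icc 1 (8 * N)).map Nat.castEmbedding)]
  · rw [sum_map]
    unfold smoothPoly dirPoly
    refine sum_congr rfl fun n _ => ?_
    simp [wgtOsc, osc]
  · intro n hn
    rcases le_or_gt n 0 with h | h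
    · have h' : (n : ℝ) ≤ 0 := by exact_mod_cast h
      have : (n : ℝ) / N ≤ Real.exp (-2) :=
        (div_nonpos_of_nonpos_of_nonneg h' hN'.le).trans (Real.exp_pos _).le
      simp [wgtOsc, wgt_eq_zero_of_le this]
    · lift n to ℕ using h.le
      have h1 : ¬ (n ∈ Icc 1 (8 * N)) := by
        intro h2
        exact hn (mem_map.2 ⟨n, h2, rfl⟩)
      have h2 : 8 * N < n := by
        rw [mem_Icc] at h1
        have : 0 < n := by exact_mod_cast h
        omega
      have h3 : ((8 * N : ℕ) : ℝ) < n := by exact_mod_cast h2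
      push_cast at h3
      have h4 : Real.exp 2 ≤ (n : ℝ) / N := by
        rw [le_div_iff₀ hN']
        nlinarith [exp_two_lt_eight]
      simp [wgtOsc, wgt_eq_zero_of_ge h4]

/-- The dual variable in Poisson summation. -/
noncomputable def dualVar (N : ℕ) : ℂ := 2 * Real.pi * N * Complex.I

theorem dualVar_re (N : ℕ) : (dualVar N).re = 0 := by simp [dualVar]

theorem norm_dualVar (N : ℕ) : ‖dualVar N‖ = 2 * Real.pi * N := by
  simp [dualVar, abs_of_pos Real.pi_pos]

theorem exists_norm_wgtTransform_int_le (k : ℕ) : ∃ C : ℝ, 0 < C ∧ ∀ (N : ℕ) (t : ℝ) (z : ℂ),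
    0 < N → (z = dualVar N ∨ z = -dualVar N) → ∀ m : ℕ, 0 < m →
    ‖wgtTransform t (((m : ℝ) : ℂ) * z)‖ ≤ C * (1 + |t|) ^ k * (N * m : ℝ) ^ (-((k : ℝ) + 1 / 2)) := by
  obtain ⟨C, hC, h⟩ := exists_norm_wgtTransform_le k
  refine ⟨C, hC, fun N t z hN hz m hm => ?_⟩
  have hN' : (0 : ℝ) < N := by exact_mod_cast hN
  have hm' : (0 : ℝ) < m := by exact_mod_cast hm
  have hz1 : z.re = 0 := by rcases hz with rfl | rfl <;> simp [dualVar_re]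
  have hz2 : ‖z‖ = 2 * Real.pi * N := by rcases hz with rfl | rfl <;> simp [norm_dualVar]
  have hz0 : ((m : ℝ) : ℂ) * z ≠ 0 := by
    rw [← norm_pos_iff, norm_mul, hz2, Complex.norm_real, Real.norm_of_nonneg hm'.le]; positivity
  refine (h t _ (by rw [Complex.re_ofReal_mul, hz1, mul_zero]) hz0).trans ?_
  gcongr ?_ * ?_
  refine Real.rpow_le_rpow_of_nonpos (by positivity) ?_ ?_
  · rw [norm_mul, hz2, Complex.norm_real, Real.norm_of_nonneg hm'.le]
    have : (1 : ℝ) ≤ 2 * Real.pi := by linarith [Real.pi_gt_three]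
    have : 0 < (N : ℝ) * m := by positivity
    nlinarith
  · have : (0 : ℝ) ≤ k := by positivity
    linarith

theorem summable_wgtTransform {N : ℕ} (hN : 0 < N) (t : ℝ) {z : ℂ}
    (hz : z = dualVar N ∨ z = -dualVar N) :
    Summable fun m : ℕ => wgtTransform t (((m : ℝ) : ℂ) * z) := by
  obtain ⟨C, hC, h⟩ := exists_norm_wgtTransform_int_le 1
  have hs : Summable fun m : ℕ => C * (1 + |t|) ^ 1 * (N * m : ℝ) ^ (-(((1 : ℕ) : ℝ) + 1 / 2)) := by
    refine Summable.mul_left _ ?_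
    simp_rw [Real.mul_rpow (Nat.cast_nonneg N) (Nat.cast_nonneg _)]
    refine Summable.mul_left _ ?_
    rw [Real.summable_nat_rpow]; norm_num
  refine Summable.of_norm_bounded_eventually hs ?_
  rw [Nat.cofinite_eq_atTop]
  filter_upwards [Filter.eventually_gt_atTop 0] with m hm
  exact h N t z hN hz m hm

theorem smoothPoly_eq_tsum_fourier {N : ℕ} (hN : 0 < N) (t : ℝ)
    (hsum : Summable fun m : ℤ => FourierTransform.fourier (wgtOsc N t) (m : ℝ)) :
    smoothPoly N t = ∑' m : ℤ, FourierTransform.fourier (wgtOsc N t) (m : ℝ) := by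
  have hdecay : wgtOsc N t =O[Filter.cocompact ℝ] fun x => |x| ^ (-(2 : ℝ)) := by
    have : wgtOsc N t =ᶠ[Filter.cocompact ℝ] fun _ => 0 := by
      exact (hasCompactSupport_iff_eventuallyEq.1 (hasCompactSupport_wgtOsc hN t)).filter_mono
        Filter.cocompact_le_coclosedCompact
    exact this.trans_isBigO (Asymptotics.isBigO_zero _ _)
  have hP := Real.tsum_eq_tsum_fourier_of_rpow_decay_of_summable (continuous_wgtOsc hN t)
    one_lt_two hdecay hsum 0
  rw [← tsum_wgtOsc hN]
  simpa using hP

theorem smoothPoly_eq {N : ℕ} (hN : 0 < N) (t : ℝ) :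
    smoothPoly N t = N * osc N t * (wgtTransform t 0 +
      (∑' m : ℕ, wgtTransform t ((((m + 1 : ℕ) : ℝ) : ℂ) * dualVar N)) +
      ∑' m : ℕ, wgtTransform t ((((m + 1 : ℕ) : ℝ) : ℂ) * (-dualVar N))) := by
  have hs1 := summable_wgtTransform hN t (Or.inl rfl)
  have hs2 := summable_wgtTransform hN t (Or.inr rfl)
  have hs3 : Summable fun m : ℕ => wgtTransform t ((((m + 1 : ℕ) : ℝ) : ℂ) * (-dualVar N)) :=
    (summable_nat_add_iff (f := fun m : ℕ => wgtTransform t (((m : ℝ) : ℂ) * (-dualVar N))) 1).2 hs2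
  obtain ⟨g, hg⟩ : ∃ g : ℤ → ℂ, ∀ m : ℤ, FourierTransform.fourier (wgtOsc N t) (m : ℝ) = g m :=
    ⟨_, fun _ => rfl⟩
  have hg1 : ∀ m : ℕ, g m = N * osc N t * wgtTransform t (((m : ℝ) : ℂ) * dualVar N) := by
    intro m
    rw [← hg, fourier_wgtOsc hN]
    refine congrArg (fun z => (N : ℂ) * osc N t * wgtTransform t z) ?_
    unfold dualVar; push_cast; ring
  have hg2 : ∀ m : ℕ, g (-(m + 1)) =
      N * osc N t * wgtTransform t ((((m + 1 : ℕ) : ℝ) : ℂ) * (-dualVar N)) := by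
    intro m
    rw [← hg, fourier_wgtOsc hN]
    refine congrArg (fun z => (N : ℂ) * osc N t * wgtTransform t z) ?_
    unfold dualVar; push_cast; ring
  have hS1 : Summable fun m : ℕ => g m := by
    simp_rw [hg1]; exact hs1.mul_left _
  have hS2 : Summable fun m : ℕ => g (-(m + 1)) := by
    simp_rw [hg2]; exact hs3.mul_left _
  have hsum : Summable g := Summable.of_nat_of_neg_add_one hS1 hS2
  have hP := smoothPoly_eq_tsum_fourier hN t (by simpa only [hg] using hsum)
  simp only [hg] at hP
  rw [hP, tsum_of_nat_of_neg_add_one hS1 hS2]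
  simp_rw [hg1, hg2]
  rw [tsum_mul_left, tsum_mul_left, hs1.tsum_eq_zero_add]
  simp only [CharP.cast_eq_zero, Complex.ofReal_zero, zero_mul]
  ring

theorem exists_norm_tsum_wgtTransform_le {η : ℝ} (hη : 0 < η) : ∃ C : ℝ, 0 < C ∧
    ∀ (T₀ : ℝ) (N L : ℕ) (t : ℝ) (z : ℂ), 1 ≤ T₀ → 0 < N → |t| ≤ T₀ →
    T₀ ^ (1 + η) ≤ N * L → (z = dualVar N ∨ z = -dualVar N) →
    ‖∑' m : ℕ, wgtTransform t ((((m + L + 1 : ℕ) : ℝ) : ℂ) * z)‖ ≤ C / N := by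
  obtain ⟨j, hj⟩ := exists_nat_ge (2 / η)
  have hj' : 2 ≤ j * η := by rwa [div_le_iff₀ hη] at hj
  obtain ⟨C, hC, h⟩ := exists_norm_wgtTransform_int_le (j + 2)
  have hs : Summable fun n : ℕ => ((n : ℝ) ^ 2)⁻¹ := by
    have := Real.summable_nat_pow_inv (p := 2)
    exact this.2 one_lt_two
  have hs1 : Summable fun n : ℕ => (((n + 1 : ℕ) : ℝ) ^ 2)⁻¹ := (summable_nat_add_iff 1).2 hs
  set K : ℝ := ∑' n : ℕ, (((n + 1 : ℕ) : ℝ) ^ 2)⁻¹ with hK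
  have hK0 : 0 ≤ K := tsum_nonneg fun n => by positivity
  refine ⟨C * 2 ^ (j + 2) * K + 1, by positivity, ?_⟩
  intro T₀ N L t z hT hN ht hNL hz
  have hN' : (1 : ℝ) ≤ N := by exact_mod_cast hN
  have hT0 : 0 < T₀ := by linarith
  have hT1 : 1 ≤ T₀ ^ (1 + η) := Real.one_le_rpow hT (by linarith)
  have hNL1 : 1 ≤ (N : ℝ) * L := hT1.trans hNL
  have hterm : ∀ n : ℕ, ‖wgtTransform t ((((n + L + 1 : ℕ) : ℝ) : ℂ) * z)‖ ≤
      C * 2 ^ (j + 2) / N * (((n + 1 : ℕ) : ℝ) ^ 2)⁻¹ := by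
    intro n
    refine (h N t z hN hz (n + L + 1) (by omega)).trans ?_
    have hm : (L : ℝ) ≤ ((n + L + 1 : ℕ) : ℝ) := by push_cast; have : (0:ℝ) ≤ n := by positivity
                                                    linarith
    have hm' : ((n + 1 : ℕ) : ℝ) ≤ ((n + L + 1 : ℕ) : ℝ) := by
      push_cast; have : (0:ℝ) ≤ L := by positivity
      linarith
    generalize ((n + L + 1 : ℕ) : ℝ) = m at hm hm'
    have hn1 : (0 : ℝ) < ((n + 1 : ℕ) : ℝ) := by positivity
    have hm0 : 0 < m := hn1.trans_le hm'
    have hNm : (N : ℝ) * L ≤ N * m := by gcongr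
    have hNm1 : 1 ≤ N * m := hNL1.trans hNm
    have e1 : (N * m : ℝ) ^ (-(((j + 2 : ℕ) : ℝ) + 1 / 2)) ≤ ((N * m) ^ (j + 2))⁻¹ := by
      rw [← Real.rpow_natCast, ← Real.rpow_neg (by positivity)]
      exact Real.rpow_le_rpow_of_exponent_le hNm1 (by linarith)
    have e2 : ((N * m) ^ (j + 2))⁻¹ ≤ ((N * L : ℝ) ^ j)⁻¹ * ((N : ℝ)⁻¹ * (((n + 1 : ℕ) : ℝ) ^ 2)⁻¹) := by
      rw [← mul_inv, ← mul_inv]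
      apply inv_anti₀ (by positivity)
      rw [pow_add]
      have : (N : ℝ) * ((n + 1 : ℕ) : ℝ) ^ 2 ≤ (N * m) ^ 2 := by
        rw [mul_pow]
        gcongr
        nlinarith
      gcongr
    have e3 : (1 + |t|) ^ (j + 2) ≤ 2 ^ (j + 2) * (N * L : ℝ) ^ j := by
      calc (1 + |t|) ^ (j + 2) ≤ (2 * T₀) ^ (j + 2) := by gcongr; linarith
        _ = 2 ^ (j + 2) * (T₀ ^ j * T₀ ^ (2 : ℝ)) := by
          rw [mul_pow, pow_add T₀, Real.rpow_two]
        _ ≤ 2 ^ (j + 2) * (T₀ ^ j * T₀ ^ (j * η)) := by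
          gcongr
        _ = 2 ^ (j + 2) * (T₀ ^ (1 + η)) ^ j := by
          rw [← Real.rpow_natCast T₀ j, ← Real.rpow_add hT0, ← Real.rpow_natCast (T₀ ^ (1 + η)),
            ← Real.rpow_mul hT0.le]
          congr 2; ring
        _ ≤ _ := by gcongr
    have hp : 0 < (N * L : ℝ) ^ j := by positivity
    calc C * (1 + |t|) ^ (j + 2) * (N * m : ℝ) ^ (-(((j + 2 : ℕ) : ℝ) + 1 / 2))
        ≤ C * (2 ^ (j + 2) * (N * L : ℝ) ^ j) *
          (((N * L : ℝ) ^ j)⁻¹ * ((N : ℝ)⁻¹ * (((n + 1 : ℕ) : ℝ) ^ 2)⁻¹)) := by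
            gcongr
            exact e1.trans e2
      _ = _ := by field_simp
  refine (tsum_of_norm_bounded (hs1.hasSum.mul_left _) hterm).trans ?_
  rw [← hK, div_mul_eq_mul_div]
  gcongr
  linarith

/-- The reflection principle: a smoothed Dirichlet polynomial of length `N` is controlled by an
average of the dual Dirichlet polynomial of length `L`. -/
theorem exists_norm_smoothPoly_le {η : ℝ} (hη : 0 < η) : ∃ C : ℝ, 0 < C ∧
    ∀ (T₀ : ℝ) (N L : ℕ) (t : ℝ), 1 ≤ T₀ → 0 < N → |t| ≤ T₀ → T₀ ^ (1 + η) ≤ N * L →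
    ‖smoothPoly N t‖ ≤ C * (N / (1 + t ^ 2) + Real.sqrt N * (∫ ω : ℝ, ‖expBumpHat (1 / 2) ω‖ *
        ‖dirPoly (fun n => (invSqrt n : ℂ)) L (t + 2 * Real.pi * ω)‖) + 1) := by
  obtain ⟨C₁, hC₁, h1⟩ := exists_norm_tsum_wgtTransform_le hη
  obtain ⟨C₀, hC₀, h0⟩ := exists_norm_wgtTransform_zero_le
  refine ⟨C₀ + 6 + 2 * C₁, by positivity, ?_⟩
  intro T₀ N L t hT hN ht hNL
  have hN' : (0 : ℝ) < N := by exact_mod_cast hN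
  set J : ℝ := ∫ ω : ℝ, ‖expBumpHat (1 / 2) ω‖ *
        ‖dirPoly (fun n => (invSqrt n : ℂ)) L (t + 2 * Real.pi * ω)‖ with hJ
  have hJ0 : 0 ≤ J := integral_nonneg fun ω => by positivity
  have hz : ∀ z : ℂ, (z = dualVar N ∨ z = -dualVar N) →
      N * ‖∑' m : ℕ, wgtTransform t ((((m + 1 : ℕ) : ℝ) : ℂ) * z)‖ ≤
        3 * (Real.sqrt N * J) + C₁ := by
    intro z hz
    have hz1 : z.re = 0 := by rcases hz with rfl | rfl <;> simp [dualVar_re]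
    have hz2 : ‖z‖ = 2 * Real.pi * N := by rcases hz with rfl | rfl <;> simp [norm_dualVar]
    have hz0 : z ≠ 0 := by rw [← norm_pos_iff, hz2]; positivity
    have hs : Summable fun m : ℕ => wgtTransform t ((((m + 1 : ℕ) : ℝ) : ℂ) * z) :=
      (summable_nat_add_iff (f := fun m : ℕ => wgtTransform t (((m : ℝ) : ℂ) * z)) 1).2
        (summable_wgtTransform hN t hz)
    rw [← hs.sum_add_tsum_nat_add L]
    have e1 : ∑ m ∈ range L, wgtTransform t ((((m + 1 : ℕ) : ℝ) : ℂ) * z) =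
        ∑ m ∈ Icc 1 L, wgtTransform t (((m : ℝ) : ℂ) * z) := by
      rw [range_eq_Ico, sum_Ico_add' (fun m : ℕ => wgtTransform t (((m : ℝ) : ℂ) * z)) 0 L 1]
      rfl
    rw [e1]
    have e2 := norm_sum_wgtTransform_le t L hz1.ge hz0
    have e3 := h1 T₀ N L t z hT hN ht hNL hz
    rw [← hJ, hz2] at e2
    have e4 : (2 * Real.pi * N) ^ (-(1 / 2) : ℝ) ≤ (N : ℝ) ^ (-(1 / 2) : ℝ) := by
      refine Real.rpow_le_rpow_of_nonpos hN' ?_ (by norm_num)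
      nlinarith [Real.pi_gt_three]
    have e5 : (N : ℝ) * (N : ℝ) ^ (-(1 / 2) : ℝ) = Real.sqrt N := by
      rw [Real.sqrt_eq_rpow]
      nth_rewrite 1 [← Real.rpow_one (N : ℝ)]
      rw [← Real.rpow_add hN']; norm_num
    calc _ ≤ (N : ℝ) * (3 * (N : ℝ) ^ (-(1 / 2) : ℝ) * J + C₁ / N) := by
          gcongr
          refine (norm_add_le _ _).trans (add_le_add (e2.trans ?_) e3)
          gcongr
      _ = 3 * ((N : ℝ) * (N : ℝ) ^ (-(1 / 2) : ℝ) * J) + C₁ := by field_simp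
      _ = _ := by rw [e5]
  rw [smoothPoly_eq hN, norm_mul, norm_mul, norm_osc, mul_one, Complex.norm_natCast]
  have f0 := h0 t
  have f1 := hz _ (Or.inl rfl)
  have f2 := hz _ (Or.inr rfl)
  have f3 : 0 ≤ (N : ℝ) / (1 + t ^ 2) := by positivity
  have f4 : 0 ≤ Real.sqrt N * J := by positivity
  calc _ ≤ (N : ℝ) * (C₀ / (1 + t ^ 2)) + (3 * (Real.sqrt N * J) + C₁) +
        (3 * (Real.sqrt N * J) + C₁) := by
        refine (mul_le_mul_of_nonneg_left norm_add₃_le hN'.le).trans ?_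
        rw [mul_add, mul_add]
        gcongr
    _ = C₀ * (N / (1 + t ^ 2)) + 6 * (Real.sqrt N * J) + 2 * C₁ := by ring
    _ ≤ _ := by nlinarith [mul_nonneg hC₁.le f3, mul_nonneg hC₀.le f4, mul_nonneg hC₁.le f4]

/-- A measure dominated by Lebesgue measure and carried by an interval of length `T₀`. -/
def LocalizedIn (μ : Measure ℝ) (T₀ : ℝ) : Prop :=
  μ ≤ volume ∧ ∃ x, ∀ᵐ t ∂μ, t ∈ Set.Icc x (x + T₀)

theorem LocalizedIn.ae_abs_sub_le {μ : Measure ℝ} [IsFiniteMeasure μ] {T₀ : ℝ}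
    (h : LocalizedIn μ T₀) : ∀ᵐ p : ℝ × ℝ ∂(μ.prod μ), |p.1 - p.2| ≤ T₀ := by
  obtain ⟨-, x, hx⟩ := h
  have h1 : ∀ᵐ p : ℝ × ℝ ∂(μ.prod μ), p.1 ∈ Set.Icc x (x + T₀) :=
    Measure.quasiMeasurePreserving_fst.ae hx
  have h2 : ∀ᵐ p : ℝ × ℝ ∂(μ.prod μ), p.2 ∈ Set.Icc x (x + T₀) :=
    Measure.quasiMeasurePreserving_snd.ae hx
  filter_upwards [h1, h2] with p hp1 hp2
  rw [abs_le]
  constructor <;> linarith [hp1.1, hp1.2, hp2.1, hp2.2]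

theorem LocalizedIn.integral_sub_le {μ : Measure ℝ} [IsFiniteMeasure μ] {T₀ : ℝ} (hT : 0 ≤ T₀)
    (h : LocalizedIn μ T₀) {f : ℝ → ℝ} (hf : Continuous f) (hf0 : ∀ x, 0 ≤ f x)
    {K : ℝ} (hK : ∀ x, f x ≤ K) :
    ∫ p : ℝ × ℝ, f (p.1 - p.2) ∂(μ.prod μ) ≤ μ.real Set.univ * ∫ u in (-T₀)..T₀, f u := by
  obtain ⟨hμ, x, hx⟩ := h
  have hKn : ∀ p : ℝ × ℝ, ‖f (p.1 - p.2)‖ ≤ K := fun p => by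
    rw [Real.norm_of_nonneg (hf0 _)]; exact hK _
  have hint : Integrable (fun p : ℝ × ℝ => f (p.1 - p.2)) (μ.prod μ) :=
    Continuous.integrable_of_norm_le (by fun_prop) hKn
  rw [integral_prod_symm _ hint]
  have hin : ∀ᵐ s ∂μ, ∫ t, f (t - s) ∂μ ≤ ∫ u in (-T₀)..T₀, f u := by
    filter_upwards [hx] with s hs
    have hle : μ ≤ volume.restrict (Set.Icc x (x + T₀)) := by
      rw [← Measure.restrict_eq_self_of_ae_mem hx]
      exact Measure.restrict_mono le_rfl hμ
    have hc : Continuous fun t => f (t - s) := by fun_prop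
    calc ∫ t, f (t - s) ∂μ ≤ ∫ t in Set.Icc x (x + T₀), f (t - s) :=
          integral_mono_measure hle (Filter.Eventually.of_forall fun t => hf0 _)
            (hc.integrableOn_Icc)
      _ = ∫ t in x..(x + T₀), f (t - s) := by
          rw [integral_Icc_eq_integral_Ioc, intervalIntegral.integral_of_le (by linarith)]
      _ = ∫ u in (x - s)..(x + T₀ - s), f u := intervalIntegral.integral_comp_sub_right f s
      _ ≤ _ := intervalIntegral.integral_mono_interval (by linarith [hs.2]) (by linarith)
            (by linarith [hs.1]) (Filter.Eventually.of_forall hf0) (hf.intervalIntegrable _ _)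
  calc _ ≤ ∫ _, (∫ u in (-T₀)..T₀, f u) ∂μ := by
        refine integral_mono_ae hint.integral_prod_right (integrable_const _) hin
    _ = _ := by rw [integral_const, smul_eq_mul]

theorem sum_sq_rpow_le {η : ℝ} (hη : 0 < η) (C : ℝ) (M : ℕ) :
    ∑ n ∈ Icc 1 M, (C * (n : ℝ) ^ (-(1 / 2) + η)) ^ 2 ≤
      C ^ 2 * (1 + 1 / η) * (M : ℝ) ^ (3 * η) := by
  rcases Nat.eq_zero_or_pos M with rfl | hM
  · simp; positivity
  have hM1 : (1 : ℝ) ≤ M := by exact_mod_cast hM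
  have h1 : ∀ n ∈ Icc 1 M, (C * (n : ℝ) ^ (-(1 / 2) + η)) ^ 2 ≤
      C ^ 2 * (M : ℝ) ^ (2 * η) * (n : ℝ)⁻¹ := by
    intro n hn
    have hn1 : (0 : ℝ) < n := by exact_mod_cast (mem_Icc.1 hn).1
    have hnM : (n : ℝ) ≤ M := by exact_mod_cast (mem_Icc.1 hn).2
    rw [mul_pow, ← Real.rpow_natCast ((n : ℝ) ^ _), ← Real.rpow_mul hn1.le]
    have e : (-(1 / 2) + η) * ((2 : ℕ) : ℝ) = 2 * η + -1 := by push_cast; ring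
    rw [e, Real.rpow_add hn1, Real.rpow_neg_one, mul_assoc]
    gcongr
  have h2 : ∑ n ∈ Icc 1 M, (n : ℝ)⁻¹ ≤ 1 + Real.log M := by
    have := harmonic_le_one_add_log M
    rw [harmonic_eq_sum_Icc] at this
    push_cast at this
    exact this
  have h3 : 1 + Real.log M ≤ (1 + 1 / η) * (M : ℝ) ^ η := by
    have := Real.log_le_rpow_div (by linarith : (0 : ℝ) ≤ M) hη
    have h4 : 1 ≤ (M : ℝ) ^ η := Real.one_le_rpow hM1 hη.le
    have h5 : (1 + 1 / η) * (M : ℝ) ^ η = (M : ℝ) ^ η + (M : ℝ) ^ η / η := by ring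
    linarith
  calc _ ≤ ∑ n ∈ Icc 1 M, C ^ 2 * (M : ℝ) ^ (2 * η) * (n : ℝ)⁻¹ := sum_le_sum h1
    _ = C ^ 2 * (M : ℝ) ^ (2 * η) * ∑ n ∈ Icc 1 M, (n : ℝ)⁻¹ := by rw [mul_sum]
    _ ≤ C ^ 2 * (M : ℝ) ^ (2 * η) * ((1 + 1 / η) * (M : ℝ) ^ η) := by
        gcongr; exact h2.trans h3
    _ = _ := by
        have : (M : ℝ) ^ (3 * η) = (M : ℝ) ^ (2 * η) * (M : ℝ) ^ η := by
          rw [← Real.rpow_add (by linarith)]; ring_nf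
        rw [this]; ring

theorem measureReal_prod_univ (μ : Measure ℝ) [IsFiniteMeasure μ] :
    (μ.prod μ).real Set.univ = μ.real Set.univ ^ 2 := by
  rw [← Set.univ_prod_univ, measureReal_prod_prod, sq]

theorem exists_integral_sq_sq_le {η : ℝ} (hη : 0 < η) : ∃ C : ℝ, 0 < C ∧
    ∀ (T₀ : ℝ) (μ : Measure ℝ) [IsFiniteMeasure μ] (Q : ℕ) (c : ℕ → ℂ), 1 ≤ T₀ →
    LocalizedIn μ T₀ → (∀ n, 1 ≤ n → ‖c n‖ ≤ (n : ℝ) ^ (-(1 / 2) : ℝ)) →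
    (∫ p : ℝ × ℝ, ‖dirPoly c Q (p.1 - p.2)‖ ^ 2 ∂(μ.prod μ)) ^ 2 ≤
      C * μ.real Set.univ ^ 3 * (T₀ + (Q : ℝ) ^ 4 / T₀) * (Q : ℝ) ^ η := by
  obtain ⟨C₁, hC₁, h1⟩ := exists_dirPoly_pow (-(1 / 2)) (η := η / 6) (by positivity) 1
  obtain ⟨C₂, hC₂, h2⟩ := exists_meanValue_dirPoly
  refine ⟨C₂ * (C₁ ^ 2 * (1 + 1 / (η / 6))) + 1, by positivity, ?_⟩
  intro T₀ μ _ Q c hT hμ hc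
  obtain ⟨b, hb, hbe⟩ := h1 Q c hc
  have hT0 : 0 < T₀ := by linarith
  set X := μ.real Set.univ with hX
  have hX0 : 0 ≤ X := measureReal_nonneg
  have hJ := pow_integral_le (μ.prod μ) 1 (f := fun p : ℝ × ℝ => ‖dirPoly c Q (p.1 - p.2)‖ ^ 2)
    (fun p => by positivity) (integrable_norm_dirPoly_pow _ _ _ _ (by fun_prop))
    (by
      simp_rw [← pow_mul]
      exact integrable_norm_dirPoly_pow _ _ _ _ (by fun_prop))
  rw [measureReal_prod_univ, pow_one, ← hX] at hJ
  refine hJ.trans ?_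
  have e1 : ∀ p : ℝ × ℝ, (‖dirPoly c Q (p.1 - p.2)‖ ^ 2) ^ (1 + 1) =
      ‖dirPoly b (Q ^ (1 + 1)) (p.1 - p.2)‖ ^ 2 := by
    intro p
    rw [← hbe, norm_pow]
  simp_rw [e1]
  have h3 := hμ.integral_sub_le hT0.le (f := fun u => ‖dirPoly b (Q ^ (1 + 1)) u‖ ^ 2)
    (by fun_prop) (fun u => by positivity) (K := (∑ n ∈ Icc 1 (Q ^ (1 + 1)), ‖b n‖) ^ 2)
    (fun u => pow_le_pow_left₀ (norm_nonneg _) (norm_dirPoly_le _ _ _) _)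
  rw [← hX] at h3
  have h4 := h2 T₀ (Q ^ (1 + 1)) b hT0
  have h5 : ∑ n ∈ Icc 1 (Q ^ (1 + 1)), ‖b n‖ ^ 2 ≤
      C₁ ^ 2 * (1 + 1 / (η / 6)) * (Q : ℝ) ^ η := by
    calc _ ≤ ∑ n ∈ Icc 1 (Q ^ (1 + 1)), (C₁ * (n : ℝ) ^ (-(1 / 2) + η / 6)) ^ 2 := by
          refine sum_le_sum fun n hn => ?_
          have := hb n (mem_Icc.1 hn).1
          simp only [Nat.cast_one, one_mul] at this
          gcongr
      _ ≤ _ := sum_sq_rpow_le (by positivity) _ _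
      _ = _ := by
          congr 1
          push_cast
          rw [← Real.rpow_natCast (Q : ℝ), ← Real.rpow_mul (Nat.cast_nonneg Q)]
          congr 1; push_cast; ring
  have e2 : (((Q ^ (1 + 1) : ℕ) : ℝ)) ^ 2 = (Q : ℝ) ^ 4 := by push_cast; ring
  rw [e2] at h4
  calc _ ≤ X ^ 2 * (X * (C₂ * (T₀ + (Q : ℝ) ^ 4 / T₀) *
        (C₁ ^ 2 * (1 + 1 / (η / 6)) * (Q : ℝ) ^ η))) := by
        gcongr
        refine h3.trans ?_
        gcongr
        refine h4.trans ?_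
        gcongr
    _ = (C₂ * (C₁ ^ 2 * (1 + 1 / (η / 6)))) * (X ^ 3 * (T₀ + (Q : ℝ) ^ 4 / T₀) * (Q : ℝ) ^ η) := by
        ring
    _ ≤ _ := by
        have : 0 ≤ X ^ 3 * (T₀ + (Q : ℝ) ^ 4 / T₀) * (Q : ℝ) ^ η := by positivity
        nlinarith

/-- The main term in the large value estimates. -/
noncomputable def mainTerm (X T₀ : ℝ) : ℝ := X * Real.sqrt (X * T₀)

theorem mainTerm_nonneg {X : ℝ} (hX : 0 ≤ X) (T₀ : ℝ) : 0 ≤ mainTerm X T₀ :=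
  mul_nonneg hX (Real.sqrt_nonneg _)

theorem exists_integral_sq_le {η : ℝ} (hη : 0 < η) (hη1 : η ≤ 1 / 2) : ∃ C : ℝ, 0 < C ∧
    ∀ (T₀ : ℝ) (μ : Measure ℝ) [IsFiniteMeasure μ] (Q : ℕ) (c : ℕ → ℂ), 1 ≤ T₀ →
    LocalizedIn μ T₀ → (∀ n, 1 ≤ n → ‖c n‖ ≤ (n : ℝ) ^ (-(1 / 2) : ℝ)) →
    (Q : ℝ) ≤ 8 * T₀ ^ (1 / 2 + η) →
    ∫ p : ℝ × ℝ, ‖dirPoly c Q (p.1 - p.2)‖ ^ 2 ∂(μ.prod μ) ≤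
      C * T₀ ^ (3 * η) * mainTerm (μ.real Set.univ) T₀ := by
  obtain ⟨C, hC, h⟩ := exists_integral_sq_sq_le hη
  refine ⟨Real.sqrt (C * (1 + 8 ^ 4) * 8), by positivity, ?_⟩
  intro T₀ μ _ Q c hT hμ hc hQ
  have hT0 : 0 < T₀ := by linarith
  have h1 := h T₀ μ Q c hT hμ hc
  set X := μ.real Set.univ with hX
  have hX0 : 0 ≤ X := measureReal_nonneg
  refine le_of_sq_le_sq ?_ (by have := mainTerm_nonneg hX0 T₀; positivity)
  refine h1.trans ?_
  rw [mul_pow, mul_pow, Real.sq_sqrt (by positivity), mainTerm, mul_pow,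
    Real.sq_sqrt (by positivity)]
  have e1 : (Q : ℝ) ^ η ≤ 8 * T₀ ^ η := by
    calc (Q : ℝ) ^ η ≤ (8 * T₀ ^ (1 / 2 + η)) ^ η := by gcongr
      _ = 8 ^ η * T₀ ^ ((1 / 2 + η) * η) := by
        rw [Real.mul_rpow (by positivity) (by positivity), ← Real.rpow_mul hT0.le]
      _ ≤ 8 ^ (1 : ℝ) * T₀ ^ η := by
        gcongr
        · norm_num
        · linarith
        · nlinarith
      _ = _ := by rw [Real.rpow_one]
  have e2 : T₀ + (Q : ℝ) ^ 4 / T₀ ≤ (1 + 8 ^ 4) * (T₀ * T₀ ^ (4 * η)) := by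
    have a1 : (Q : ℝ) ^ 4 ≤ 8 ^ 4 * (T₀ ^ 2 * T₀ ^ (4 * η)) := by
      calc (Q : ℝ) ^ 4 ≤ (8 * T₀ ^ (1 / 2 + η)) ^ 4 := by gcongr
        _ = _ := by
          rw [mul_pow, ← Real.rpow_natCast (T₀ ^ _), ← Real.rpow_mul hT0.le,
            ← Real.rpow_natCast T₀ 2, ← Real.rpow_add hT0]
          congr 2; push_cast; ring
    have a2 : 1 ≤ T₀ ^ (4 * η) := Real.one_le_rpow hT (by positivity)
    have a3 : (Q : ℝ) ^ 4 / T₀ ≤ 8 ^ 4 * (T₀ * T₀ ^ (4 * η)) := by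
      rw [div_le_iff₀ hT0]
      refine a1.trans (le_of_eq (by ring))
    nlinarith
  calc C * X ^ 3 * (T₀ + (Q : ℝ) ^ 4 / T₀) * (Q : ℝ) ^ η
      ≤ C * X ^ 3 * ((1 + 8 ^ 4) * (T₀ * T₀ ^ (4 * η))) * (8 * T₀ ^ η) := by gcongr
    _ = C * (1 + 8 ^ 4) * 8 * (T₀ ^ (4 * η) * T₀ ^ η) * (X ^ 2 * (X * T₀)) := by ring
    _ ≤ C * (1 + 8 ^ 4) * 8 * (T₀ ^ (3 * η)) ^ 2 * (X ^ 2 * (X * T₀)) := by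
        gcongr
        rw [← Real.rpow_natCast (T₀ ^ _), ← Real.rpow_mul hT0.le, ← Real.rpow_add hT0]
        refine Real.rpow_le_rpow_of_exponent_le hT ?_
        push_cast; linarith

/-- The finite measure with density `‖expBumpHat (1 / 2)‖`. -/
noncomputable def bumpMeasure : Measure ℝ :=
  volume.withDensity fun ω => ENNReal.ofReal ‖expBumpHat (1 / 2) ω‖

instance : IsFiniteMeasure bumpMeasure :=
  isFiniteMeasure_withDensity_ofReal (expBumpHat (1 / 2)).integrable.norm.2

theorem integral_bumpMeasure (g : ℝ → ℝ) :
    ∫ ω, g ω ∂bumpMeasure = ∫ ω : ℝ, ‖expBumpHat (1 / 2) ω‖ * g ω := by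
  unfold bumpMeasure
  rw [integral_withDensity_eq_integral_toReal_smul
    (by have := (expBumpHat (1 / 2)).continuous; fun_prop)
    (Filter.Eventually.of_forall fun _ => ENNReal.ofReal_lt_top)]
  refine integral_congr_ae (Filter.Eventually.of_forall fun ω => ?_)
  simp only [smul_eq_mul]
  rw [ENNReal.toReal_ofReal (norm_nonneg _)]

theorem norm_invSqrt_mul_osc_le (u : ℝ) (n : ℕ) :
    ‖(invSqrt n : ℂ) * osc n u‖ ≤ (n : ℝ) ^ (-(1 / 2) : ℝ) := by
  rw [norm_mul, norm_osc, mul_one, Complex.norm_of_nonneg (by unfold invSqrt; positivity)]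
  rfl

/-- Fubini and Jensen for moments of the averaged Dirichlet polynomial. -/
theorem pow_integral_bumpMeasure_le (μ : Measure ℝ) [IsFiniteMeasure μ] (c : ℕ → ℂ) (L k : ℕ)
    {Y : ℝ} (hY : ∀ u, ∫ p : ℝ × ℝ, ‖dirPoly c L (p.1 - p.2 + u)‖ ^ (k + 1) ∂(μ.prod μ) ≤ Y) :
    ∫ p : ℝ × ℝ, (∫ ω, ‖dirPoly c L (p.1 - p.2 + 2 * Real.pi * ω)‖ ∂bumpMeasure) ^ (k + 1)
      ∂(μ.prod μ) ≤ bumpMeasure.real Set.univ ^ (k + 1) * Y := by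
  set W := bumpMeasure.real Set.univ with hW
  have hint : Integrable (fun q : (ℝ × ℝ) × ℝ =>
      ‖dirPoly c L (q.1.1 - q.1.2 + 2 * Real.pi * q.2)‖ ^ (k + 1)) ((μ.prod μ).prod bumpMeasure) :=
    integrable_norm_dirPoly_pow _ _ _ _ (by fun_prop)
  have h1 : ∀ p : ℝ × ℝ, (∫ ω, ‖dirPoly c L (p.1 - p.2 + 2 * Real.pi * ω)‖ ∂bumpMeasure) ^ (k + 1)
      ≤ W ^ k * ∫ ω, ‖dirPoly c L (p.1 - p.2 + 2 * Real.pi * ω)‖ ^ (k + 1) ∂bumpMeasure := by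
    intro p
    refine pow_integral_le _ _ (fun _ => norm_nonneg _) ?_
      (integrable_norm_dirPoly_pow _ _ _ _ (by fun_prop))
    simpa using integrable_norm_dirPoly_pow bumpMeasure c L 1
      (φ := fun ω => p.1 - p.2 + 2 * Real.pi * ω) (by fun_prop)
  calc _ ≤ ∫ p : ℝ × ℝ, W ^ k * ∫ ω, ‖dirPoly c L (p.1 - p.2 + 2 * Real.pi * ω)‖ ^ (k + 1)
        ∂bumpMeasure ∂(μ.prod μ) := by
        refine integral_mono_of_nonneg (Filter.Eventually.of_forall fun p => ?_) ?_
          (Filter.Eventually.of_forall h1)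
        · exact pow_nonneg (integral_nonneg fun _ => norm_nonneg _) _
        · exact hint.integral_prod_left.const_mul _
    _ = W ^ k * ∫ ω, ∫ p : ℝ × ℝ, ‖dirPoly c L (p.1 - p.2 + 2 * Real.pi * ω)‖ ^ (k + 1)
        ∂(μ.prod μ) ∂bumpMeasure := by
        rw [integral_const_mul, integral_integral_swap hint]
    _ ≤ W ^ k * ∫ _, Y ∂bumpMeasure := by
        gcongr
        · exact hint.integral_prod_right
        · exact integrable_const _
        · exact fun ω => hY _
    _ = _ := by rw [integral_const, smul_eq_mul]; ring

theorem LocalizedIn.integral_inv_one_add_sq_le {μ : Measure ℝ} [IsFiniteMeasure μ] {T₀ : ℝ}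
    (hT : 0 ≤ T₀) (h : LocalizedIn μ T₀) :
    ∫ p : ℝ × ℝ, (1 + (p.1 - p.2) ^ 2)⁻¹ ∂(μ.prod μ) ≤ 4 * μ.real Set.univ := by
  have h1 := h.integral_sub_le hT (f := fun u => (1 + u ^ 2)⁻¹)
    (by fun_prop (disch := intro x; positivity)) (fun u => by positivity) (K := 1)
    (fun u => inv_le_one_of_one_le₀ (by nlinarith [sq_nonneg u]))
  rw [integral_inv_one_add_sq] at h1
  refine h1.trans ?_
  rw [mul_comm]
  gcongr
  linarith [Real.arctan_lt_pi_div_two T₀, Real.neg_pi_div_two_lt_arctan (-T₀), Real.pi_lt_four]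

theorem integrable_inv_one_add_sq_sub (μ : Measure ℝ) [IsFiniteMeasure μ] :
    Integrable (fun p : ℝ × ℝ => (1 + (p.1 - p.2) ^ 2)⁻¹) (μ.prod μ) := by
  refine Continuous.integrable_of_norm_le (C := 1)
    (by fun_prop (disch := intro x; positivity)) fun p => ?_
  rw [Real.norm_of_nonneg (by positivity)]
  exact inv_le_one_of_one_le₀ (by nlinarith [sq_nonneg (p.1 - p.2)])

theorem integrable_integral_bumpMeasure_pow (μ : Measure ℝ) [IsFiniteMeasure μ] (c : ℕ → ℂ)
    (L k : ℕ) :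
    Integrable (fun p : ℝ × ℝ =>
      (∫ ω, ‖dirPoly c L (p.1 - p.2 + 2 * Real.pi * ω)‖ ∂bumpMeasure) ^ k) (μ.prod μ) := by
  have hint : Integrable (fun q : (ℝ × ℝ) × ℝ =>
      ‖dirPoly c L (q.1.1 - q.1.2 + 2 * Real.pi * q.2)‖ ^ 1) ((μ.prod μ).prod bumpMeasure) :=
    integrable_norm_dirPoly_pow _ _ _ _ (by fun_prop)
  have hm := hint.integral_prod_left.aestronglyMeasurable
  simp only [pow_one] at hm
  refine Integrable.of_bound (hm.pow k)
    ((bumpMeasure.real Set.univ * ∑ n ∈ Icc 1 L, ‖c n‖) ^ k)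
    (Filter.Eventually.of_forall fun p => ?_)
  rw [norm_pow]
  refine pow_le_pow_left₀ (norm_nonneg _) ?_ _
  refine (norm_integral_le_of_norm_le_const (C := ∑ n ∈ Icc 1 L, ‖c n‖)
    (Filter.Eventually.of_forall fun ω => ?_)).trans (le_of_eq (mul_comm _ _))
  rw [norm_norm]
  exact norm_dirPoly_le _ _ _

theorem exists_integral_smoothPoly_sq_le_of_le {η : ℝ} (hη : 0 < η) (hη1 : η ≤ 1 / 2) :
    ∃ C : ℝ, 0 < C ∧ ∀ (T₀ : ℝ) (μ : Measure ℝ) [IsFiniteMeasure μ] (M : ℕ), 1 ≤ T₀ →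
    LocalizedIn μ T₀ → 0 < M → (M : ℝ) ≤ T₀ ^ (1 / 2 : ℝ) →
    ∫ p : ℝ × ℝ, ‖smoothPoly M (p.1 - p.2)‖ ^ 2 ∂(μ.prod μ) ≤
      C * T₀ ^ (3 * η) * M * mainTerm (μ.real Set.univ) T₀ := by
  obtain ⟨C, hC, h⟩ := exists_integral_sq_le hη hη1
  refine ⟨8 * C, by positivity, ?_⟩
  intro T₀ μ _ M hT hμ hM hMT
  have hM0 : (0 : ℝ) < M := by exact_mod_cast hM
  set r : ℝ := Real.sqrt (8 * M) with hr
  have hr0 : 0 < r := Real.sqrt_pos.2 (by positivity)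
  have hr2 : r ^ 2 = 8 * M := Real.sq_sqrt (by positivity)
  have h1 := h T₀ μ (8 * M) (fun n => ((wgt ((n : ℝ) / M) / r : ℝ) : ℂ)) hT hμ (by
    intro n hn
    have hn0 : (0 : ℝ) < n := by exact_mod_cast hn
    rw [Complex.norm_of_nonneg (div_nonneg (wgt_nonneg _) hr0.le)]
    by_cases hnM : (n : ℝ) ≤ 8 * M
    · calc wgt ((n : ℝ) / M) / r ≤ 1 / r := by gcongr; exact wgt_le_one _
        _ = (8 * M : ℝ) ^ (-(1 / 2) : ℝ) := by
          rw [hr, Real.sqrt_eq_rpow, Real.rpow_neg (by positivity), one_div]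
        _ ≤ _ := Real.rpow_le_rpow_of_nonpos hn0 hnM (by norm_num)
    · rw [wgt_eq_zero_of_ge, zero_div]
      · positivity
      · rw [le_div_iff₀ hM0]
        push Not at hnM
        nlinarith [exp_two_lt_eight]) (by
    push_cast
    have : (M : ℝ) ≤ T₀ ^ (1 / 2 + η) :=
      hMT.trans (Real.rpow_le_rpow_of_exponent_le hT (by linarith))
    linarith)
  have e : ∀ t, ‖smoothPoly M t‖ ^ 2 =
      8 * M * ‖dirPoly (fun n => ((wgt ((n : ℝ) / M) / r : ℝ) : ℂ)) (8 * M) t‖ ^ 2 := by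
    intro t
    suffices h2 : smoothPoly M t =
        (r : ℂ) * dirPoly (fun n => ((wgt ((n : ℝ) / M) / r : ℝ) : ℂ)) (8 * M) t by
      rw [h2, norm_mul, mul_pow, Complex.norm_of_nonneg hr0.le, hr2]
    unfold smoothPoly dirPoly
    rw [mul_sum]
    refine sum_congr rfl fun n _ => ?_
    have : (r : ℂ) ≠ 0 := by exact_mod_cast hr0.ne'
    push_cast
    field_simp
  simp_rw [e]
  rw [integral_const_mul]
  calc _ ≤ 8 * (M : ℝ) * (C * T₀ ^ (3 * η) * mainTerm (μ.real Set.univ) T₀) := by gcongr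
    _ = _ := by ring

theorem exists_integral_smoothPoly_sq_le_of_ge {η : ℝ} (hη : 0 < η) (hη1 : η ≤ 1 / 2) :
    ∃ C : ℝ, 0 < C ∧ ∀ (T₀ : ℝ) (μ : Measure ℝ) [IsFiniteMeasure μ] (M : ℕ), 1 ≤ T₀ →
    LocalizedIn μ T₀ → 0 < M → T₀ ^ (1 / 2 : ℝ) ≤ (M : ℝ) →
    ∫ p : ℝ × ℝ, ‖smoothPoly M (p.1 - p.2)‖ ^ 2 ∂(μ.prod μ) ≤
      C * (μ.real Set.univ * M ^ 2 + M * (T₀ ^ (3 * η) * mainTerm (μ.real Set.univ) T₀)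
        + μ.real Set.univ ^ 2) := by
  obtain ⟨C, hC, h⟩ := exists_integral_sq_le hη hη1
  obtain ⟨C', hC', h'⟩ := exists_norm_smoothPoly_le hη
  set W := bumpMeasure.real Set.univ with hW
  have hW0 : 0 ≤ W := measureReal_nonneg
  refine ⟨3 * C' ^ 2 * (4 + W ^ 2 * C + 1), by positivity, ?_⟩
  intro T₀ μ _ M hT hμ hM hMT
  have hT0 : 0 < T₀ := by linarith
  have hM0 : (0 : ℝ) < M := by exact_mod_cast hM
  set X := μ.real Set.univ with hX
  have hX0 : 0 ≤ X := measureReal_nonneg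
  have hm0 := mainTerm_nonneg hX0 T₀
  set L := ⌈T₀ ^ (1 + η) / M⌉₊ with hL
  have hL1 : T₀ ^ (1 + η) ≤ M * L := by
    have := Nat.le_ceil (T₀ ^ (1 + η) / M)
    rw [div_le_iff₀ hM0] at this
    linarith
  have hL2 : (L : ℝ) ≤ 8 * T₀ ^ (1 / 2 + η) := by
    have h1 := Nat.ceil_lt_add_one (show 0 ≤ T₀ ^ (1 + η) / M by positivity)
    have h2 : T₀ ^ (1 + η) / M ≤ T₀ ^ (1 / 2 + η) := by
      rw [div_le_iff₀ hM0]
      calc T₀ ^ (1 + η) = T₀ ^ (1 / 2 + η) * T₀ ^ (1 / 2 : ℝ) := by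
            rw [← Real.rpow_add hT0]; ring_nf
        _ ≤ _ := by gcongr
    have h3 : 1 ≤ T₀ ^ (1 / 2 + η) := Real.one_le_rpow hT (by positivity)
    rw [← hL] at h1
    linarith
  set D : ℝ × ℝ → ℝ := fun p => ∫ ω, ‖dirPoly (fun n => (invSqrt n : ℂ)) L
    (p.1 - p.2 + 2 * Real.pi * ω)‖ ∂bumpMeasure with hD
  have hDY := pow_integral_bumpMeasure_le μ (fun n => (invSqrt n : ℂ)) L 1
    (Y := C * T₀ ^ (3 * η) * mainTerm X T₀) (fun u => by
      simp_rw [dirPoly_add _ _ _ u]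
      exact h T₀ μ L _ hT hμ (fun n _ => norm_invSqrt_mul_osc_le u n) hL2)
  have hDint : Integrable (fun p => D p ^ 2) (μ.prod μ) :=
    integrable_integral_bumpMeasure_pow μ _ L 2
  have hpt : ∀ᵐ p : ℝ × ℝ ∂(μ.prod μ), ‖smoothPoly M (p.1 - p.2)‖ ^ 2 ≤
      3 * C' ^ 2 * (M ^ 2 * (1 + (p.1 - p.2) ^ 2)⁻¹ + M * D p ^ 2 + 1) := by
    filter_upwards [hμ.ae_abs_sub_le] with p hp
    have h1 := h' T₀ M L (p.1 - p.2) hT hM hp hL1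
    rw [← integral_bumpMeasure] at h1
    set y := (1 + (p.1 - p.2) ^ 2)⁻¹ with hy
    have hy0 : 0 ≤ y := by positivity
    have hy1 : y ≤ 1 := inv_le_one_of_one_le₀ (by nlinarith [sq_nonneg (p.1 - p.2)])
    have h2 : ‖smoothPoly M (p.1 - p.2)‖ ≤ C' * (M * y + Real.sqrt M * D p + 1) := by
      simpa only [hD, hy, div_eq_mul_inv] using h1
    have hsq : Real.sqrt M ^ 2 = M := Real.sq_sqrt hM0.le
    calc ‖smoothPoly M (p.1 - p.2)‖ ^ 2 ≤ (C' * (M * y + Real.sqrt M * D p + 1)) ^ 2 := by gcongr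
      _ = C' ^ 2 * (M * y + Real.sqrt M * D p + 1) ^ 2 := by ring
      _ ≤ C' ^ 2 * (3 * ((M * y) ^ 2 + (Real.sqrt M * D p) ^ 2 + 1)) := by
        gcongr
        nlinarith [sq_nonneg (M * y - Real.sqrt M * D p), sq_nonneg (M * y - 1),
          sq_nonneg (Real.sqrt M * D p - 1)]
      _ = 3 * C' ^ 2 * (M ^ 2 * y ^ 2 + M * D p ^ 2 + 1) := by rw [mul_pow (Real.sqrt M), hsq]; ring
      _ ≤ _ := by
        have : y ^ 2 ≤ y := by nlinarith
        gcongr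
  have i1 := (integrable_inv_one_add_sq_sub μ).const_mul ((M : ℝ) ^ 2)
  have i2 := hDint.const_mul (M : ℝ)
  have i3 : Integrable (fun p : ℝ × ℝ => M ^ 2 * (1 + (p.1 - p.2) ^ 2)⁻¹ + M * D p ^ 2)
      (μ.prod μ) := i1.add i2
  calc _ ≤ ∫ p : ℝ × ℝ, 3 * C' ^ 2 * (M ^ 2 * (1 + (p.1 - p.2) ^ 2)⁻¹ + M * D p ^ 2 + 1)
        ∂(μ.prod μ) := by
        refine integral_mono_ae (integrable_norm_dirPoly_pow _ _ _ _ (by fun_prop)) ?_ hpt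
        exact (i3.add (integrable_const 1)).const_mul _
    _ = 3 * C' ^ 2 * (M ^ 2 * (∫ p : ℝ × ℝ, (1 + (p.1 - p.2) ^ 2)⁻¹ ∂(μ.prod μ)) +
          M * (∫ p, D p ^ 2 ∂(μ.prod μ)) + X ^ 2) := by
        rw [integral_const_mul, integral_add i3 (integrable_const 1), integral_add i1 i2,
          integral_const_mul, integral_const_mul, integral_const, measureReal_prod_univ]
        simp [hX]
    _ ≤ 3 * C' ^ 2 * (M ^ 2 * (4 * X) + M * (W ^ 2 * (C * T₀ ^ (3 * η) * mainTerm X T₀)) +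
          X ^ 2) := by
        gcongr
        · exact hμ.integral_inv_one_add_sq_le hT0.le
    _ ≤ _ := by
        have a1 : 0 ≤ X * (M : ℝ) ^ 2 := by positivity
        have a2 : 0 ≤ M * (T₀ ^ (3 * η) * mainTerm X T₀) := by positivity
        have a3 : 0 ≤ X ^ 2 := by positivity
        rw [mul_assoc (3 * C' ^ 2)]
        refine mul_le_mul_of_nonneg_left ?_ (by positivity)
        have b : 0 ≤ W ^ 2 * C := by positivity
        nlinarith [mul_nonneg b a1, mul_nonneg b a3]

theorem exists_integral_smoothPoly_sq_le {η : ℝ} (hη : 0 < η) (hη1 : η ≤ 1 / 2) :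
    ∃ C : ℝ, 0 < C ∧ ∀ (T₀ : ℝ) (μ : Measure ℝ) [IsFiniteMeasure μ] (M : ℕ), 1 ≤ T₀ →
    LocalizedIn μ T₀ → 0 < M →
    ∫ p : ℝ × ℝ, ‖smoothPoly M (p.1 - p.2)‖ ^ 2 ∂(μ.prod μ) ≤
      C * T₀ ^ (3 * η) * M *
        (mainTerm (μ.real Set.univ) T₀ + μ.real Set.univ * M + μ.real Set.univ ^ 2) := by
  obtain ⟨C₁, hC₁, h1⟩ := exists_integral_smoothPoly_sq_le_of_le hη hη1
  obtain ⟨C₂, hC₂, h2⟩ := exists_integral_smoothPoly_sq_le_of_ge hη hη1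
  refine ⟨C₁ + C₂, by positivity, ?_⟩
  intro T₀ μ _ M hT hμ hM
  have hM1 : (1 : ℝ) ≤ M := by exact_mod_cast hM
  set X := μ.real Set.univ with hX
  have hX0 : 0 ≤ X := measureReal_nonneg
  have hm0 := mainTerm_nonneg hX0 T₀
  have hT1 : 1 ≤ T₀ ^ (3 * η) := Real.one_le_rpow hT (by positivity)
  rcases le_total (M : ℝ) (T₀ ^ (1 / 2 : ℝ)) with hc | hc
  · refine (h1 T₀ μ M hT hμ hM hc).trans ?_
    have h3 : mainTerm X T₀ ≤ mainTerm X T₀ + X * M + X ^ 2 := by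
      have : 0 ≤ X * M + X ^ 2 := by positivity
      linarith
    gcongr
    linarith
  · refine (h2 T₀ μ M hT hμ hM hc).trans ?_
    calc _ ≤ C₂ * (T₀ ^ (3 * η) * M * (mainTerm X T₀ + X * M + X ^ 2)) := by
          gcongr
          have a1 : X * (M : ℝ) ^ 2 ≤ T₀ ^ (3 * η) * (X * (M : ℝ) ^ 2) :=
            le_mul_of_one_le_left (by positivity) hT1
          have a2 : X ^ 2 ≤ T₀ ^ (3 * η) * M * X ^ 2 :=
            le_mul_of_one_le_left (by positivity) (one_le_mul_of_one_le_of_one_le hT1 hM1)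
          nlinarith
      _ ≤ (C₁ + C₂) * (T₀ ^ (3 * η) * M * (mainTerm X T₀ + X * M + X ^ 2)) := by
          gcongr
          linarith
      _ = _ := by ring

theorem dirPoly_eq_sum_dyadic (c : ℕ → ℂ) (M : ℕ) (t : ℝ) :
    dirPoly c M t = ∑ j ∈ range (Nat.log 2 M + 1),
      dirPoly (fun n => if n ≤ M ∧ Nat.log 2 n = j then c n else 0) (8 * 2 ^ j) t := by
  have h1 : dirPoly c M t = ∑ j ∈ range (Nat.log 2 M + 1), ∑ n ∈ Icc 1 M with Nat.log 2 n = j,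
      c n * osc n t := by
    unfold dirPoly
    refine (sum_fiberwise_of_maps_to (fun n hn => ?_) _).symm
    rw [mem_range, Nat.lt_succ_iff]
    exact Nat.log_mono_right (mem_Icc.1 hn).2
  rw [h1]
  refine sum_congr rfl fun j _ => ?_
  unfold dirPoly
  simp_rw [ite_mul, zero_mul]
  rw [← sum_filter]
  refine sum_congr ?_ fun _ _ => rfl
  ext n
  simp only [mem_filter, mem_Icc]
  constructor
  · rintro ⟨⟨h1, h2⟩, h3⟩
    refine ⟨⟨h1, ?_⟩, h2, h3⟩
    have := Nat.lt_pow_succ_log_self (b := 2) (by norm_num) n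
    rw [h3, pow_succ] at this
    omega
  · rintro ⟨⟨h1, h2⟩, h3, h4⟩
    exact ⟨⟨h1, h3⟩, h4⟩

theorem log_two_add_one_le {δ : ℝ} (hδ : 0 < δ) {M : ℕ} (hM : 0 < M) :
    (Nat.log 2 M + 1 : ℝ) ≤ (2 / δ + 1) * (M : ℝ) ^ δ := by
  have hM1 : (1 : ℝ) ≤ M := by exact_mod_cast hM
  have h1 : ((2 ^ Nat.log 2 M : ℕ) : ℝ) ≤ M := by exact_mod_cast Nat.pow_log_le_self 2 hM.ne'
  have h2 := Real.log_le_log (by positivity) h1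
  push_cast at h2
  rw [Real.log_pow] at h2
  have h3 := Real.log_le_rpow_div (by linarith : (0 : ℝ) ≤ M) hδ
  have h4 : 1 ≤ (M : ℝ) ^ δ := Real.one_le_rpow hM1 hδ.le
  have h5 : (Nat.log 2 M : ℝ) ≤ 2 * Real.log M := by
    have := Real.log_two_gt_d9
    have h0 : (0 : ℝ) ≤ Nat.log 2 M := by positivity
    nlinarith
  have h6 : (2 / δ + 1) * (M : ℝ) ^ δ = 2 * ((M : ℝ) ^ δ / δ) + (M : ℝ) ^ δ := by ring
  rw [h6]
  linarith

theorem exists_integral_dirPoly_sub_sq_le {η δ : ℝ} (hη : 0 < η) (hη1 : η ≤ 1 / 2) (hδ : 0 < δ) :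
    ∃ K : ℝ, 0 < K ∧ ∀ (T₀ : ℝ) (μ : Measure ℝ) [IsFiniteMeasure μ] (M : ℕ) (c : ℕ → ℂ) (A : ℝ),
    1 ≤ T₀ → LocalizedIn μ T₀ → 0 < M → 0 ≤ A →
    (∀ n, 1 ≤ n → ‖c n‖ ≤ A * (n : ℝ) ^ (-(1 / 2) + δ)) →
    ∫ p : ℝ × ℝ, ‖dirPoly c M (p.1 - p.2)‖ ^ 2 ∂(μ.prod μ) ≤
      K * A ^ 2 * T₀ ^ (3 * η) * (M : ℝ) ^ (4 * δ) *
        (mainTerm (μ.real Set.univ) T₀ + μ.real Set.univ * M + μ.real Set.univ ^ 2) := by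
  obtain ⟨C, hC, h⟩ := exists_integral_smoothPoly_sq_le hη hη1
  refine ⟨(2 / δ + 1) ^ 2 * C, by positivity, ?_⟩
  intro T₀ μ _ M c A hT hμ hM hA hc
  have hT0 : 0 < T₀ := by linarith
  have hM0 : (0 : ℝ) < M := by exact_mod_cast hM
  set X := μ.real Set.univ with hX
  have hX0 : 0 ≤ X := measureReal_nonneg
  have hm0 := mainTerm_nonneg hX0 T₀
  set J := Nat.log 2 M with hJ
  set P : ℕ → ℕ → ℂ := fun j n => if n ≤ M ∧ Nat.log 2 n = j then c n else 0 with hP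
  set S := mainTerm X T₀ + X * M + X ^ 2 with hS
  have hblock : ∀ j ∈ range (J + 1),
      ∫ p : ℝ × ℝ, ‖dirPoly (P j) (8 * 2 ^ j) (p.1 - p.2)‖ ^ 2 ∂(μ.prod μ) ≤
        A ^ 2 * (M : ℝ) ^ (2 * δ) * (C * T₀ ^ (3 * η) * S) := by
    intro j hj
    have hjM : 2 ^ j ≤ M :=
      (Nat.pow_le_pow_right (by norm_num) (Nat.lt_succ_iff.1 (mem_range.1 hj))).trans
        (Nat.pow_log_le_self 2 hM.ne')
    have hjM' : (2 : ℝ) ^ j ≤ M := by exact_mod_cast hjM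
    set q : ℝ := (2 : ℝ) ^ j with hq
    have hq0 : 0 < q := by positivity
    set r : ℝ := A * (q ^ (-(1 / 2) : ℝ) * (M : ℝ) ^ δ) with hr
    have hr0 : 0 ≤ r := by positivity
    have h1 := integral_norm_dirPoly_sub_sq_le μ (8 * 2 ^ j) (P j)
      (fun n => r * wgt ((n : ℝ) / (2 ^ j : ℕ))) (by
        intro n hn
        simp only [hP]
        split_ifs with hnj
        · have hn1 : 1 ≤ n := (mem_Icc.1 hn).1
          have hn0 : (0 : ℝ) < n := by exact_mod_cast hn1
          have g1 : q ≤ n := by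
            have := Nat.pow_log_le_self 2 (x := n) (by omega)
            rw [hnj.2] at this
            rw [hq]
            exact_mod_cast this
          have g2 : (n : ℝ) ≤ 2 * q := by
            have := Nat.lt_pow_succ_log_self (b := 2) (by norm_num) n
            rw [hnj.2, pow_succ] at this
            have : (n : ℝ) < (2 : ℝ) ^ j * 2 := by exact_mod_cast this
            linarith
          rw [wgt_eq_one, mul_one]
          · refine (hc n hn1).trans ?_
            rw [hr, Real.rpow_add hn0]
            have : (n : ℝ) ≤ M := by exact_mod_cast hnj.1
            gcongr A * (?_ * ?_)
            · exact Real.rpow_le_rpow_of_nonpos hq0 g1 (by norm_num)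
            · gcongr
          · push_cast
            rwa [le_div_iff₀ hq0, one_mul]
          · push_cast
            rwa [div_le_iff₀ hq0]
        · rw [norm_zero]
          exact mul_nonneg hr0 (wgt_nonneg _))
    refine h1.trans ?_
    have e : ∀ t, ‖dirPoly (fun n => ((r * wgt ((n : ℝ) / (2 ^ j : ℕ)) : ℝ) : ℂ)) (8 * 2 ^ j) t‖ ^ 2
        = r ^ 2 * ‖smoothPoly (2 ^ j) t‖ ^ 2 := by
      intro t
      suffices h2 : dirPoly (fun n => ((r * wgt ((n : ℝ) / (2 ^ j : ℕ)) : ℝ) : ℂ)) (8 * 2 ^ j) t =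
          (r : ℂ) * smoothPoly (2 ^ j) t by
        rw [h2, norm_mul, mul_pow, Complex.norm_of_nonneg hr0]
      unfold smoothPoly dirPoly
      rw [mul_sum]
      refine sum_congr rfl fun n _ => ?_
      push_cast
      ring
    simp_rw [e]
    rw [integral_const_mul]
    have h3 := h T₀ μ (2 ^ j) hT hμ (by positivity)
    have e2 : r ^ 2 * q = A ^ 2 * (M : ℝ) ^ (2 * δ) := by
      have : (q ^ (-(1 / 2) : ℝ)) ^ 2 * q = 1 := by
        rw [← Real.rpow_natCast, ← Real.rpow_mul hq0.le]
        norm_num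
        rw [Real.rpow_neg_one, inv_mul_cancel₀ hq0.ne']
      have h5 : ((M : ℝ) ^ δ) ^ 2 = (M : ℝ) ^ (2 * δ) := by
        rw [← Real.rpow_natCast, ← Real.rpow_mul hM0.le]
        push_cast; ring_nf
      calc r ^ 2 * q = A ^ 2 * (((q ^ (-(1 / 2) : ℝ)) ^ 2 * q) * ((M : ℝ) ^ δ) ^ 2) := by
            rw [hr]; ring
        _ = _ := by rw [this, h5, one_mul]
    calc r ^ 2 * ∫ p : ℝ × ℝ, ‖smoothPoly (2 ^ j) (p.1 - p.2)‖ ^ 2 ∂(μ.prod μ)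
        ≤ r ^ 2 * (C * T₀ ^ (3 * η) * q * (mainTerm X T₀ + X * q + X ^ 2)) := by
          gcongr
          push_cast at h3
          exact h3
      _ = r ^ 2 * q * (C * T₀ ^ (3 * η) * (mainTerm X T₀ + X * q + X ^ 2)) := by ring
      _ ≤ _ := by
          rw [e2, hS]
          gcongr
  have hpt : ∀ p : ℝ × ℝ, ‖dirPoly c M (p.1 - p.2)‖ ^ 2 ≤
      (J + 1 : ℝ) * ∑ j ∈ range (J + 1), ‖dirPoly (P j) (8 * 2 ^ j) (p.1 - p.2)‖ ^ 2 := by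
    intro p
    rw [dirPoly_eq_sum_dyadic]
    calc _ ≤ (∑ j ∈ range (J + 1), ‖dirPoly (P j) (8 * 2 ^ j) (p.1 - p.2)‖) ^ 2 := by
          gcongr; exact norm_sum_le _ _
      _ ≤ _ := by
          refine sq_sum_le_card_mul_sum_sq.trans (le_of_eq ?_)
          rw [card_range]; push_cast; rfl
  have hint : ∀ j ∈ range (J + 1), Integrable (fun p : ℝ × ℝ =>
      ‖dirPoly (P j) (8 * 2 ^ j) (p.1 - p.2)‖ ^ 2) (μ.prod μ) := fun j _ =>
    integrable_norm_dirPoly_pow _ _ _ _ (by fun_prop)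
  calc _ ≤ ∫ p : ℝ × ℝ, (J + 1 : ℝ) * ∑ j ∈ range (J + 1),
        ‖dirPoly (P j) (8 * 2 ^ j) (p.1 - p.2)‖ ^ 2 ∂(μ.prod μ) :=
        integral_mono (integrable_norm_dirPoly_pow _ _ _ _ (by fun_prop))
          ((integrable_finsetSum _ hint).const_mul _) hpt
    _ = (J + 1 : ℝ) * ∑ j ∈ range (J + 1), ∫ p : ℝ × ℝ,
        ‖dirPoly (P j) (8 * 2 ^ j) (p.1 - p.2)‖ ^ 2 ∂(μ.prod μ) := by
        rw [integral_const_mul, integral_finsetSum _ hint]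
    _ ≤ (J + 1 : ℝ) * ∑ j ∈ range (J + 1),
          (A ^ 2 * (M : ℝ) ^ (2 * δ) * (C * T₀ ^ (3 * η) * S)) := by
        gcongr with j hj
        exact hblock j hj
    _ = (J + 1 : ℝ) ^ 2 * (A ^ 2 * (M : ℝ) ^ (2 * δ) * (C * T₀ ^ (3 * η) * S)) := by
        rw [sum_const, card_range, nsmul_eq_mul]; push_cast; ring
    _ ≤ ((2 / δ + 1) * (M : ℝ) ^ δ) ^ 2 * (A ^ 2 * (M : ℝ) ^ (2 * δ) * (C * T₀ ^ (3 * η) * S)) := by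
        gcongr
        exact log_two_add_one_le hδ hM
    _ = (2 / δ + 1) ^ 2 * C * A ^ 2 * T₀ ^ (3 * η) * (((M : ℝ) ^ δ) ^ 2 * (M : ℝ) ^ (2 * δ)) * S := by
        ring
    _ = _ := by
        congr 2
        rw [← Real.rpow_natCast, ← Real.rpow_mul hM0.le, ← Real.rpow_add hM0]
        congr 1; push_cast; ring

theorem exists_integral_invSqrt_pow_fourteen_le {η : ℝ} (hη : 0 < η) (hη1 : η ≤ 1) :
    ∃ K : ℝ, 0 < K ∧ ∀ (T₀ : ℝ) (μ : Measure ℝ) [IsFiniteMeasure μ] (L : ℕ) (u : ℝ),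
    1 ≤ T₀ → LocalizedIn μ T₀ → 0 < L → (L : ℝ) ≤ 2 * T₀ ^ 2 →
    ∫ p : ℝ × ℝ, ‖dirPoly (fun n => (invSqrt n : ℂ)) L (p.1 - p.2 + u)‖ ^ 14 ∂(μ.prod μ) ≤
      K * T₀ ^ η * (mainTerm (μ.real Set.univ) T₀ + μ.real Set.univ * (L : ℝ) ^ 7 +
        μ.real Set.univ ^ 2) := by
  set δ := η / 112 with hδ
  have hδ0 : 0 < δ := by positivity
  obtain ⟨K, hK, h⟩ := exists_integral_dirPoly_sub_sq_le (η := η / 6) (δ := δ) (by positivity)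
    (by linarith) hδ0
  obtain ⟨C, hC, h1⟩ := exists_dirPoly_pow (-(1 / 2)) (η := δ / 6) (by positivity) 6
  refine ⟨K * C ^ 2 * (2 ^ 7) ^ (4 * δ) + 1, by positivity, ?_⟩
  intro T₀ μ _ L u hT hμ hL hLT
  have hT0 : 0 < T₀ := by linarith
  obtain ⟨c, hc, hce⟩ := h1 L (fun n => (invSqrt n : ℂ) * osc n u)
    (fun n _ => norm_invSqrt_mul_osc_le u n)
  have e : ∀ t, ‖dirPoly (fun n => (invSqrt n : ℂ)) L (t + u)‖ ^ 14 =
      ‖dirPoly c (L ^ (6 + 1)) t‖ ^ 2 := by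
    intro t
    rw [dirPoly_add, ← hce, norm_pow, ← pow_mul]
  simp_rw [e]
  have h2 := h T₀ μ (L ^ (6 + 1)) c C hT hμ (by positivity) hC (fun n hn => by
    refine (hc n hn).trans (le_of_eq ?_)
    congr 2; push_cast; ring)
  set X := μ.real Set.univ with hX
  have hX0 : 0 ≤ X := measureReal_nonneg
  have hm0 := mainTerm_nonneg hX0 T₀
  have h3 : (((L ^ (6 + 1) : ℕ) : ℝ)) ^ (4 * δ) ≤ (2 ^ 7) ^ (4 * δ) * T₀ ^ (η / 2) := by
    calc (((L ^ (6 + 1) : ℕ) : ℝ)) ^ (4 * δ) ≤ ((2 * T₀ ^ 2) ^ 7) ^ (4 * δ) := by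
          push_cast; gcongr
      _ = _ := by
          rw [mul_pow, Real.mul_rpow (by positivity) (by positivity), ← pow_mul,
            ← Real.rpow_natCast T₀, ← Real.rpow_mul hT0.le]
          congr 2
          rw [hδ]; push_cast; ring
  push_cast at h2 h3
  refine h2.trans ?_
  calc _ ≤ K * C ^ 2 * T₀ ^ (3 * (η / 6)) * ((2 ^ 7) ^ (4 * δ) * T₀ ^ (η / 2)) *
        (mainTerm X T₀ + X * L ^ (6 + 1) + X ^ 2) := by gcongr
    _ = K * C ^ 2 * (2 ^ 7) ^ (4 * δ) * (T₀ ^ (3 * (η / 6)) * T₀ ^ (η / 2)) *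
        (mainTerm X T₀ + X * L ^ 7 + X ^ 2) := by ring
    _ = K * C ^ 2 * (2 ^ 7) ^ (4 * δ) * T₀ ^ η * (mainTerm X T₀ + X * L ^ 7 + X ^ 2) := by
        rw [← Real.rpow_add hT0]; congr 3; ring
    _ ≤ _ := by gcongr; linarith

/-- The dual form of the Halász–Montgomery inequality. -/
theorem sum_wgt_mul_norm_integral_sq_le (μ : Measure ℝ) [IsFiniteMeasure μ] (N : ℕ) {c : ℝ → ℂ}
    (hc : Measurable c) (hc1 : ∀ t, ‖c t‖ ≤ 1) :
    ∑ n ∈ Icc 1 (8 * N), wgt ((n : ℝ) / N) * ‖∫ t, c t * osc n (-t) ∂μ‖ ^ 2 ≤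
      ∫ p : ℝ × ℝ, ‖smoothPoly N (p.1 - p.2)‖ ∂(μ.prod μ) := by
  have h1 : ∀ n : ℕ, ((‖∫ t, c t * osc n (-t) ∂μ‖ ^ 2 : ℝ) : ℂ) =
      ∫ p : ℝ × ℝ, (starRingEnd ℂ) (c p.1) * c p.2 * osc n (p.1 - p.2) ∂(μ.prod μ) := by
    intro n
    push_cast
    rw [← Complex.conj_mul', ← integral_conj, ← integral_prod_mul]
    refine integral_congr_ae (Filter.Eventually.of_forall fun p => ?_)
    simp only [map_mul]
    rw [conj_osc, neg_neg, osc_sub, conj_osc]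
    ring
  have hm : ∀ n : ℕ, Integrable (fun p : ℝ × ℝ =>
      (wgt ((n : ℝ) / N) : ℂ) * ((starRingEnd ℂ) (c p.1) * c p.2 * osc n (p.1 - p.2)))
      (μ.prod μ) := by
    intro n
    refine Integrable.const_mul (Integrable.of_bound (C := 1) ?_
      (Filter.Eventually.of_forall fun p => ?_)) _
    · have h1 : Measurable (osc n) := (continuous_osc n).measurable
      have h2 : Measurable fun p : ℝ × ℝ => (starRingEnd ℂ) (c p.1) :=
        Complex.continuous_conj.measurable.comp (hc.comp measurable_fst)
      exact ((h2.mul (hc.comp measurable_snd)).mul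
        (h1.comp (measurable_fst.sub measurable_snd))).aestronglyMeasurable
    · rw [norm_mul, norm_mul, norm_osc, mul_one, RCLike.norm_conj]
      exact mul_le_one₀ (hc1 _) (norm_nonneg _) (hc1 _)
  have h2 : ((∑ n ∈ Icc 1 (8 * N), wgt ((n : ℝ) / N) * ‖∫ t, c t * osc n (-t) ∂μ‖ ^ 2 : ℝ) : ℂ) =
      ∫ p : ℝ × ℝ, (starRingEnd ℂ) (c p.1) * c p.2 * smoothPoly N (p.1 - p.2) ∂(μ.prod μ) := by
    rw [Complex.ofReal_sum]
    simp_rw [Complex.ofReal_mul, h1, ← integral_const_mul]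
    rw [← integral_finsetSum _ fun n _ => hm n]
    refine integral_congr_ae (Filter.Eventually.of_forall fun p => ?_)
    simp only [smoothPoly, dirPoly, mul_sum]
    refine sum_congr rfl fun n _ => ?_
    ring
  have h0 : 0 ≤ ∑ n ∈ Icc 1 (8 * N), wgt ((n : ℝ) / N) * ‖∫ t, c t * osc n (-t) ∂μ‖ ^ 2 :=
    sum_nonneg fun n _ => mul_nonneg (wgt_nonneg _) (by positivity)
  rw [← Complex.norm_of_nonneg h0, h2]
  refine norm_integral_le_of_norm_le ?_ (Filter.Eventually.of_forall fun p => ?_)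
  · simpa [smoothPoly] using integrable_norm_dirPoly_pow (μ.prod μ)
      (fun n => (wgt ((n : ℝ) / N) : ℂ)) (8 * N) 1 (φ := fun p : ℝ × ℝ => p.1 - p.2) (by fun_prop)
  · rw [norm_mul, norm_mul, RCLike.norm_conj]
    exact mul_le_of_le_one_left (norm_nonneg _)
      (mul_le_one₀ (hc1 _) (norm_nonneg _) (hc1 _))

theorem sq_measure_mul_le_integral_smoothPoly (μ : Measure ℝ) [IsFiniteMeasure μ] {N : ℕ}
    (hN : 0 < N) {a : ℕ → ℂ} {K V : ℝ} (hV : 0 ≤ V)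
    (ha : ∀ n ∈ Ioc N (2 * N), ‖a n‖ ≤ K)
    (hF : ∀ᵐ t ∂μ, V ≤ ‖∑ n ∈ Ioc N (2 * N), a n * osc n (-t)‖) :
    (μ.real Set.univ * V) ^ 2 ≤
      K ^ 2 * N * ∫ p : ℝ × ℝ, ‖smoothPoly N (p.1 - p.2)‖ ∂(μ.prod μ) := by
  have hN0 : (0 : ℝ) < N := by exact_mod_cast hN
  have hK : 0 ≤ K := (norm_nonneg _).trans (ha (2 * N) (mem_Ioc.2 (by omega)))
  set F : ℝ → ℂ := fun t => ∑ n ∈ Ioc N (2 * N), a n * osc n (-t) with hFdef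
  have hFc : Continuous F := by fun_prop
  set c : ℝ → ℂ := fun t => (starRingEnd ℂ) (F t) / (‖F t‖ : ℂ) with hcdef
  have hcm : Measurable c :=
    (Complex.continuous_conj.comp hFc).measurable.div
      (Complex.continuous_ofReal.comp hFc.norm).measurable
  have hc1 : ∀ t, ‖c t‖ ≤ 1 := fun t => by
    simp only [hcdef, norm_div, RCLike.norm_conj, Complex.norm_real, norm_norm]
    exact div_self_le_one _
  have hcF : ∀ t, c t * F t = (‖F t‖ : ℂ) := fun t => by
    simp only [hcdef]
    rw [div_mul_eq_mul_div, Complex.conj_mul']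
    rcases eq_or_ne (‖F t‖ : ℂ) 0 with h | h
    · rw [h]; simp
    · field_simp
  have hFb : ∀ t, ‖F t‖ ≤ ∑ n ∈ Ioc N (2 * N), ‖a n‖ := fun t => by
    refine (norm_sum_le _ _).trans (le_of_eq (sum_congr rfl fun n _ => ?_))
    rw [norm_mul, norm_osc, mul_one]
  have hint : Integrable (fun t => ‖F t‖) μ :=
    Continuous.integrable_of_norm_le (C := ∑ n ∈ Ioc N (2 * N), ‖a n‖) hFc.norm
      (fun t => by rw [norm_norm]; exact hFb t)
  have hci : ∀ n, Integrable (fun t => c t * osc n (-t)) μ := fun n => by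
    refine Integrable.of_bound (C := 1) (hcm.mul ((continuous_osc n).measurable.comp
      measurable_neg)).aestronglyMeasurable (Filter.Eventually.of_forall fun t => ?_)
    rw [norm_mul, norm_osc, mul_one]
    exact hc1 t
  have h1 : μ.real Set.univ * V ≤ ∫ t, ‖F t‖ ∂μ := by
    rw [← smul_eq_mul, ← integral_const]
    exact integral_mono_ae (integrable_const _) hint hF
  have h2 : ((∫ t, ‖F t‖ ∂μ : ℝ) : ℂ) =
      ∑ n ∈ Ioc N (2 * N), a n * ∫ t, c t * osc n (-t) ∂μ := by
    rw [← integral_complex_ofReal]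
    simp_rw [← integral_const_mul]
    rw [← integral_finsetSum _ fun n _ => (hci n).const_mul _]
    refine integral_congr_ae (Filter.Eventually.of_forall fun t => ?_)
    simp only
    rw [← hcF, hFdef, mul_sum]
    refine sum_congr rfl fun n _ => ?_
    ring
  have h3 : ∫ t, ‖F t‖ ∂μ ≤ K * ∑ n ∈ Ioc N (2 * N), ‖∫ t, c t * osc n (-t) ∂μ‖ := by
    rw [← Complex.norm_of_nonneg (integral_nonneg fun t => norm_nonneg (F t)), h2, mul_sum]
    refine (norm_sum_le _ _).trans (sum_le_sum fun n hn => ?_)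
    rw [norm_mul]
    gcongr
    exact ha n hn
  have h4 : ∑ n ∈ Ioc N (2 * N), ‖∫ t, c t * osc n (-t) ∂μ‖ ^ 2 ≤
      ∫ p : ℝ × ℝ, ‖smoothPoly N (p.1 - p.2)‖ ∂(μ.prod μ) := by
    refine le_trans ?_ (sum_wgt_mul_norm_integral_sq_le μ N hcm hc1)
    calc _ = ∑ n ∈ Ioc N (2 * N), wgt ((n : ℝ) / N) * ‖∫ t, c t * osc n (-t) ∂μ‖ ^ 2 := by
          refine sum_congr rfl fun n hn => ?_
          rw [mem_Ioc] at hn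
          rw [wgt_eq_one, one_mul]
          · rw [le_div_iff₀ hN0, one_mul]; exact_mod_cast hn.1.le
          · rw [div_le_iff₀ hN0]; exact_mod_cast hn.2
      _ ≤ _ := by
          refine sum_le_sum_of_subset_of_nonneg (fun n hn => ?_) fun n _ _ =>
            mul_nonneg (wgt_nonneg _) (by positivity)
          rw [mem_Ioc] at hn
          rw [mem_Icc]
          omega
  have h5 : (∑ n ∈ Ioc N (2 * N), ‖∫ t, c t * osc n (-t) ∂μ‖) ^ 2 ≤
      N * ∑ n ∈ Ioc N (2 * N), ‖∫ t, c t * osc n (-t) ∂μ‖ ^ 2 := by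
    refine sq_sum_le_card_mul_sum_sq.trans (le_of_eq ?_)
    rw [Nat.card_Ioc, show 2 * N - N = N by omega]
  calc _ ≤ (K * ∑ n ∈ Ioc N (2 * N), ‖∫ t, c t * osc n (-t) ∂μ‖) ^ 2 :=
        pow_le_pow_left₀ (mul_nonneg measureReal_nonneg hV) (h1.trans h3) 2
    _ = K ^ 2 * (∑ n ∈ Ioc N (2 * N), ‖∫ t, c t * osc n (-t) ∂μ‖) ^ 2 := by ring
    _ ≤ K ^ 2 * (N * ∫ p : ℝ × ℝ, ‖smoothPoly N (p.1 - p.2)‖ ∂(μ.prod μ)) := by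
        gcongr; exact h5.trans (by gcongr)
    _ = _ := by ring

/-- A bound for the `L¹` mean of `smoothPoly N` over differences, through reflection and the
fourteenth moment of the reflected polynomial. -/
theorem exists_integral_norm_smoothPoly_le {η : ℝ} (hη : 0 < η) (hη1 : η ≤ 1) :
    ∃ C : ℝ, 0 < C ∧ ∀ (T₀ : ℝ) (μ : Measure ℝ) [IsFiniteMeasure μ] (N : ℕ), 1 ≤ T₀ →
    LocalizedIn μ T₀ → 0 < N → (N : ℝ) ≤ T₀ → ∃ R : ℝ, 0 ≤ R ∧
    ∫ p : ℝ × ℝ, ‖smoothPoly N (p.1 - p.2)‖ ∂(μ.prod μ) ≤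
      C * (N * μ.real Set.univ + Real.sqrt N * R + μ.real Set.univ ^ 2) ∧
    R ^ 14 ≤ C * μ.real Set.univ ^ 26 * (T₀ ^ η * (mainTerm (μ.real Set.univ) T₀ +
      μ.real Set.univ * (T₀ ^ (1 + η) / N) ^ 7 + μ.real Set.univ ^ 2)) := by
  obtain ⟨C₁, hC₁, h1⟩ := exists_norm_smoothPoly_le hη
  obtain ⟨C₂, hC₂, h2⟩ := exists_integral_invSqrt_pow_fourteen_le hη hη1
  set W := bumpMeasure.real Set.univ with hW
  have hW0 : 0 ≤ W := measureReal_nonneg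
  refine ⟨4 * C₁ + W ^ 14 * C₂ * 2 ^ 7, by positivity, ?_⟩
  intro T₀ μ _ N hT hμ hN hNT
  have hT0 : 0 < T₀ := by linarith
  have hN0 : (0 : ℝ) < N := by exact_mod_cast hN
  have hN1 : (1 : ℝ) ≤ N := by exact_mod_cast hN
  set X := μ.real Set.univ with hX
  have hX0 : 0 ≤ X := measureReal_nonneg
  have hm0 := mainTerm_nonneg hX0 T₀
  set L := ⌈T₀ ^ (1 + η) / N⌉₊ with hL
  have hq : 1 ≤ T₀ ^ (1 + η) / N := by
    rw [le_div_iff₀ hN0, one_mul]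
    refine hNT.trans ?_
    calc T₀ = T₀ ^ (1 : ℝ) := (Real.rpow_one _).symm
      _ ≤ _ := Real.rpow_le_rpow_of_exponent_le hT (by linarith)
  have hL0 : 0 < L := Nat.ceil_pos.2 (by linarith)
  have hL1 : T₀ ^ (1 + η) ≤ N * L := by
    have := Nat.le_ceil (T₀ ^ (1 + η) / N)
    rw [div_le_iff₀ hN0] at this
    linarith
  have hL2 : (L : ℝ) ≤ 2 * (T₀ ^ (1 + η) / N) := by
    have := Nat.ceil_lt_add_one (show 0 ≤ T₀ ^ (1 + η) / N by positivity)
    rw [← hL] at this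
    linarith
  have hL3 : (L : ℝ) ≤ 2 * T₀ ^ 2 := by
    refine hL2.trans ?_
    gcongr
    calc T₀ ^ (1 + η) / N ≤ T₀ ^ (1 + η) := div_le_self (by positivity) hN1
      _ ≤ T₀ ^ ((2 : ℕ) : ℝ) := Real.rpow_le_rpow_of_exponent_le hT (by push_cast; linarith)
      _ = _ := Real.rpow_natCast _ _
  set D : ℝ × ℝ → ℝ := fun p => ∫ ω, ‖dirPoly (fun n => (invSqrt n : ℂ)) L
    (p.1 - p.2 + 2 * Real.pi * ω)‖ ∂bumpMeasure with hD
  have hD0 : ∀ p, 0 ≤ D p := fun p => integral_nonneg fun _ => norm_nonneg _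
  have hD1 : Integrable D (μ.prod μ) := by
    simpa using integrable_integral_bumpMeasure_pow μ (fun n => (invSqrt n : ℂ)) L 1
  have hD14 : ∫ p, D p ^ 14 ∂(μ.prod μ) ≤ W ^ 14 * (C₂ * T₀ ^ η * (mainTerm X T₀ +
      X * (L : ℝ) ^ 7 + X ^ 2)) :=
    pow_integral_bumpMeasure_le μ (fun n => (invSqrt n : ℂ)) L 13
      (fun u => h2 T₀ μ L u hT hμ hL0 hL3)
  refine ⟨∫ p, D p ∂(μ.prod μ), integral_nonneg hD0, ?_, ?_⟩
  · have hpt : ∀ᵐ p : ℝ × ℝ ∂(μ.prod μ), ‖smoothPoly N (p.1 - p.2)‖ ≤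
        C₁ * (N * (1 + (p.1 - p.2) ^ 2)⁻¹ + Real.sqrt N * D p + 1) := by
      filter_upwards [hμ.ae_abs_sub_le] with p hp
      have h3 := h1 T₀ N L (p.1 - p.2) hT hN hp hL1
      rw [← integral_bumpMeasure] at h3
      simpa only [hD, div_eq_mul_inv] using h3
    have i1 := (integrable_inv_one_add_sq_sub μ).const_mul (N : ℝ)
    have i2 := hD1.const_mul (Real.sqrt N)
    have i3 : Integrable (fun p : ℝ × ℝ => N * (1 + (p.1 - p.2) ^ 2)⁻¹ + Real.sqrt N * D p)
        (μ.prod μ) := i1.add i2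
    calc _ ≤ ∫ p : ℝ × ℝ, C₁ * (N * (1 + (p.1 - p.2) ^ 2)⁻¹ + Real.sqrt N * D p + 1)
          ∂(μ.prod μ) := by
          refine integral_mono_ae ?_ ((i3.add (integrable_const 1)).const_mul _) hpt
          simpa [smoothPoly] using integrable_norm_dirPoly_pow (μ.prod μ)
            (fun n => (wgt ((n : ℝ) / N) : ℂ)) (8 * N) 1 (φ := fun p : ℝ × ℝ => p.1 - p.2)
            (by fun_prop)
      _ = C₁ * (N * (∫ p : ℝ × ℝ, (1 + (p.1 - p.2) ^ 2)⁻¹ ∂(μ.prod μ)) +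
            Real.sqrt N * (∫ p, D p ∂(μ.prod μ)) + X ^ 2) := by
          rw [integral_const_mul, integral_add i3 (integrable_const 1), integral_add i1 i2,
            integral_const_mul, integral_const_mul, integral_const, measureReal_prod_univ]
          simp [hX]
      _ ≤ C₁ * (N * (4 * X) + Real.sqrt N * (∫ p, D p ∂(μ.prod μ)) + X ^ 2) := by
          gcongr
          exact hμ.integral_inv_one_add_sq_le hT0.le
      _ ≤ 4 * C₁ * (N * X + Real.sqrt N * (∫ p, D p ∂(μ.prod μ)) + X ^ 2) := by
          have b1 : 0 ≤ Real.sqrt N * (∫ p, D p ∂(μ.prod μ)) :=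
            mul_nonneg (Real.sqrt_nonneg _) (integral_nonneg hD0)
          have b2 : 0 ≤ X ^ 2 := by positivity
          nlinarith [mul_nonneg hC₁.le b1, mul_nonneg hC₁.le b2]
      _ ≤ _ := by
          have b1 : 0 ≤ ∫ p, D p ∂(μ.prod μ) := integral_nonneg hD0
          gcongr
          have : 0 ≤ W ^ 14 * C₂ * 2 ^ 7 := by positivity
          linarith
  · have h3 := pow_integral_le (μ.prod μ) 13 hD0 hD1
      (integrable_integral_bumpMeasure_pow μ _ L 14)
    rw [measureReal_prod_univ, ← hX, ← pow_mul] at h3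
    calc _ ≤ X ^ 26 * (W ^ 14 * (C₂ * T₀ ^ η * (mainTerm X T₀ + X * (L : ℝ) ^ 7 + X ^ 2))) := by
          refine h3.trans ?_
          gcongr
      _ ≤ X ^ 26 * (W ^ 14 * (C₂ * T₀ ^ η * (2 ^ 7 * (mainTerm X T₀ +
            X * (T₀ ^ (1 + η) / N) ^ 7 + X ^ 2)))) := by
          have : X * (L : ℝ) ^ 7 ≤ 2 ^ 7 * (X * (T₀ ^ (1 + η) / N) ^ 7) := by
            calc X * (L : ℝ) ^ 7 ≤ X * (2 * (T₀ ^ (1 + η) / N)) ^ 7 := by gcongr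
              _ = _ := by ring
          gcongr
          nlinarith [sq_nonneg X]
      _ = W ^ 14 * C₂ * 2 ^ 7 * (X ^ 26 * (T₀ ^ η * (mainTerm X T₀ +
            X * (T₀ ^ (1 + η) / N) ^ 7 + X ^ 2))) := by ring
      _ ≤ (4 * C₁ + W ^ 14 * C₂ * 2 ^ 7) * (X ^ 26 * (T₀ ^ η * (mainTerm X T₀ +
            X * (T₀ ^ (1 + η) / N) ^ 7 + X ^ 2))) := by
          gcongr
          linarith
      _ = _ := by ring

/-- If the last of three terms is small, one of the first two dominates their sum. -/
theorem le_or_le_of_le_add {x a b c : ℝ} (h : x ≤ a + b + c) (hc : 3 * c < x) :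
    x ≤ 3 * a ∨ x ≤ 3 * b := by
  by_contra! h1
  linarith [h1.1, h1.2]

/-- A large values estimate of Jutila type with parameter `7`. -/
theorem exists_measure_le {η : ℝ} (hη : 0 < η) (hη1 : η ≤ 1) :
    ∃ C : ℝ, 0 < C ∧ ∀ (T₀ : ℝ) (μ : Measure ℝ) [IsFiniteMeasure μ] (N : ℕ) (a : ℕ → ℂ)
    (A V : ℝ), 1 ≤ T₀ → LocalizedIn μ T₀ → 0 < N → (N : ℝ) ≤ T₀ → 1 ≤ A → 0 < V →
    (∀ n ∈ Ioc N (2 * N), ‖a n‖ ≤ A / N) →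
    (∀ᵐ t ∂μ, V ≤ ‖∑ n ∈ Ioc N (2 * N), a n * osc n (-t)‖) →
    C * A ^ 2 < V ^ 2 * N → C * A ^ 28 * T₀ ^ η < V ^ 28 * (N : ℝ) ^ 7 →
    μ.real Set.univ ≤ C * A ^ 56 * T₀ ^ (8 * η) *
      (1 / V ^ 2 + T₀ / (V ^ 56 * (N : ℝ) ^ 14) + T₀ ^ 7 / (V ^ 28 * (N : ℝ) ^ 14)) := by
  obtain ⟨C₁, hC₁, h1⟩ := exists_integral_norm_smoothPoly_le hη hη1
  set C₂ : ℝ := (3 * C₁) ^ 14 * C₁ with hC₂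
  have hC₂0 : 0 < C₂ := by positivity
  refine ⟨3 * C₁ + 9 * C₂ ^ 2 + 3 * C₂, by positivity, ?_⟩
  intro T₀ μ _ N a A V hT hμ hN hNT hA hV ha hF hV1 hV2
  set C : ℝ := 3 * C₁ + 9 * C₂ ^ 2 + 3 * C₂ with hC
  clear_value C C₂
  have hC0 : 0 < C := by rw [hC]; positivity
  have hT0 : 0 < T₀ := by linarith
  have hA0 : 0 < A := by linarith
  have hN0 : (0 : ℝ) < N := by exact_mod_cast hN
  obtain ⟨R, hR0, hR1, hR2⟩ := h1 T₀ μ N hT hμ hN hNT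
  have h2 := sq_measure_mul_le_integral_smoothPoly μ hN hV.le ha hF
  have hX0 : 0 ≤ μ.real Set.univ := measureReal_nonneg
  generalize μ.real Set.univ = X at *
  have hm0 := mainTerm_nonneg hX0 T₀
  have hTη : 1 ≤ T₀ ^ (8 * η) := Real.one_le_rpow hT (by positivity)
  have hfirst : ∀ {K e y : ℝ} {k : ℕ}, 0 ≤ y → 0 < K → K ≤ C → k ≤ 56 → e ≤ 8 * η →
      X ≤ K * A ^ k * T₀ ^ e * y →
      y ≤ 1 / V ^ 2 + T₀ / (V ^ 56 * (N : ℝ) ^ 14) + T₀ ^ 7 / (V ^ 28 * (N : ℝ) ^ 14) →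
      X ≤ C * A ^ 56 * T₀ ^ (8 * η) *
        (1 / V ^ 2 + T₀ / (V ^ 56 * (N : ℝ) ^ 14) + T₀ ^ 7 / (V ^ 28 * (N : ℝ) ^ 14)) := by
    intro K e y k hy hK hKC hk he h hy2
    refine h.trans ?_
    gcongr
  have p1 : 0 ≤ 1 / V ^ 2 := by positivity
  have p2 : 0 ≤ T₀ / (V ^ 56 * (N : ℝ) ^ 14) := by positivity
  have p3 : 0 ≤ T₀ ^ 7 / (V ^ 28 * (N : ℝ) ^ 14) := by positivity
  rcases hX0.eq_or_lt with hX | hX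
  · rw [← hX]; positivity
  have h3 : X ^ 2 * (V ^ 2 * N) ≤ C₁ * A ^ 2 * (N * X) + C₁ * A ^ 2 * (Real.sqrt N * R) +
      C₁ * A ^ 2 * X ^ 2 := by
    calc X ^ 2 * (V ^ 2 * N) = (X * V) ^ 2 * N := by ring
      _ ≤ (A / N) ^ 2 * N * (C₁ * (N * X + Real.sqrt N * R + X ^ 2)) * N := by
          gcongr
          exact h2.trans (by gcongr)
      _ = _ := by field_simp
  rcases le_or_le_of_le_add h3 (by
    have : 3 * C₁ * A ^ 2 < V ^ 2 * N := lt_of_le_of_lt (by gcongr; rw [hC]; linarith [sq_nonneg C₂]) hV1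
    nlinarith [pow_pos hX 2]) with h4 | h4
  · refine hfirst (K := 3 * C₁) (k := 2) (e := 0) p1 (by positivity) (by rw [hC]; linarith [sq_nonneg C₂])
      (by norm_num) (by positivity) ?_ (by linarith)
    rw [Real.rpow_zero, mul_one, mul_one_div, le_div_iff₀ (by positivity)]
    have : (N * X) * (X * V ^ 2) ≤ (N * X) * (3 * C₁ * A ^ 2) := by linarith
    exact le_of_mul_le_mul_left this (by positivity)
  · have h5 : X ^ 2 * (V ^ 28 * (N : ℝ) ^ 7) ≤ C₂ * A ^ 28 * T₀ ^ η * mainTerm X T₀ +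
        C₂ * A ^ 28 * T₀ ^ η * (X * (T₀ ^ (1 + η) / N) ^ 7) + C₂ * A ^ 28 * T₀ ^ η * X ^ 2 := by
      have h6 : (X ^ 2 * (V ^ 2 * N)) ^ 14 ≤ (3 * (C₁ * A ^ 2 * (Real.sqrt N * R))) ^ 14 := by
        gcongr
      have h7 : Real.sqrt N ^ 14 = (N : ℝ) ^ 7 := by
        rw [show 14 = 2 * 7 by norm_num, pow_mul, Real.sq_sqrt hN0.le]
      have h8 : (X ^ 26 * (N : ℝ) ^ 7) * (X ^ 2 * (V ^ 28 * (N : ℝ) ^ 7)) ≤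
          (X ^ 26 * (N : ℝ) ^ 7) * (C₂ * A ^ 28 * (T₀ ^ η * (mainTerm X T₀ +
            X * (T₀ ^ (1 + η) / N) ^ 7 + X ^ 2))) := by
        calc _ = (X ^ 2 * (V ^ 2 * N)) ^ 14 := by ring
          _ ≤ _ := h6
          _ = (3 * C₁) ^ 14 * A ^ 28 * Real.sqrt N ^ 14 * R ^ 14 := by ring
          _ ≤ (3 * C₁) ^ 14 * A ^ 28 * Real.sqrt N ^ 14 * (C₁ * X ^ 26 * (T₀ ^ η * (mainTerm X T₀ +
            X * (T₀ ^ (1 + η) / N) ^ 7 + X ^ 2))) := by gcongr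
          _ = _ := by rw [h7, hC₂]; ring
      exact (le_of_mul_le_mul_left h8 (by positivity)).trans (le_of_eq (by ring))
    have h9 : 3 * (C₂ * A ^ 28 * T₀ ^ η * X ^ 2) < X ^ 2 * (V ^ 28 * (N : ℝ) ^ 7) := by
      have h10 : 3 * C₂ ≤ C := by rw [hC]; linarith [sq_nonneg C₂]
      have h11 : 3 * C₂ * A ^ 28 * T₀ ^ η < V ^ 28 * (N : ℝ) ^ 7 :=
        lt_of_le_of_lt (by gcongr) hV2
      calc _ = X ^ 2 * (3 * C₂ * A ^ 28 * T₀ ^ η) := by ring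
        _ < _ := by gcongr
    rcases le_or_le_of_le_add h5 h9 with h6 | h6
    · refine hfirst (K := 9 * C₂ ^ 2) (k := 56) (e := 2 * η) p2 (by positivity)
        (by rw [hC]; linarith) le_rfl (by linarith) ?_ (by linarith)
      rw [mul_div_assoc', le_div_iff₀ (by positivity)]
      have h7 : X * (X * (V ^ 28 * (N : ℝ) ^ 7)) ≤
          X * (3 * (C₂ * A ^ 28 * T₀ ^ η) * Real.sqrt (X * T₀)) := by
        refine le_trans (le_of_eq (by ring)) (h6.trans (le_of_eq ?_))
        rw [mainTerm]; ring
      have h8 := pow_le_pow_left₀ (by positivity) (le_of_mul_le_mul_left h7 hX) 2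
      rw [mul_pow _ (Real.sqrt (X * T₀)), Real.sq_sqrt (by positivity)] at h8
      have h9 : (T₀ ^ η) ^ 2 = T₀ ^ (2 * η) := by
        rw [← Real.rpow_natCast, ← Real.rpow_mul hT0.le]; push_cast; ring_nf
      have h10 : X * (X * (V ^ 56 * (N : ℝ) ^ 14)) ≤
          X * (9 * C₂ ^ 2 * A ^ 56 * T₀ ^ (2 * η) * T₀) := by
        rw [← h9]
        refine le_trans (le_of_eq (by ring)) (h8.trans (le_of_eq (by ring)))
      exact le_of_mul_le_mul_left h10 hX
    · refine hfirst (K := 3 * C₂) (k := 28) (e := 8 * η) p3 (by positivity)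
        (by rw [hC]; linarith [sq_nonneg C₂]) (by norm_num) le_rfl ?_ (by linarith)
      rw [mul_div_assoc', le_div_iff₀ (by positivity)]
      have h7 : T₀ ^ η * (T₀ ^ (1 + η)) ^ 7 = T₀ ^ (8 * η) * T₀ ^ 7 := by
        rw [← Real.rpow_natCast (T₀ ^ _), ← Real.rpow_mul hT0.le, ← Real.rpow_add hT0,
          ← Real.rpow_natCast T₀, ← Real.rpow_add hT0]
        congr 1; push_cast; ring
      have h8 : X * (X * (V ^ 28 * (N : ℝ) ^ 14)) ≤
          X * (3 * C₂ * A ^ 28 * T₀ ^ (8 * η) * T₀ ^ 7) := by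
        calc _ = X ^ 2 * (V ^ 28 * (N : ℝ) ^ 7) * (N : ℝ) ^ 7 := by ring
          _ ≤ 3 * (C₂ * A ^ 28 * T₀ ^ η * (X * (T₀ ^ (1 + η) / N) ^ 7)) * (N : ℝ) ^ 7 := by
              gcongr
          _ = X * (3 * C₂ * A ^ 28 * (T₀ ^ η * (T₀ ^ (1 + η)) ^ 7)) := by field_simp
          _ = _ := by rw [h7]; ring
      exact le_of_mul_le_mul_left h8 hX

theorem measureReal_le_of_forall_inter_Icc_le {E : Set ℝ} {T T₀ b : ℝ} (hT₀ : 0 < T₀)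
    (hT : T₀ ≤ T) (hE : E ⊆ Set.Icc (-T) T)
    (hb : ∀ x, volume.real (E ∩ Set.Icc x (x + T₀)) ≤ b) :
    volume.real E ≤ 3 * (T / T₀) * b := by
  have hb0 : 0 ≤ b := measureReal_nonneg.trans (hb 0)
  set K := ⌈2 * T / T₀⌉₊ with hK
  have hsub : E ⊆ ⋃ i ∈ range K, E ∩ Set.Icc (-T + i * T₀) (-T + i * T₀ + T₀) := by
    intro t ht
    obtain ⟨h1, h2⟩ := hE ht
    have h0 : 0 ≤ (t + T) / T₀ := div_nonneg (by linarith) hT₀.le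
    simp only [Set.mem_iUnion, mem_range]
    rcases h2.lt_or_eq with h2 | h2
    · refine ⟨⌊(t + T) / T₀⌋₊, ?_, ht, ?_, ?_⟩
      · rw [Nat.floor_lt h0]
        refine lt_of_lt_of_le ?_ (Nat.le_ceil _)
        gcongr
        linarith
      · have := Nat.floor_le h0
        rw [le_div_iff₀ hT₀] at this
        linarith
      · have := Nat.lt_floor_add_one ((t + T) / T₀)
        rw [div_lt_iff₀ hT₀] at this
        linarith
    · have hK0 : 0 < K := Nat.ceil_pos.2 (by
        have : 0 < T := by linarith
        positivity)
      have hK1 : ((K - 1 : ℕ) : ℝ) = K - 1 := by rw [Nat.cast_sub hK0]; simp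
      have h3 := Nat.le_ceil (2 * T / T₀)
      have h4 := Nat.ceil_lt_add_one (show 0 ≤ 2 * T / T₀ by
        have : 0 < T := by linarith
        positivity)
      rw [← hK] at h3 h4
      rw [div_le_iff₀ hT₀] at h3
      rw [← sub_lt_iff_lt_add, lt_div_iff₀ hT₀] at h4
      refine ⟨K - 1, by omega, ht, ?_, ?_⟩
      · rw [hK1, h2]; linarith
      · rw [hK1, h2]; linarith
  have hfin : ∀ i ∈ range K, volume (E ∩ Set.Icc (-T + i * T₀) (-T + i * T₀ + T₀)) ≠ ⊤ :=
    fun i _ h => measure_Icc_lt_top.ne (measure_mono_top Set.inter_subset_right h)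
  calc volume.real E ≤ volume.real (⋃ i ∈ range K, E ∩ Set.Icc (-T + i * T₀) (-T + i * T₀ + T₀)) :=
        measureReal_mono hsub (measure_biUnion_lt_top (range K).finite_toSet
          fun i hi => (hfin i hi).lt_top).ne
    _ ≤ ∑ i ∈ range K, volume.real (E ∩ Set.Icc (-T + i * T₀) (-T + i * T₀ + T₀)) :=
        measureReal_biUnion_finset_le _ _
    _ ≤ ∑ i ∈ range K, b := sum_le_sum fun i _ => hb _
    _ = K * b := by rw [sum_const, card_range, nsmul_eq_mul]
    _ ≤ _ := by
        gcongr
        have h1 := Nat.ceil_lt_add_one (show 0 ≤ 2 * T / T₀ by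
          have : 0 < T := by linarith
          positivity)
        have h2 : 1 ≤ T / T₀ := by rwa [le_div_iff₀ hT₀, one_mul]
        have h3 : 2 * T / T₀ = 2 * (T / T₀) := by ring
        rw [← hK] at h1
        linarith

theorem cpow_neg_one_sub_I_mul (n : ℕ) (hn : n ≠ 0) (t : ℝ) :
    (n : ℂ) ^ (-(1 : ℂ) - Complex.I * t) = (n : ℂ)⁻¹ * osc n (-t) := by
  have hn0 : (n : ℂ) ≠ 0 := by exact_mod_cast hn
  rw [sub_eq_add_neg, Complex.cpow_add _ _ hn0, Complex.cpow_neg_one,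
    Complex.cpow_def_of_ne_zero hn0, ← Complex.natCast_log, osc]
  congr 2
  push_cast
  ring

theorem exists_norm_div_le {κ B C₀ : ℝ} (hκ : 0 < κ) (hκ1 : κ ≤ 1) (hB : 0 ≤ B) (hC₀ : 0 < C₀) :
    ∃ K : ℝ, 1 ≤ K ∧ ∀ (a : ℕ → ℂ) (N : ℕ), 0 < N →
      (∀ n, ‖a n‖ ≤ C₀ * (n.divisors.card : ℝ) ^ B) →
      ∀ n ∈ Ioc N (2 * N), ‖a n * (n : ℂ)⁻¹‖ ≤ K * (N : ℝ) ^ κ / N := by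
  obtain ⟨D, hD1, hD⟩ := exists_card_divisors_le_rpow (η := κ / (B + 1)) (by positivity)
  refine ⟨max 1 (C₀ * D ^ B * 2), le_max_left _ _, ?_⟩
  intro a N hN ha n hn
  rw [mem_Ioc] at hn
  have hN0 : (0 : ℝ) < N := by exact_mod_cast hN
  have hNn : (N : ℝ) ≤ n := by exact_mod_cast hn.1.le
  have hn0 : (0 : ℝ) < n := by linarith
  have hn1 : (1 : ℝ) ≤ n := by exact_mod_cast (show 1 ≤ n by omega)
  have hn2 : (n : ℝ) ≤ 2 * N := by exact_mod_cast hn.2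
  have h1 : ‖a n‖ ≤ C₀ * D ^ B * 2 * (N : ℝ) ^ κ := by
    calc ‖a n‖ ≤ C₀ * (n.divisors.card : ℝ) ^ B := ha n
      _ ≤ C₀ * (D * (n : ℝ) ^ (κ / (B + 1))) ^ B := by
          gcongr
          exact hD n (by omega)
      _ = C₀ * D ^ B * (n : ℝ) ^ (κ * (B / (B + 1))) := by
          rw [Real.mul_rpow (by positivity) (by positivity), ← Real.rpow_mul hn0.le, mul_assoc]
          congr 3; ring
      _ ≤ C₀ * D ^ B * (n : ℝ) ^ κ := by
          gcongr
          refine mul_le_of_le_one_right hκ.le ?_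
          rw [div_le_one (by positivity)]; linarith
      _ ≤ C₀ * D ^ B * (2 * N) ^ κ := by gcongr
      _ = C₀ * D ^ B * (2 ^ κ * (N : ℝ) ^ κ) := by rw [Real.mul_rpow (by norm_num) hN0.le]
      _ ≤ C₀ * D ^ B * (2 ^ (1 : ℝ) * (N : ℝ) ^ κ) := by gcongr; norm_num
      _ = _ := by rw [Real.rpow_one]; ring
  rw [norm_mul, norm_inv, Complex.norm_natCast, ← div_eq_mul_inv]
  have h2 := le_max_right 1 (C₀ * D ^ B * 2)
  gcongr
  exact h1.trans (by gcongr)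

theorem one_add_mul_le_first {ε σ : ℝ} (hε : 0 < ε) (hε1 : ε ≤ 1 / 100)
    (hσ : σ ≤ 49 / 206 - 5 * ε) :
    1 + (9 / 11 - 10 * ε) * (40 * σ / 7 - 2) ≤ 2 * σ - ε ^ 2 := by
  have hg : 0 ≤ 40 / 7 * (9 / 11 - 10 * ε) - 2 := by linarith
  have h := mul_le_mul_of_nonneg_right hσ hg
  nlinarith

theorem one_add_mul_le_second {ε σ : ℝ} (hε : 0 < ε) (hε1 : ε ≤ 1 / 100)
    (hσ : σ ≤ 49 / 206 - 5 * ε) :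
    1 + (9 / 11 - 10 * ε) * (56 * σ - 14) ≤ 2 * σ - ε ^ 2 := by
  have hg : 0 ≤ 56 * (9 / 11 - 10 * ε) - 2 := by linarith
  have h := mul_le_mul_of_nonneg_right hσ hg
  nlinarith

theorem main_terms_le {ε σ T n T₀ V : ℝ} (hε : 0 < ε) (hε1 : ε ≤ 1 / 100)
    (hσ0 : 5 * ε ≤ σ) (hσ : σ ≤ 49 / 206 - 5 * ε) (hT : 1 ≤ T) (hn : 1 ≤ n)
    (hn1 : T ^ ((9 : ℝ) / 11 - 10 * ε) ≤ n) (hn2 : n ≤ T ^ (1 - ε / 10))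
    (hT₀ : T₀ = min T (n ^ (2 - 26 * σ / 7))) (hV : V = n ^ (-σ)) :
    T / T₀ * (1 / V ^ 2 + T₀ / (V ^ 56 * n ^ 14) + T₀ ^ 7 / (V ^ 28 * n ^ 14)) ≤
      5 * T ^ (2 * σ - ε ^ 2) := by
  have hn0 : 0 < n := by linarith
  have hT0 : 0 < T := by linarith
  have hT₀0 : 0 < T₀ := by rw [hT₀]; exact lt_min hT0 (by positivity)
  have e1 : 1 / V ^ 2 = n ^ (2 * σ) := by
    rw [hV, ← Real.rpow_natCast, ← Real.rpow_mul hn0.le, one_div, ← Real.rpow_neg hn0.le]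
    congr 1; push_cast; ring
  have e2 : ∀ k : ℕ, V ^ k * n ^ 14 = n ^ (14 - k * σ) := fun k => by
    rw [hV, ← Real.rpow_natCast, ← Real.rpow_mul hn0.le, ← Real.rpow_natCast n 14,
      ← Real.rpow_add hn0]
    congr 1; push_cast; ring
  have h1 : T₀ ^ 7 / (V ^ 28 * n ^ 14) ≤ n ^ (2 * σ) := by
    rw [e2, div_le_iff₀ (by positivity), ← Real.rpow_add hn0]
    calc T₀ ^ 7 ≤ (n ^ (2 - 26 * σ / 7)) ^ 7 := by
          gcongr
          rw [hT₀]; exact min_le_right _ _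
      _ = _ := by
          rw [← Real.rpow_natCast, ← Real.rpow_mul hn0.le]
          congr 1; push_cast; ring
  have h2 : n ^ (2 * σ) ≤ T ^ (2 * σ - ε ^ 2) := by
    calc n ^ (2 * σ) ≤ (T ^ (1 - ε / 10)) ^ (2 * σ) := by gcongr; linarith
      _ = T ^ ((1 - ε / 10) * (2 * σ)) := by rw [← Real.rpow_mul hT0.le]
      _ ≤ _ := by
          refine Real.rpow_le_rpow_of_exponent_le hT ?_
          nlinarith
  have hneg : ∀ {e : ℝ}, e ≤ 0 → T * n ^ e ≤ T ^ (1 + (9 / 11 - 10 * ε) * e) := fun {e} he => by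
    rw [Real.rpow_add hT0, Real.rpow_one, Real.rpow_mul hT0.le]
    exact mul_le_mul_of_nonneg_left (Real.rpow_le_rpow_of_nonpos (by positivity) hn1 he) hT0.le
  have h3 : T / T₀ * n ^ (2 * σ) ≤ 2 * T ^ (2 * σ - ε ^ 2) := by
    have h4 : T / T₀ ≤ 1 + T * n ^ (-(2 - 26 * σ / 7)) := by
      have h5 : 0 ≤ T * n ^ (-(2 - 26 * σ / 7)) := by positivity
      rcases min_choice T (n ^ (2 - 26 * σ / 7)) with h | h
      · rw [hT₀, h, div_self hT0.ne']; linarith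
      · rw [hT₀, h, Real.rpow_neg hn0.le, div_eq_mul_inv]; linarith
    have h6 : T * n ^ (-(2 - 26 * σ / 7)) * n ^ (2 * σ) ≤ T ^ (2 * σ - ε ^ 2) := by
      rw [mul_assoc, ← Real.rpow_add hn0]
      refine (hneg (by linarith)).trans (Real.rpow_le_rpow_of_exponent_le hT ?_)
      refine le_trans (le_of_eq ?_) (one_add_mul_le_first hε hε1 hσ)
      ring
    calc _ ≤ (1 + T * n ^ (-(2 - 26 * σ / 7))) * n ^ (2 * σ) := by gcongr
      _ = n ^ (2 * σ) + T * n ^ (-(2 - 26 * σ / 7)) * n ^ (2 * σ) := by ring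
      _ ≤ _ := by linarith
  have h7 : T / T₀ * (T₀ / (V ^ 56 * n ^ 14)) ≤ T ^ (2 * σ - ε ^ 2) := by
    rw [e2, div_mul_div_cancel₀ hT₀0.ne', div_eq_mul_inv, ← Real.rpow_neg hn0.le]
    push_cast
    refine (hneg (by linarith)).trans (Real.rpow_le_rpow_of_exponent_le hT ?_)
    refine le_trans (le_of_eq ?_) (one_add_mul_le_second hε hε1 hσ)
    ring
  calc _ = T / T₀ * n ^ (2 * σ) + T / T₀ * (T₀ / (V ^ 56 * n ^ 14)) +
        T / T₀ * (T₀ ^ 7 / (V ^ 28 * n ^ 14)) := by rw [e1]; ring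
    _ ≤ 2 * T ^ (2 * σ - ε ^ 2) + T ^ (2 * σ - ε ^ 2) + 2 * T ^ (2 * σ - ε ^ 2) := by
        have h8 := (mul_le_mul_of_nonneg_left h1 (div_pos hT0 hT₀0).le).trans h3
        linarith
    _ = _ := by ring

/-- A "density hypothesis"-strength large value estimate for Dirichlet polynomials
with divisor-bounded coefficients (via Jutila's large values theorem with `k = 7`). -/
theorem stmt11 :
    ∃ ε₀ : ℝ, 0 < ε₀ ∧ ∀ ε : ℝ, 0 < ε → ε ≤ ε₀ →
      ∀ B C₀ : ℝ, 0 ≤ B → 0 < C₀ →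
      ∃ C : ℝ, 0 < C ∧ ∀ (T : ℝ) (N : ℕ) (a : ℕ → ℂ) (σ : ℝ),
        2 ≤ N → (N : ℝ) ≤ T →
        T ^ ((9 : ℝ)/11 - 10 * ε) ≤ (N : ℝ) → (N : ℝ) ≤ T ^ (1 - ε/10) →
        (∀ n, ‖a n‖ ≤ C₀ * (n.divisors.card : ℝ) ^ B) →
        5 * ε ≤ σ → σ ≤ 49/206 - 5 * ε →
        (volume {t : ℝ | t ∈ Set.Icc (-T) T ∧
            (N : ℝ) ^ (-σ) <
              ‖∑ n ∈ Finset.Ioc N (2 * N),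
                  a n * (n : ℂ) ^ (-(1 : ℂ) - Complex.I * (t : ℂ))‖}).toReal ≤
          C * T ^ (2 * σ - ε ^ 2 / 5) := by
  refine ⟨1 / 100, by norm_num, ?_⟩
  intro ε hε hε1 B C₀ hB hC₀
  set κ := ε ^ 2 / 80 with hκ
  have hκ0 : 0 < κ := by positivity
  have hκ1 : κ ≤ 1 / 100 := by rw [hκ]; nlinarith
  obtain ⟨K, hK, hcoef⟩ := exists_norm_div_le hκ0 (by linarith) hB hC₀
  obtain ⟨C, hC, hLV⟩ := exists_measure_le hκ0 (by linarith)
  have hK0 : 0 < K := by linarith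
  obtain ⟨n₀, hn₀⟩ := Filter.eventually_atTop.1 <|
    (tendsto_rpow_atTop (show (0 : ℝ) < 1 / 100 by norm_num)).eventually_gt_atTop (C * K ^ 28)
  have hpos : 0 < 15 * C * K ^ 56 := by positivity
  refine ⟨15 * C * K ^ 56 + 2 * n₀ ^ 2, by positivity, ?_⟩
  intro T N a σ hN hNT hN1 hN2 ha hσ0 hσ
  have hn2 : (2 : ℝ) ≤ N := by exact_mod_cast hN
  have hn1 : (1 : ℝ) ≤ N := by linarith
  have hn0 : (0 : ℝ) < N := by linarith
  have hT1 : 1 ≤ T := by linarith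
  have hT0 : 0 < T := by linarith
  set F : ℝ → ℂ := fun t => ∑ n ∈ Ioc N (2 * N), (a n * (n : ℂ)⁻¹) * osc n (-t) with hF
  have hFc : Continuous F := by fun_prop
  have hFe : ∀ t : ℝ, ∑ n ∈ Ioc N (2 * N), a n * (n : ℂ) ^ (-(1 : ℂ) - Complex.I * (t : ℂ)) =
      F t := fun t => by
    refine sum_congr rfl fun n hn => ?_
    rw [mem_Ioc] at hn
    rw [cpow_neg_one_sub_I_mul n (by omega), mul_assoc]
  simp_rw [hFe]
  set V : ℝ := (N : ℝ) ^ (-σ) with hV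
  have hV0 : 0 < V := by positivity
  set E : Set ℝ := {t : ℝ | t ∈ Set.Icc (-T) T ∧ V < ‖F t‖} with hE
  change volume.real E ≤ _
  have hEsub : E ⊆ Set.Icc (-T) T := fun t ht => ht.1
  have hEm : MeasurableSet E :=
    measurableSet_Icc.inter (isOpen_lt continuous_const hFc.norm).measurableSet
  have hTN : T ≤ (N : ℝ) ^ (2 : ℝ) := by
    calc T = T ^ (1 : ℝ) := (Real.rpow_one _).symm
      _ ≤ T ^ (((9 : ℝ) / 11 - 10 * ε) * 2) := Real.rpow_le_rpow_of_exponent_le hT1 (by linarith)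
      _ = (T ^ ((9 : ℝ) / 11 - 10 * ε)) ^ (2 : ℝ) := Real.rpow_mul hT0.le _ _
      _ ≤ _ := by gcongr
  rcases lt_or_ge (N : ℝ) n₀ with hsmall | hlarge
  · have h1 : 1 ≤ T ^ (2 * σ - ε ^ 2 / 5) := Real.one_le_rpow hT1 (by nlinarith)
    have h2 : volume.real E ≤ 2 * T := by
      refine (measureReal_mono hEsub measure_Icc_lt_top.ne).trans (le_of_eq ?_)
      rw [Real.volume_real_Icc_of_le (by linarith)]
      ring
    have h3 : T ≤ n₀ ^ 2 := by
      rw [Real.rpow_two] at hTN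
      exact hTN.trans (by gcongr)
    calc volume.real E ≤ 2 * n₀ ^ 2 := by linarith
      _ ≤ 15 * C * K ^ 56 + 2 * n₀ ^ 2 := by linarith
      _ ≤ _ := le_mul_of_one_le_right (by positivity) h1
  set T₀ := min T ((N : ℝ) ^ (2 - 26 * σ / 7)) with hT₀
  have hNT₀ : (N : ℝ) ≤ T₀ := by
    refine le_min hNT ?_
    calc (N : ℝ) = (N : ℝ) ^ (1 : ℝ) := (Real.rpow_one _).symm
      _ ≤ _ := Real.rpow_le_rpow_of_exponent_le hn1 (by linarith)
  have hT₀1 : 1 ≤ T₀ := by linarith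
  have hT₀0 : 0 < T₀ := by linarith
  have hT₀T : T₀ ≤ T := min_le_left _ _
  set A := K * (N : ℝ) ^ κ with hA
  have hNκ : 1 ≤ (N : ℝ) ^ κ := Real.one_le_rpow hn1 hκ0.le
  have hA1 : 1 ≤ A := one_le_mul_of_one_le_of_one_le hK hNκ
  have hbig : C * K ^ 28 < (N : ℝ) ^ (1 / 100 : ℝ) := hn₀ N hlarge
  have hAk : ∀ k : ℕ, A ^ k = K ^ k * (N : ℝ) ^ (k * κ) := fun k => by
    rw [hA, mul_pow, ← Real.rpow_natCast ((N : ℝ) ^ κ), ← Real.rpow_mul hn0.le, mul_comm κ]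
  have hVk : ∀ k : ℕ, V ^ k = (N : ℝ) ^ (-(k * σ)) := fun k => by
    rw [hV, ← Real.rpow_natCast, ← Real.rpow_mul hn0.le]
    congr 1; ring
  have hc1 : C * A ^ 2 < V ^ 2 * N := by
    rw [hAk, hVk]
    calc C * (K ^ 2 * (N : ℝ) ^ (((2 : ℕ) : ℝ) * κ)) ≤
          C * K ^ 28 * (N : ℝ) ^ (((2 : ℕ) : ℝ) * κ) := by
          rw [← mul_assoc]
          gcongr
          norm_num
      _ < (N : ℝ) ^ (1 / 100 : ℝ) * (N : ℝ) ^ (((2 : ℕ) : ℝ) * κ) := by gcongr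
      _ = (N : ℝ) ^ (1 / 100 + ((2 : ℕ) : ℝ) * κ) := (Real.rpow_add hn0 _ _).symm
      _ ≤ (N : ℝ) ^ (-(((2 : ℕ) : ℝ) * σ) + 1) :=
          Real.rpow_le_rpow_of_exponent_le hn1 (by push_cast; linarith)
      _ = _ := by rw [Real.rpow_add hn0, Real.rpow_one]
  have hc2 : C * A ^ 28 * T₀ ^ κ < V ^ 28 * (N : ℝ) ^ 7 := by
    rw [hAk, hVk]
    have hT₀κ : T₀ ^ κ ≤ (N : ℝ) ^ (2 * κ) := by
      rw [Real.rpow_mul hn0.le]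
      gcongr
      exact hT₀T.trans hTN
    calc C * (K ^ 28 * (N : ℝ) ^ (((28 : ℕ) : ℝ) * κ)) * T₀ ^ κ ≤
          C * K ^ 28 * (N : ℝ) ^ (((28 : ℕ) : ℝ) * κ) * (N : ℝ) ^ (2 * κ) := by
          rw [← mul_assoc]
          gcongr
      _ < (N : ℝ) ^ (1 / 100 : ℝ) * (N : ℝ) ^ (((28 : ℕ) : ℝ) * κ) * (N : ℝ) ^ (2 * κ) := by
          gcongr
      _ = (N : ℝ) ^ (1 / 100 + ((28 : ℕ) : ℝ) * κ + 2 * κ) := by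
          rw [← Real.rpow_add hn0, ← Real.rpow_add hn0]
      _ ≤ (N : ℝ) ^ (-(((28 : ℕ) : ℝ) * σ) + ((7 : ℕ) : ℝ)) := by
          refine Real.rpow_le_rpow_of_exponent_le hn1 ?_
          push_cast
          rw [hκ]
          nlinarith
      _ = _ := by rw [Real.rpow_add hn0, Real.rpow_natCast]
  set S := 1 / V ^ 2 + T₀ / (V ^ 56 * (N : ℝ) ^ 14) + T₀ ^ 7 / (V ^ 28 * (N : ℝ) ^ 14) with hS
  have hloc : ∀ x, volume.real (E ∩ Set.Icc x (x + T₀)) ≤ C * A ^ 56 * T₀ ^ (8 * κ) * S := by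
    intro x
    have hm : MeasurableSet (E ∩ Set.Icc x (x + T₀)) := hEm.inter measurableSet_Icc
    have hfin : IsFiniteMeasure (volume.restrict (E ∩ Set.Icc x (x + T₀))) :=
      isFiniteMeasure_restrict.2 fun h =>
        measure_Icc_lt_top.ne (measure_mono_top Set.inter_subset_right h)
    have h1 := hLV T₀ (volume.restrict (E ∩ Set.Icc x (x + T₀))) N (fun n => a n * (n : ℂ)⁻¹) A V
      hT₀1 ⟨Measure.restrict_le_self, x, (ae_restrict_mem hm).mono fun t ht => ht.2⟩
      (by omega) hNT₀ hA1 hV0 (hcoef a N (by omega) ha)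
      ((ae_restrict_mem hm).mono fun t ht => ht.1.2.le) hc1 hc2
    rwa [measureReal_restrict_apply_univ] at h1
  have hmain := main_terms_le hε hε1 hσ0 hσ hT1 hn1 hN1 hN2 hT₀ hV
  have hAT : A ^ 56 * T₀ ^ (8 * κ) ≤ K ^ 56 * T ^ (4 / 5 * ε ^ 2) := by
    rw [hAk]
    calc K ^ 56 * (N : ℝ) ^ (((56 : ℕ) : ℝ) * κ) * T₀ ^ (8 * κ) ≤
          K ^ 56 * T ^ (((56 : ℕ) : ℝ) * κ) * T ^ (8 * κ) := by gcongr
      _ = _ := by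
          rw [mul_assoc, ← Real.rpow_add hT0]
          congr 2
          rw [hκ]; push_cast; ring
  have hS0 : 0 ≤ T / T₀ * S := by positivity
  calc volume.real E ≤ 3 * (T / T₀) * (C * A ^ 56 * T₀ ^ (8 * κ) * S) :=
        measureReal_le_of_forall_inter_Icc_le hT₀0 hT₀T hEsub hloc
    _ = 3 * C * (A ^ 56 * T₀ ^ (8 * κ)) * (T / T₀ * S) := by ring
    _ ≤ 3 * C * (K ^ 56 * T ^ (4 / 5 * ε ^ 2)) * (5 * T ^ (2 * σ - ε ^ 2)) := by gcongr
    _ = 15 * C * K ^ 56 * (T ^ (4 / 5 * ε ^ 2) * T ^ (2 * σ - ε ^ 2)) := by ring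
    _ = 15 * C * K ^ 56 * T ^ (2 * σ - ε ^ 2 / 5) := by
        rw [← Real.rpow_add hT0]
        congr 2; ring
    _ ≤ _ := by
        gcongr
        have : 0 ≤ 2 * n₀ ^ 2 := by positivity
        linarith
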